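/- In the non-uniform case (not all p_j equal) with ρ > 1, for every integer m ≥ 0 the m-th central moment of the size S_n of a random G-trie built from n labelings satisfies E[(S_n - E(S_n))^m] = g_m · c^{m/2} · (Σ_{β ∈ S_ρ} β G_E(β) n^{β-1})^m · n^{m/2} + o(n^{(ρ-1/2)m}) as n → ∞, where c = (M-1)/(M·P(2ρ-1)) - 1 > 0 and g_m is the m-th moment of the standard normal distribution (g_m = m!/(2^{m/2}(m/2)!) for even m, g_m = 0 for odd m). -/

import Mathlib

open MeasureTheory ProbabilityTheory Filter Topology

/-- A word `w` over `{1,…,M}×{1,…,A}` occurs in the labeling `L` of the infinite rooted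
`M`-ary tree (nodes are identified with words over `Fin M`; the value of `L` on the root `[]`
is irrelevant) if along the path determined by the first components the labels are the
second components. -/
def Occurs {M A : ℕ} (L : List (Fin M) → Fin A) (w : List (Fin M × Fin A)) : Prop :=
  ∀ t : Fin w.length, L ((w.take (t.1 + 1)).map Prod.fst) = (w.get t).2

/-- The number of labelings among `Ls` in which the word `w` occurs. -/
noncomputable def occCount {M A n : ℕ} (Ls : Fin n → List (Fin M) → Fin A)
    (w : List (Fin M × Fin A)) : ℕ :=
  Nat.card {i : Fin n // Occurs (Ls i) w}

/-- The G-trie built from the labelings `Ls`: all words occurring in at least two of them. -/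
def GTrie {M A n : ℕ} (Ls : Fin n → List (Fin M) → Fin A) : Set (List (Fin M × Fin A)) :=
  {w | 2 ≤ occCount Ls w}

/-- The size of the G-trie built from the labelings `Ls` (as a real number). -/
noncomputable def gtrieSize {M A n : ℕ} (Ls : Fin n → List (Fin M) → Fin A) : ℝ :=
  (GTrie Ls).ncard

/-- `μL` is the distribution of a random labeling of the infinite rooted `M`-ary tree where
all labels are independent with `P(letter = j) = p j`: every finite cylinder set has the
product probability. -/
def IsLabelingMeasure {M A : ℕ} (p : Fin A → ℝ) (μL : Measure (List (Fin M) → Fin A)) : Prop :=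
  ∀ (s : Finset (List (Fin M))) (f : List (Fin M) → Fin A),
    μL {L | ∀ w ∈ s, L w = f w} = ∏ w ∈ s, ENNReal.ofReal (p (f w))

/-- `P(s) = 1 - M ∑_j p_j ^ s` for complex `s`. -/
noncomputable def Pfun (M A : ℕ) (p : Fin A → ℝ) (s : ℂ) : ℂ :=
  1 - (M : ℂ) * ∑ j, (p j : ℂ) ^ s

/-- `G_E(s) = (1-s)Γ(-s)/(M ∑_j p_j^s log p_j)`. -/
noncomputable def GE (M A : ℕ) (p : Fin A → ℝ) (s : ℂ) : ℂ :=
  (1 - s) * Complex.Gamma (-s) / ((M : ℂ) * ∑ j, (p j : ℂ) ^ s * (Real.log (p j) : ℂ))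

/-- The roots of `P` with real part equal to `ρ`. -/
def rootsLine (M A : ℕ) (p : Fin A → ℝ) (ρ : ℝ) : Set ℂ :=
  {s | Pfun M A p s = 0 ∧ s.re = ρ}

/-- `g_m`, the `m`-th moment of the standard normal distribution. -/
noncomputable def gaussianMoment (m : ℕ) : ℝ :=
  if Even m then (m.factorial : ℝ) / (2 ^ (m / 2) * ((m / 2).factorial : ℝ)) else 0


open MeasureTheory ProbabilityTheory Filter Topology

namespace GT

/-- Expectation of `f` under the binomial distribution with parameters `x`, `p`. -/
noncomputable def Bop (p : ℝ) : ℕ → (ℕ → ℝ) → ℝ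
  | 0, f => f 0
  | x + 1, f => p * Bop p x (fun k => f (k + 1)) + (1 - p) * Bop p x f

lemma Bop_add (p : ℝ) (x : ℕ) (f g : ℕ → ℝ) :
    Bop p x (fun k => f k + g k) = Bop p x f + Bop p x g := by
  induction x generalizing f g with
  | zero => simp [Bop]
  | succ x ih => simp only [Bop, ih]; ring

lemma Bop_mul (p c : ℝ) (x : ℕ) (f : ℕ → ℝ) :
    Bop p x (fun k => c * f k) = c * Bop p x f := by
  induction x generalizing f with
  | zero => simp [Bop]
  | succ x ih => simp only [Bop, ih]; ring

lemma Bop_const (p c : ℝ) (x : ℕ) : Bop p x (fun _ => c) = c := by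
  induction x with
  | zero => simp [Bop]
  | succ x ih => simp only [Bop, ih]; ring

lemma Bop_sum {ι : Type*} (s : Finset ι) (p : ℝ) (x : ℕ) (f : ι → ℕ → ℝ) :
    Bop p x (fun k => ∑ i ∈ s, f i k) = ∑ i ∈ s, Bop p x (f i) := by
  classical
  induction s using Finset.induction_on with
  | empty => simpa using Bop_const p 0 x
  | insert a s ha ih => simp only [Finset.sum_insert ha, Bop_add, ih]

lemma Bop_mono {p : ℝ} (h0 : 0 ≤ p) (h1 : p ≤ 1) (x : ℕ) (f g : ℕ → ℝ)
    (h : ∀ k ≤ x, f k ≤ g k) : Bop p x f ≤ Bop p x g := by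
  induction x generalizing f g with
  | zero => simpa [Bop] using h 0 le_rfl
  | succ x ih =>
    simp only [Bop]
    have := ih (fun k => f (k + 1)) (fun k => g (k + 1)) (fun k hk => h _ (by omega))
    have := ih f g (fun k hk => h _ (by omega))
    have : 0 ≤ 1 - p := by linarith
    gcongr

lemma Bop_nonneg {p : ℝ} (h0 : 0 ≤ p) (h1 : p ≤ 1) (x : ℕ) (f : ℕ → ℝ)
    (h : ∀ k ≤ x, 0 ≤ f k) : 0 ≤ Bop p x f := by
  rw [← Bop_const p 0 x]
  exact Bop_mono h0 h1 x _ _ h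

lemma Bop_id (p : ℝ) (x : ℕ) : Bop p x (fun k => (k : ℝ)) = x * p := by
  induction x with
  | zero => simp [Bop]
  | succ x ih =>
    simp only [Bop, Nat.cast_add, Nat.cast_one, Bop_add, ih, Bop_const]; ring

lemma Bop_sq (p : ℝ) (x : ℕ) : Bop p x (fun k => (k : ℝ) ^ 2) = x * p * (1 - p) + (x * p) ^ 2 := by
  induction x with
  | zero => simp [Bop]
  | succ x ih =>
    have e : (fun k : ℕ => ((k + 1 : ℕ) : ℝ) ^ 2)
        = fun k : ℕ => ((k : ℝ) ^ 2 + (2 * (k : ℝ) + 1)) := by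
      funext k; push_cast; ring
    simp only [Bop, e, Bop_add, Bop_mul, ih, Bop_const, Bop_id]; push_cast; ring

lemma Bop_var (p : ℝ) (x : ℕ) :
    Bop p x (fun k => ((k : ℝ) - x * p) ^ 2) = x * p * (1 - p) := by
  have e : (fun k : ℕ => ((k : ℝ) - x * p) ^ 2)
      = fun k : ℕ => ((k : ℝ) ^ 2 + ((-2 * (x * p)) * (k : ℝ) + (x * p) ^ 2)) := by
    funext k; ring
  rw [e]
  simp only [Bop_add, Bop_mul, Bop_sq, Bop_const, Bop_id]; ring

/-- `x q (1-q)^(x-1)`. -/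
noncomputable def phi (q : ℝ) (x : ℕ) : ℝ := x * q * (1 - q) ^ (x - 1)

lemma Bop_pow (p r : ℝ) (x : ℕ) : Bop p x (fun k => r ^ k) = (1 - p + p * r) ^ x := by
  induction x with
  | zero => simp [Bop]
  | succ x ih =>
    have e : (fun k : ℕ => r ^ (k + 1)) = fun k : ℕ => r * r ^ k := by
      funext k; ring
    simp only [Bop, e, Bop_mul, ih]; ring

lemma Bop_phi (p q : ℝ) (x : ℕ) : Bop p x (phi q) = phi (q * p) x := by
  induction x with
  | zero => simp [Bop, phi]
  | succ x ih =>
    have e : (fun k : ℕ => phi q (k + 1)) = fun k : ℕ => ((1 - q) * phi q k + q * (1 - q) ^ k) := by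
      funext k
      rcases k with _ | k
      · simp [phi]
      · simp only [phi, Nat.add_sub_cancel]; push_cast; ring
    have h2 : Bop p x (fun k => (1 - q) ^ k) = (1 - q * p) ^ x := by
      rw [Bop_pow]; congr 1; ring
    simp only [Bop, e, Bop_add, Bop_mul, h2, ih]
    rcases x with _ | k
    · simp [phi, mul_comm]
    · simp only [phi, Nat.add_sub_cancel]; push_cast; ring

/-- Concave powers. -/
lemma Bop_rpow_le {p τ : ℝ} (h0 : 0 < p) (h1 : p ≤ 1) (hτ0 : 0 < τ) (hτ1 : τ ≤ 1) (x : ℕ) :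
    Bop p x (fun k => (k : ℝ) ^ τ) ≤ p ^ τ * (x : ℝ) ^ τ := by
  rcases Nat.eq_zero_or_pos x with rfl | hx
  · simp [Bop, Real.zero_rpow hτ0.ne']
  have hx' : (0 : ℝ) < x := by exact_mod_cast hx
  set t : ℝ := x * p with ht
  have htp : 0 < t := by positivity
  have hb : ∀ k : ℕ, (k : ℝ) ^ τ ≤ (t ^ τ * (1 - τ) + (t ^ τ * τ / t) * (k : ℝ)) := by
    intro k
    have hs : (-1 : ℝ) ≤ k / t - 1 := by
      have : 0 ≤ (k : ℝ) / t := by positivity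
      linarith
    have := rpow_one_add_le_one_add_mul_self hs hτ0.le hτ1
    rw [show 1 + ((k : ℝ) / t - 1) = k / t by ring, Real.div_rpow (by positivity) htp.le,
      div_le_iff₀ (by positivity)] at this
    calc (k : ℝ) ^ τ ≤ _ := this
      _ = _ := by field_simp; ring
  calc Bop p x (fun k => (k : ℝ) ^ τ)
      ≤ Bop p x (fun k => (t ^ τ * (1 - τ) + (t ^ τ * τ / t) * (k : ℝ))) :=
        Bop_mono h0.le h1 x _ _ (fun k _ => hb k)
    _ = t ^ τ := by
        simp only [Bop_add, Bop_mul, Bop_const, Bop_id, ← ht]; field_simp; ring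
    _ = p ^ τ * (x : ℝ) ^ τ := by rw [ht, Real.mul_rpow hx'.le h0.le, mul_comm]

/-- Convex powers. -/
lemma Bop_rpow_le' {p τ : ℝ} (h0 : 0 < p) (h1 : p ≤ 1) (hτ1 : 1 ≤ τ) {δ : ℝ} (hδ : 0 < δ)
    (x : ℕ) (hx : 1 ≤ x) :
    Bop p x (fun k => (k : ℝ) ^ τ) ≤ (p ^ τ + τ * δ + τ / (δ * x)) * (x : ℝ) ^ τ := by
  have hx' : (0 : ℝ) < x := by exact_mod_cast hx
  have hb : ∀ k ≤ x, (k : ℝ) ^ τ ≤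
      (x : ℝ) ^ τ * (p ^ τ + τ * δ) + ((x : ℝ) ^ τ * τ / δ / x ^ 2) * ((k : ℝ) - x * p) ^ 2 := by
    intro k hk
    have hk' : (k : ℝ) ≤ x := by exact_mod_cast hk
    set s : ℝ := k / x with hs
    have hs0 : 0 ≤ s := by positivity
    have hs1 : s ≤ 1 := by rw [hs, div_le_one hx']; exact hk'
    have key : s ^ τ ≤ p ^ τ + τ * |s - p| := by
      rcases hs0.eq_or_lt with h | hspos
      · rw [← h, Real.zero_rpow (by linarith)]; positivity
      have h := one_add_mul_self_le_rpow_one_add (s := p / s - 1) (by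
        have : 0 ≤ p / s := by positivity
        linarith) hτ1
      rw [show 1 + (p / s - 1) = p / s by ring, Real.div_rpow h0.le hs0,
        le_div_iff₀ (by positivity)] at h
      have e : (1 + τ * (p / s - 1)) * s ^ τ = s ^ τ - τ * ((s - p) * s ^ (τ - 1)) := by
        rw [Real.rpow_sub_one hspos.ne']; field_simp; ring
      rw [e] at h
      have h3 : (s - p) * s ^ (τ - 1) ≤ |s - p| := by
        have h4 : s ^ (τ - 1) ≤ 1 := Real.rpow_le_one hs0 hs1 (by linarith)
        have h5 : 0 ≤ s ^ (τ - 1) := by positivity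
        calc (s - p) * s ^ (τ - 1) ≤ |s - p| * s ^ (τ - 1) := by
              gcongr; exact le_abs_self _
          _ ≤ |s - p| * 1 := by gcongr
          _ = _ := mul_one _
      nlinarith
    have hab : |s - p| ≤ δ + (s - p) ^ 2 / δ := by
      rw [← sq_abs (s - p)]
      rcases le_total (|s - p|) δ with h | h
      · have : 0 ≤ |s - p| ^ 2 / δ := by positivity
        linarith
      · have : |s - p| ≤ |s - p| ^ 2 / δ := by
          rw [le_div_iff₀ hδ, sq]; gcongr
        linarith
    have e1 : (k : ℝ) = x * s := by rw [hs]; field_simp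
    rw [e1, Real.mul_rpow hx'.le hs0]
    calc (x : ℝ) ^ τ * s ^ τ ≤ (x : ℝ) ^ τ * (p ^ τ + τ * (δ + (s - p) ^ 2 / δ)) := by
          gcongr; exact key.trans (by gcongr)
      _ = _ := by field_simp; ring
  calc Bop p x (fun k => (k : ℝ) ^ τ) ≤ _ := Bop_mono h0.le h1 x _ _ hb
    _ = (x : ℝ) ^ τ * (p ^ τ + τ * δ) + ((x : ℝ) ^ τ * τ / δ / x ^ 2) * (x * p * (1 - p)) := by
        simp only [Bop_add, Bop_mul, Bop_const, Bop_var]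
    _ ≤ (x : ℝ) ^ τ * (p ^ τ + τ * δ) + ((x : ℝ) ^ τ * τ / δ / x ^ 2) * (x * 1 * (1 - 0)) := by
        gcongr
    _ = _ := by field_simp; ring

lemma Bop_rpow_eventually {p τ : ℝ} (h0 : 0 < p) (h1 : p ≤ 1) (hτ : 0 < τ) {δ : ℝ} (hδ : 0 < δ) :
    ∀ᶠ x : ℕ in atTop, Bop p x (fun k => (k : ℝ) ^ τ) ≤ (p ^ τ + δ) * (x : ℝ) ^ τ := by
  rcases le_total τ 1 with h | h
  · refine Eventually.of_forall fun x => (Bop_rpow_le h0 h1 hτ h x).trans ?_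
    gcongr; linarith
  · have hδ' : 0 < δ / (2 * τ) := by positivity
    have : Tendsto (fun x : ℕ => τ / (δ / (2 * τ) * (x : ℝ))) atTop (𝓝 0) :=
      Tendsto.div_atTop tendsto_const_nhds
        (tendsto_natCast_atTop_atTop.const_mul_atTop hδ')
    filter_upwards [this.eventually (gt_mem_nhds (half_pos hδ)), eventually_ge_atTop 1] with x hx hx1
    refine (Bop_rpow_le' h0 h1 h hδ' x hx1).trans ?_
    have : τ * (δ / (2 * τ)) = δ / 2 := by field_simp
    refine mul_le_mul_of_nonneg_right ?_ (by positivity)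
    linarith

end GT

open MeasureTheory ProbabilityTheory Filter Topology

namespace GT

/-- Standing assumptions. -/
structure Par (M A : ℕ) (p : Fin A → ℝ) (ρ : ℝ) : Prop where
  hM : 1 ≤ M
  p0 : ∀ j, 0 < p j
  p1 : ∀ j, p j < 1
  sum1 : ∑ j, p j = 1
  sum2 : (M : ℝ) * ∑ j, p j * p j < 1
  hρ : (M : ℝ) * ∑ j, p j ^ ρ = 1
  ρ1 : 1 < ρ
  ρ2 : ρ < 2
  nonunif : ∃ j₁ j₂, p j₁ ≠ p j₂

variable {M A : ℕ} {p : Fin A → ℝ} {ρ : ℝ}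

lemma Par.Mpos (h : Par M A p ρ) : (0 : ℝ) < M := by exact_mod_cast h.hM

lemma Par.nonempty (h : Par M A p ρ) : Nonempty (Fin A) := ⟨h.nonunif.choose⟩

/-- `M ∑ p^τ` is strictly less than one beyond `ρ`. -/
lemma Par.kappa_lt (h : Par M A p ρ) {τ : ℝ} (hτ : ρ < τ) : (M : ℝ) * ∑ j, p j ^ τ < 1 := by
  rw [← h.hρ]
  have := h.nonempty
  refine mul_lt_mul_of_pos_left ?_ h.Mpos
  exact Finset.sum_lt_sum_of_nonempty Finset.univ_nonempty
    fun j _ => Real.rpow_lt_rpow_of_exponent_gt (h.p0 j) (h.p1 j) hτ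

/-- `∑_{|w|<d} p_w ψ(y p_w)` with `ψ(y) = y e^{-y}`. -/
noncomputable def Fd (M : ℕ) {A : ℕ} (p : Fin A → ℝ) : ℕ → ℝ → ℝ
  | 0, _ => 0
  | d + 1, y => y * Real.exp (-y) + M * ∑ a, p a * Fd M p d (p a * y)

lemma Fd_nonneg (h : Par M A p ρ) (d : ℕ) {y : ℝ} (hy : 0 ≤ y) : 0 ≤ Fd M p d y := by
  induction d generalizing y with
  | zero => simp [Fd]
  | succ d ih =>
    simp only [Fd]
    have : ∀ a, 0 ≤ p a * Fd M p d (p a * y) := fun a =>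
      mul_nonneg (h.p0 a).le (ih (mul_nonneg (h.p0 a).le hy))
    have := Finset.sum_nonneg (s := Finset.univ) (fun a _ => this a)
    positivity

lemma Fd_mono (h : Par M A p ρ) (d : ℕ) {y : ℝ} (hy : 0 ≤ y) : Fd M p d y ≤ Fd M p (d + 1) y := by
  induction d generalizing y with
  | zero => exact Fd_nonneg h 1 hy
  | succ d ih =>
    rw [Fd.eq_2, Fd.eq_2]
    gcongr with a _
    · exact (h.p0 a).le
    · exact ih (mul_nonneg (h.p0 a).le hy)

/-- The bounded supersolution. -/
noncomputable def Lg (ε y : ℝ) : ℝ := y ^ ε / (1 + y ^ ε)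

lemma Lg_nonneg {ε y : ℝ} (hy : 0 ≤ y) : 0 ≤ Lg ε y := by unfold Lg; positivity

lemma Lg_le_one {ε y : ℝ} (hy : 0 ≤ y) : Lg ε y ≤ 1 := by
  unfold Lg
  have : 0 ≤ y ^ ε := by positivity
  rw [div_le_one (by positivity)]; linarith

lemma Lg_le {ε y : ℝ} (hy : 0 ≤ y) : Lg ε y ≤ y ^ ε := by
  unfold Lg
  have : 0 ≤ y ^ ε := by positivity
  exact div_le_self this (by linarith)

lemma Lg_diff {ε y r : ℝ} (hε : 0 < ε) (hy : 0 < y) (hr0 : 0 < r) (hr1 : r < 1) :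
    (1 - r ^ ε) * (y ^ ε / (1 + y ^ ε) ^ 2) ≤ Lg ε y - Lg ε (r * y) := by
  unfold Lg
  rw [Real.mul_rpow hr0.le hy.le]
  have h1 : 0 < y ^ ε := by positivity
  have h2 : 0 < r ^ ε := by positivity
  have h3 : r ^ ε < 1 := Real.rpow_lt_one hr0.le hr1 hε
  set Y := y ^ ε
  set R := r ^ ε
  rw [div_sub_div _ _ (by positivity) (by positivity), ← mul_div_assoc,
    div_le_div_iff₀ (by positivity) (by positivity)]
  have : Y * (1 + R * Y) - (1 + Y) * (R * Y) = (1 - R) * Y := by ring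
  rw [this]
  have : 0 ≤ (1 - R) * Y := mul_nonneg (by linarith) h1.le
  gcongr
  nlinarith [mul_pos h1 h1]

lemma Fd_le (h : Par M A p ρ) : ∃ C > 0, ∀ d, ∀ y > 0,
    Fd M p d y ≤ C * (y ^ (ρ - 1) * Lg (2 - ρ) y) := by
  have hε : 0 < 2 - ρ := by linarith [h.ρ2]
  have hε1 : 2 - ρ ≤ 1 := by linarith [h.ρ1]
  set S : ℝ := M * ∑ a, p a ^ ρ * (1 - p a ^ (2 - ρ)) with hS
  have := h.nonempty
  have hMpos := h.Mpos
  have hSpos : 0 < S := by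
    refine mul_pos h.Mpos (Finset.sum_pos (fun a _ => mul_pos (Real.rpow_pos_of_pos (h.p0 a) _) ?_)
      Finset.univ_nonempty)
    linarith [Real.rpow_lt_one (h.p0 a).le (h.p1 a) hε]
  refine ⟨4 / S, by positivity, fun d => ?_⟩
  induction d with
  | zero =>
    intro y hy
    have := Lg_nonneg (ε := 2 - ρ) hy.le
    simp only [Fd]; positivity
  | succ d ih =>
    intro y hy
    simp only [Fd]
    set Q : ℝ := y ^ (2 - ρ) with hQ
    have hQ0 : 0 < Q := by positivity
    have hyy : y = y ^ (ρ - 1) * Q := by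
      rw [hQ, ← Real.rpow_add hy]; norm_num
    have hQle : Q ≤ 1 + y := by
      rcases le_total y 1 with h1 | h1
      · have := Real.rpow_le_one hy.le h1 hε.le
        linarith
      · have := Real.rpow_le_rpow_of_exponent_le h1 hε1
        rw [Real.rpow_one] at this; linarith
    have hexp : (1 + Q) ^ 2 * Real.exp (-y) ≤ 4 := by
      rw [Real.exp_neg, ← div_eq_mul_inv, div_le_iff₀ (Real.exp_pos _)]
      have := Real.quadratic_le_exp_of_nonneg hy.le
      have : (1 + Q) ^ 2 ≤ (2 + y) ^ 2 :=
        pow_le_pow_left₀ (by positivity) (by linarith) 2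
      nlinarith
    have step1 : M * ∑ a, p a * Fd M p d (p a * y) ≤
        M * ∑ a, p a * (4 / S * ((p a * y) ^ (ρ - 1) * Lg (2 - ρ) (p a * y))) := by
      gcongr with a _
      · exact (h.p0 a).le
      · exact ih _ (mul_pos (h.p0 a) hy)
    have step2 : M * ∑ a, p a * (4 / S * ((p a * y) ^ (ρ - 1) * Lg (2 - ρ) (p a * y)))
        = 4 / S * y ^ (ρ - 1) * (M * ∑ a, p a ^ ρ * Lg (2 - ρ) (p a * y)) := by
      rw [Finset.mul_sum, Finset.mul_sum, Finset.mul_sum]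
      refine Finset.sum_congr rfl fun a _ => ?_
      rw [Real.mul_rpow (h.p0 a).le hy.le,
        show p a ^ ρ = p a * p a ^ (ρ - 1) by
          rw [Real.rpow_sub_one (h.p0 a).ne']; field_simp [(h.p0 a).ne']]
      ring
    have step3 : M * ∑ a, p a ^ ρ * Lg (2 - ρ) (p a * y) ≤
        Lg (2 - ρ) y - S * (Q / (1 + Q) ^ 2) := by
      have : M * ∑ a, p a ^ ρ * Lg (2 - ρ) (p a * y) ≤
          M * ∑ a, p a ^ ρ * (Lg (2 - ρ) y - (1 - p a ^ (2 - ρ)) * (Q / (1 + Q) ^ 2)) := by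
        gcongr with a _
        · exact (Real.rpow_pos_of_pos (h.p0 a) _).le
        · linarith [Lg_diff hε hy (h.p0 a) (h.p1 a)]
      refine this.trans (le_of_eq ?_)
      rw [hS]
      have e1 : M * ∑ a, p a ^ ρ * (Lg (2 - ρ) y - (1 - p a ^ (2 - ρ)) * (Q / (1 + Q) ^ 2))
        = (M * ∑ a, p a ^ ρ) * Lg (2 - ρ) y -
          (M * ∑ a, p a ^ ρ * (1 - p a ^ (2 - ρ))) * (Q / (1 + Q) ^ 2) := by
        simp only [Finset.mul_sum, Finset.sum_mul, ← Finset.sum_sub_distrib]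
        exact Finset.sum_congr rfl fun a _ => by ring
      rw [e1, h.hρ, one_mul]
    have step4 : y * Real.exp (-y) ≤ 4 / S * y ^ (ρ - 1) * (S * (Q / (1 + Q) ^ 2)) := by
      calc y * Real.exp (-y) = y ^ (ρ - 1) * Q * Real.exp (-y) := by rw [← hyy]
        _ = y ^ (ρ - 1) * Q / (1 + Q) ^ 2 * ((1 + Q) ^ 2 * Real.exp (-y)) := by field_simp
        _ ≤ y ^ (ρ - 1) * Q / (1 + Q) ^ 2 * 4 := by gcongr
        _ = _ := by field_simp
    have step5 := mul_le_mul_of_nonneg_left step3 (a := 4 / S * y ^ (ρ - 1)) (by positivity)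
    calc _ ≤ 4 / S * y ^ (ρ - 1) * (S * (Q / (1 + Q) ^ 2)) +
          4 / S * y ^ (ρ - 1) * (Lg (2 - ρ) y - S * (Q / (1 + Q) ^ 2)) := by
            linarith
      _ = _ := by ring

/-- The limit function. -/
noncomputable def FF (M : ℕ) {A : ℕ} (p : Fin A → ℝ) (y : ℝ) : ℝ := ⨆ d, Fd M p d y

lemma Fd_bdd (h : Par M A p ρ) {y : ℝ} (hy : 0 ≤ y) : BddAbove (Set.range fun d => Fd M p d y) := by
  rcases hy.eq_or_lt with rfl | hy
  · refine ⟨0, ?_⟩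
    rintro _ ⟨d, rfl⟩
    dsimp only
    induction d with
    | zero => simp [Fd]
    | succ d ih => simpa [Fd, ← Finset.sum_mul, h.sum1] using mul_nonpos_of_nonneg_of_nonpos (h.Mpos).le ih
  · obtain ⟨C, hC, hF⟩ := Fd_le h
    exact ⟨_, by rintro _ ⟨d, rfl⟩; exact hF d y hy⟩

lemma Fd_tendsto (h : Par M A p ρ) {y : ℝ} (hy : 0 ≤ y) :
    Tendsto (fun d => Fd M p d y) atTop (𝓝 (FF M p y)) :=
  tendsto_atTop_ciSup (monotone_nat_of_le_succ fun d => Fd_mono h d hy) (Fd_bdd h hy)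

lemma Fd_le_FF (h : Par M A p ρ) (d : ℕ) {y : ℝ} (hy : 0 ≤ y) : Fd M p d y ≤ FF M p y :=
  le_ciSup (Fd_bdd h hy) d

lemma FF_nonneg (h : Par M A p ρ) {y : ℝ} (hy : 0 ≤ y) : 0 ≤ FF M p y :=
  (Fd_nonneg h 0 hy).trans (Fd_le_FF h 0 hy)

lemma FF_le (h : Par M A p ρ) : ∃ C > 0, ∀ y > 0,
    FF M p y ≤ C * (y ^ (ρ - 1) * Lg (2 - ρ) y) := by
  obtain ⟨C, hC, hF⟩ := Fd_le h
  exact ⟨C, hC, fun y hy => ciSup_le fun d => hF d y hy⟩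

lemma FF_eq (h : Par M A p ρ) {y : ℝ} (hy : 0 ≤ y) :
    FF M p y = y * Real.exp (-y) + M * ∑ a, p a * FF M p (p a * y) := by
  refine tendsto_nhds_unique ((tendsto_add_atTop_iff_nat 1).2 (Fd_tendsto h hy)) ?_
  simp only [Fd]
  refine tendsto_const_nhds.add (Tendsto.const_mul _ (tendsto_finsetSum _ fun a _ => ?_))
  exact (Fd_tendsto h (mul_nonneg (h.p0 a).le hy)).const_mul _

lemma psi_lip {y z : ℝ} (hy : 0 < y) (hz : |z - y| ≤ y / 4) :
    |z * Real.exp (-z) - y * Real.exp (-y)| ≤ 12 * (|z - y| / y) * (y / 2 * Real.exp (-(y / 2))) := by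
  have hz' := abs_le.1 hz
  -- bound for the derivative
  have key : ∀ s ∈ Set.Icc (3 * y / 4) (5 * y / 4), ‖(1 - s) * Real.exp (-s)‖ ≤
      6 * Real.exp (-(y / 2)) := by
    intro s hs
    have h0 : 0 ≤ s := by linarith [hs.1]
    rw [norm_mul, Real.norm_eq_abs, Real.norm_eq_abs, abs_of_pos (Real.exp_pos _)]
    have h1 : |1 - s| ≤ 1 + s := by rw [abs_le]; constructor <;> linarith
    have h2 : 1 + s ≤ 6 * Real.exp (y / 4) := by
      have := Real.add_one_le_exp (y / 4)
      nlinarith [hs.2]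
    calc |1 - s| * Real.exp (-s) ≤ (6 * Real.exp (y / 4)) * Real.exp (-(3 * y / 4)) := by
          gcongr
          · exact h1.trans h2
          · exact hs.1
      _ = 6 * Real.exp (-(y / 2)) := by rw [mul_assoc, ← Real.exp_add]; ring_nf
  have hd : ∀ s ∈ Set.Icc (3 * y / 4) (5 * y / 4),
      HasDerivWithinAt (fun s => s * Real.exp (-s)) ((1 - s) * Real.exp (-s))
        (Set.Icc (3 * y / 4) (5 * y / 4)) s := by
    intro s _
    have h1 : HasDerivAt (fun s : ℝ => s * Real.exp (-s))
        (1 * Real.exp (-s) + s * (Real.exp (-s) * (-1))) s :=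
      (hasDerivAt_id s).mul ((Real.hasDerivAt_exp (-s)).comp s (hasDerivAt_neg s))
    exact (h1.congr_deriv (by ring)).hasDerivWithinAt
  have := (convex_Icc (3 * y / 4) (5 * y / 4)).norm_image_sub_le_of_norm_hasDerivWithin_le
    hd key (x := y) (y := z) ⟨by linarith, by linarith⟩ ⟨by linarith, by linarith⟩
  rw [Real.norm_eq_abs, Real.norm_eq_abs] at this
  refine this.trans (le_of_eq ?_)
  field_simp; ring

lemma Fd_lip (h : Par M A p ρ) (d : ℕ) {y z : ℝ} (hy : 0 < y) (hz : |z - y| ≤ y / 4) :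
    |Fd M p d z - Fd M p d y| ≤ 12 * (|z - y| / y) * Fd M p d (y / 2) := by
  induction d generalizing y z with
  | zero => simp [Fd]
  | succ d ih =>
    simp only [Fd]
    have h1 := psi_lip hy hz
    have h2 : ∀ a, |p a * Fd M p d (p a * z) - p a * Fd M p d (p a * y)| ≤
        12 * (|z - y| / y) * (p a * Fd M p d (p a * (y / 2))) := by
      intro a
      have hp := h.p0 a
      have e : p a * z - p a * y = p a * (z - y) := by ring
      have := ih (y := p a * y) (z := p a * z) (by positivity) (by
        rw [e, abs_mul, abs_of_pos hp, mul_div_assoc]; gcongr)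
      rw [e, abs_mul, abs_of_pos hp, mul_div_mul_left _ _ hp.ne'] at this
      rw [← mul_sub, abs_mul, abs_of_pos hp]
      calc p a * |Fd M p d (p a * z) - Fd M p d (p a * y)| ≤ _ :=
            mul_le_mul_of_nonneg_left this hp.le
        _ = _ := by rw [mul_div_assoc]; ring
    have h3 : |∑ a, p a * Fd M p d (p a * z) - ∑ a, p a * Fd M p d (p a * y)| ≤
        12 * (|z - y| / y) * ∑ a, p a * Fd M p d (p a * (y / 2)) := by
      rw [← Finset.sum_sub_distrib, Finset.mul_sum]
      exact (Finset.abs_sum_le_sum_abs _ _).trans (Finset.sum_le_sum fun a _ => h2 a)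
    have h4 : |(M : ℝ) * ∑ a, p a * Fd M p d (p a * z) - M * ∑ a, p a * Fd M p d (p a * y)| ≤
        M * (12 * (|z - y| / y) * ∑ a, p a * Fd M p d (p a * (y / 2))) := by
      rw [← mul_sub, abs_mul, abs_of_pos h.Mpos]
      exact mul_le_mul_of_nonneg_left h3 h.Mpos.le
    calc _ = |(z * Real.exp (-z) - y * Real.exp (-y)) +
          ((M : ℝ) * ∑ a, p a * Fd M p d (p a * z) - M * ∑ a, p a * Fd M p d (p a * y))| := by
            congr 1; ring
      _ ≤ _ := (abs_add_le _ _).trans (add_le_add h1 h4)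
      _ = _ := by ring

lemma FF_lip (h : Par M A p ρ) {y z : ℝ} (hy : 0 < y) (hz : |z - y| ≤ y / 4) :
    |FF M p z - FF M p y| ≤ 12 * (|z - y| / y) * FF M p (y / 2) := by
  have hz0 : 0 ≤ z := by have := abs_le.1 hz; linarith
  refine le_of_tendsto_of_tendsto' (((Fd_tendsto h hz0).sub (Fd_tendsto h hy.le)).abs)
    ((Fd_tendsto h (by positivity : 0 ≤ y / 2)).const_mul _) fun d => Fd_lip h d hy hz

/-- `E U_x` at depth `d`. -/
noncomputable def ud (M : ℕ) {A : ℕ} (p : Fin A → ℝ) : ℕ → ℕ → ℝ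
  | 0, _ => 0
  | d + 1, x => (if x = 1 then 1 else 0) + M * ∑ a, p a * Bop (p a) x (ud M p d)

noncomputable def Phid (M : ℕ) {A : ℕ} (p : Fin A → ℝ) : ℕ → ℝ → ℕ → ℝ
  | 0, _, _ => 0
  | d + 1, q, x => phi q x + M * ∑ a, p a * Phid M p d (q * p a) x

lemma Bop_Phid (r q : ℝ) (d x : ℕ) :
    Bop r x (Phid M p d q) = Phid M p d (q * r) x := by
  induction d generalizing q with
  | zero => exact Bop_const r 0 x
  | succ d ih =>
    have e : Phid M p (d + 1) q = fun x => phi q x + M * ∑ a, p a * Phid M p d (q * p a) x := by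
      funext x; rfl
    rw [e]
    simp only [Bop_add, Bop_mul, Bop_sum, Bop_phi]
    simp only [Phid]
    congr 2
    refine Finset.sum_congr rfl fun a _ => ?_
    have : Bop r x (fun k => Phid M p d (q * p a) k) = Bop r x (Phid M p d (q * p a)) := rfl
    rw [ih, mul_right_comm]

lemma ud_eq (d x : ℕ) : ud M p d x = Phid M p d 1 x := by
  induction d generalizing x with
  | zero => rfl
  | succ d ih =>
    have : ud M p d = Phid M p d 1 := funext ih
    simp only [ud, Phid, this, Bop_Phid]
    congr 1
    simp only [phi]
    rcases x with _ | _ | x <;> simp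

lemma phi_psi {q : ℝ} (hq0 : 0 < q) (hq1 : q ≤ 1) (x : ℕ) :
    |phi q x - q * x * Real.exp (-(q * x))| ≤ 6 * q := by
  rcases Nat.eq_zero_or_pos x with rfl | hx
  · simp [phi]; positivity
  obtain ⟨k, rfl⟩ : ∃ k, x = k + 1 := ⟨x - 1, by omega⟩
  set t : ℝ := q * ((k + 1 : ℕ) : ℝ) with ht
  have ht0 : 0 < t := by positivity
  have ha : 1 - q ≤ Real.exp (-q) := by linarith [Real.add_one_le_exp (-q)]
  have hb : Real.exp (-q) - (1 - q) ≤ q ^ 2 := by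
    have h1 : Real.exp (-q) ≤ 1 / (1 + q) := by
      rw [Real.exp_neg, ← one_div]
      have := Real.add_one_le_exp q
      gcongr; linarith
    have : 1 / (1 + q) ≤ 1 - q + q ^ 2 := by
      rw [div_le_iff₀ (by positivity)]
      nlinarith [pow_pos hq0 3]
    linarith
  have hq' : 0 ≤ 1 - q := by linarith
  have he3 : Real.exp q ≤ 3 := by
    have := Real.exp_le_exp.2 hq1
    linarith [Real.exp_one_lt_d9]
  have hepow : Real.exp (-q) ^ k = Real.exp (-t) * Real.exp q := by
    rw [← Real.exp_nat_mul, ← Real.exp_add, ht]; push_cast; ring_nf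
  have hupper : (1 - q) ^ k ≤ Real.exp (-t) * Real.exp q := by
    rw [← hepow]; gcongr
  have h1 : t * Real.exp (-t) ≤ 1 := by
    have := Real.add_one_le_exp t
    rw [Real.exp_neg, ← div_eq_mul_inv, div_le_one (Real.exp_pos _)]; linarith
  have h2 : t ^ 2 * Real.exp (-t) ≤ 2 := by
    have := Real.quadratic_le_exp_of_nonneg ht0.le
    rw [Real.exp_neg, ← div_eq_mul_inv, div_le_iff₀ (Real.exp_pos _)]; linarith
  have h0 : 0 < Real.exp (-t) := Real.exp_pos _
  have hphi : phi q (k + 1) = t * (1 - q) ^ k := by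
    simp only [phi, Nat.add_sub_cancel]; rw [ht]; ring
  rw [hphi, ← mul_sub, abs_mul, abs_of_pos ht0]
  have hup : (1 - q) ^ k - Real.exp (-t) ≤ 2 * q * Real.exp (-t) := by
    have : Real.exp q - 1 ≤ 2 * q := by
      have := Real.abs_exp_sub_one_le (x := q) (by rw [abs_of_pos hq0]; exact hq1)
      rw [abs_of_pos hq0] at this
      exact (le_abs_self _).trans this
    nlinarith
  have hlow : Real.exp (-t) - (1 - q) ^ k ≤ t * q * Real.exp (-t) * 3 := by
    have e1 : Real.exp (-t) = Real.exp (-q) ^ (k + 1) := by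
      rw [pow_succ, hepow, mul_assoc, ← Real.exp_add]; simp
    have e2 : (1 - q) ^ (k + 1) ≤ (1 - q) ^ k := pow_le_pow_of_le_one hq' (by linarith) (by omega)
    have e3 : Real.exp (-q) ^ (k + 1) - (1 - q) ^ (k + 1) ≤
        (k + 1 : ℕ) * (Real.exp (-q) - (1 - q)) * Real.exp (-q) ^ k := by
      have := (Commute.all (Real.exp (-q)) (1 - q)).geom_sum₂_mul (k + 1)
      rw [← this]
      have hs : ∑ i ∈ Finset.range (k + 1), Real.exp (-q) ^ i * (1 - q) ^ (k + 1 - 1 - i) ≤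
          ∑ i ∈ Finset.range (k + 1), Real.exp (-q) ^ k := by
        refine Finset.sum_le_sum fun i hi => ?_
        have hi' : i ≤ k := by simpa [Nat.lt_succ_iff] using hi
        calc Real.exp (-q) ^ i * (1 - q) ^ (k + 1 - 1 - i)
            ≤ Real.exp (-q) ^ i * Real.exp (-q) ^ (k + 1 - 1 - i) := by gcongr
          _ = Real.exp (-q) ^ k := by rw [← pow_add]; congr 1; omega
      simp only [Finset.sum_const, Finset.card_range, nsmul_eq_mul] at hs
      have := mul_le_mul_of_nonneg_right hs (by linarith : 0 ≤ Real.exp (-q) - (1 - q))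
      linarith
    calc Real.exp (-t) - (1 - q) ^ k ≤ Real.exp (-q) ^ (k + 1) - (1 - q) ^ (k + 1) := by
          rw [← e1]; linarith
      _ ≤ _ := e3
      _ ≤ (k + 1 : ℕ) * q ^ 2 * (Real.exp (-t) * 3) := by
          rw [hepow]; gcongr
      _ = _ := by rw [ht]; ring
  have habs : |(1 - q) ^ k - Real.exp (-t)| ≤ (2 * q + 3 * q * t) * Real.exp (-t) := by
    rw [abs_le]
    have : 0 ≤ t * q * Real.exp (-t) * 3 := by positivity
    have : 0 ≤ 2 * q * Real.exp (-t) := by positivity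
    constructor <;> linarith
  have h3 := mul_le_mul_of_nonneg_left habs ht0.le
  -- refine the constant
  rcases le_total 0 ((1 - q) ^ k - Real.exp (-t)) with hs | hs
  · rw [abs_of_nonneg hs]
    have := mul_le_mul_of_nonneg_left hup ht0.le
    nlinarith
  · rw [abs_of_nonpos hs]
    have := mul_le_mul_of_nonneg_left hlow ht0.le
    nlinarith

lemma Phid_Fd (h : Par M A p ρ) : ∃ C > 0, ∀ d x, ∀ q : ℝ, 0 < q → q ≤ 1 →
    |Phid M p d q x - Fd M p d (q * x)| ≤ C * q := by
  set κ : ℝ := M * ∑ j, p j * p j with hκ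
  have hκ1 : κ < 1 := h.sum2
  have hκ1' : 0 < 1 - κ := by linarith
  refine ⟨6 / (1 - κ), by positivity, fun d => ?_⟩
  induction d with
  | zero => intro x q hq _; simp [Phid, Fd]; positivity
  | succ d ih =>
    intro x q hq0 hq1
    simp only [Phid, Fd]
    have h1 := phi_psi hq0 hq1 x
    have h2 : ∀ a, |p a * Phid M p d (q * p a) x - p a * Fd M p d (p a * (q * x))| ≤
        6 / (1 - κ) * q * (p a * p a) := by
      intro a
      have := ih x (q * p a) (mul_pos hq0 (h.p0 a)) (mul_le_one₀ hq1 (h.p0 a).le (h.p1 a).le)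
      rw [show q * p a * (x : ℝ) = p a * (q * x) by ring] at this
      rw [← mul_sub, abs_mul, abs_of_pos (h.p0 a)]
      calc _ ≤ _ := mul_le_mul_of_nonneg_left this (h.p0 a).le
        _ = _ := by ring
    have h3 : |∑ a, p a * Phid M p d (q * p a) x - ∑ a, p a * Fd M p d (p a * (q * x))| ≤
        6 / (1 - κ) * q * ∑ a, p a * p a := by
      rw [← Finset.sum_sub_distrib, Finset.mul_sum]
      exact (Finset.abs_sum_le_sum_abs _ _).trans (Finset.sum_le_sum fun a _ => h2 a)
    have h4 : |(M : ℝ) * ∑ a, p a * Phid M p d (q * p a) x - M * ∑ a, p a * Fd M p d (p a * (q * x))| ≤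
        6 / (1 - κ) * q * κ := by
      rw [← mul_sub, abs_mul, abs_of_pos h.Mpos]
      calc _ ≤ _ := mul_le_mul_of_nonneg_left h3 h.Mpos.le
        _ = _ := by rw [hκ]; ring
    calc _ = |(phi q x - q * x * Real.exp (-(q * x))) +
          ((M : ℝ) * ∑ a, p a * Phid M p d (q * p a) x - M * ∑ a, p a * Fd M p d (p a * (q * x)))| := by
            congr 1; ring
      _ ≤ _ := (abs_add_le _ _).trans (add_le_add h1 h4)
      _ = _ := by field_simp; ring

lemma ud_Fd (h : Par M A p ρ) : ∃ C > 0, ∀ d x, |ud M p d x - Fd M p d x| ≤ C := by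
  obtain ⟨C, hC, hF⟩ := Phid_Fd h
  refine ⟨C, hC, fun d x => ?_⟩
  have := hF d x 1 one_pos le_rfl
  rwa [one_mul, mul_one, ← ud_eq] at this

end GT

open MeasureTheory ProbabilityTheory Filter Topology

namespace GT

lemma ren_aux {ι : Type*} [Fintype ι] (q ℓ : ι → ℝ) (hq : ∀ a, 0 < q a) (hq1 : ∑ a, q a = 1)
    (f g : ℝ → ℝ) (B : ℝ) (hB : ∀ t, |f t| ≤ B) (hg : Tendsto g atTop (𝓝 0))
    (hf : ∀ t, f t = g t + ∑ a, q a * f (t - ℓ a)) (a : ι) {η : ℝ} (hη : 0 < η) :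
    ∀ᶠ t in atTop, f t - f (t - ℓ a) ≤ η := by
  set δ : ℝ → ℝ := fun t => f t - f (t - ℓ a) with hδ
  set h : ℝ → ℝ := fun t => g t - g (t - ℓ a) with hh
  have hh0 : Tendsto h atTop (𝓝 0) := by
    have := hg.sub (hg.comp (tendsto_atTop_add_const_right atTop (-ℓ a) tendsto_id))
    simpa [hh, sub_eq_add_neg, Function.comp_def] using this
  have hδeq : ∀ t, δ t = h t + ∑ b, q b * δ (t - ℓ b) := by
    intro t
    simp only [hδ, hh, mul_sub, Finset.sum_sub_distrib]
    rw [hf t, hf (t - ℓ a)]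
    have : ∀ b, t - ℓ b - ℓ a = t - ℓ a - ℓ b := fun b => by ring
    simp only [this]; ring
  have hδB : ∀ t, |δ t| ≤ 2 * B := fun t => by
    have := abs_sub (f t) (f (t - ℓ a)); have := hB t; have := hB (t - ℓ a)
    simp only [hδ]; linarith
  have hbdd : IsBoundedUnder (· ≤ ·) atTop δ := isBoundedUnder_of ⟨2 * B, fun t => (abs_le.1 (hδB t)).2⟩
  have hcob : IsCoboundedUnder (· ≤ ·) atTop δ :=
    (isBoundedUnder_of ⟨-(2 * B), fun t => (abs_le.1 (hδB t)).1⟩ : IsBoundedUnder (· ≥ ·) atTop δ).isCoboundedUnder_le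
  set Λ := limsup δ atTop with hΛ
  have hup : ∀ η > 0, ∀ᶠ t in atTop, δ t < Λ + η := fun η hη =>
    eventually_lt_of_limsup_lt (by linarith) hbdd
  have hqa1 : q a ≤ 1 := by
    rw [← hq1]; exact Finset.single_le_sum (fun b _ => (hq b).le) (Finset.mem_univ a)
  have hlow : ∀ j : ℕ, ∀ η > 0, ∃ᶠ t in atTop, ∀ i ≤ j, Λ - η < δ (t - i * ℓ a) := by
    intro j
    induction j with
    | zero =>
      intro η hη
      refine (frequently_lt_of_lt_limsup hcob (by linarith : Λ - η < limsup δ atTop)).mono fun t ht i hi => ?_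
      obtain rfl : i = 0 := by omega
      simpa using ht
    | succ j ih =>
      intro η hη
      set η1 := q a * η / 3 with hη1
      have hη1p : 0 < η1 := by have := hq a; positivity
      have e1 : ∀ c : ℝ, Tendsto (fun t : ℝ => t - c) atTop atTop := fun c =>
        tendsto_atTop_add_const_right atTop (-c) tendsto_id
      have hev : ∀ᶠ t in atTop, |h (t - j * ℓ a)| < η1 ∧ ∀ b, δ (t - j * ℓ a - ℓ b) < Λ + η1 := by
        refine Eventually.and ?_ ?_
        · have := (hh0.comp (e1 (j * ℓ a))).abs
          rw [abs_zero] at this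
          exact this.eventually (gt_mem_nhds hη1p)
        · rw [eventually_all]; intro b
          exact ((e1 (ℓ b)).comp (e1 (j * ℓ a))).eventually (hup η1 hη1p)
      refine ((ih η1 hη1p).and_eventually hev).mono ?_
      rintro t ⟨h1, h2, h3⟩ i hi
      rcases Nat.lt_or_ge i (j + 1) with hij | hij
      · have := h1 i (by omega)
        have : η1 ≤ η := by rw [hη1]; nlinarith
        linarith [h1 i (by omega)]
      · obtain rfl : i = j + 1 := by omega
        have h4 := h1 j le_rfl
        rw [hδeq] at h4
        have h5 : ∑ b, q b * δ (t - j * ℓ a - ℓ b) ≤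
            q a * δ (t - j * ℓ a - ℓ a) + (1 - q a) * (Λ + η1) := by
          classical
          rw [← hq1, ← Finset.add_sum_erase _ _ (Finset.mem_univ a),
            ← Finset.add_sum_erase Finset.univ q (Finset.mem_univ a), add_sub_cancel_left, Finset.sum_mul]
          gcongr with b hb
          · exact (hq b).le
          · exact (h3 b).le
        have h6 := (abs_lt.1 h2).2
        have h7 : q a * (Λ - η) < q a * δ (t - j * ℓ a - ℓ a) := by
          have : η1 * 3 = q a * η := by rw [hη1]; ring
          nlinarith [hq a]
        have h8 := lt_of_mul_lt_mul_left h7 (hq a).le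
        have : t - ((j + 1 : ℕ) : ℝ) * ℓ a = t - j * ℓ a - ℓ a := by push_cast; ring
        rwa [this]
  have hΛ0 : Λ ≤ 0 := by
    by_contra hc
    push Not at hc
    obtain ⟨J, hJ⟩ := exists_nat_gt (2 * B / (Λ / 2))
    obtain ⟨t, ht⟩ := (hlow J (Λ / 2) (by positivity)).exists
    have hs : ∀ j ≤ J, j * (Λ / 2) ≤ f t - f (t - j * ℓ a) := by
      intro j
      induction j with
      | zero => intro _; simp
      | succ j ih =>
        intro hj
        have h1 := ih (by omega)
        have h2 := ht j (by omega)
        have : t - ((j + 1 : ℕ) : ℝ) * ℓ a = t - j * ℓ a - ℓ a := by push_cast; ring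
        rw [this]
        simp only [hδ] at h2
        push_cast
        linarith
    have h1 := hs J le_rfl
    rw [div_lt_iff₀ (by positivity)] at hJ
    have := abs_le.1 (hB t); have := abs_le.1 (hB (t - J * ℓ a))
    linarith
  filter_upwards [hup η hη] with t ht
  simp only [hδ] at ht
  linarith

lemma ren_diff {ι : Type*} [Fintype ι] (q ℓ : ι → ℝ) (hq : ∀ a, 0 < q a) (hq1 : ∑ a, q a = 1)
    (f g : ℝ → ℝ) (B : ℝ) (hB : ∀ t, |f t| ≤ B) (hg : Tendsto g atTop (𝓝 0))
    (hf : ∀ t, f t = g t + ∑ a, q a * f (t - ℓ a)) (a : ι) :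
    Tendsto (fun t => f t - f (t - ℓ a)) atTop (𝓝 0) := by
  rw [Metric.tendsto_nhds]
  intro η hη
  have h1 := ren_aux q ℓ hq hq1 f g B hB hg hf a (half_pos hη)
  have h2 := ren_aux q ℓ hq hq1 (fun t => -f t) (fun t => -g t) B (by simpa using hB)
    (by simpa using hg.neg) (fun t => by rw [hf t]; simp [Finset.sum_neg_distrib]; ring) a (half_pos hη)
  filter_upwards [h1, h2] with t h1 h2
  rw [Real.dist_eq, sub_zero, abs_lt]
  constructor <;> linarith

end GT

open MeasureTheory ProbabilityTheory Filter Topology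

namespace GT
variable {M A : ℕ} {p : Fin A → ℝ} {ρ : ℝ}

/-- normalised profile -/
noncomputable def ff (M : ℕ) {A : ℕ} (p : Fin A → ℝ) (ρ t : ℝ) : ℝ :=
  Real.exp (-((ρ - 1) * t)) * FF M p (Real.exp t)

noncomputable def gg (ρ t : ℝ) : ℝ := Real.exp ((2 - ρ) * t) * Real.exp (-Real.exp t)

noncomputable def qq (M : ℕ) {A : ℕ} (p : Fin A → ℝ) (ρ : ℝ) (a : Fin A) : ℝ := M * p a ^ ρ
noncomputable def el {A : ℕ} (p : Fin A → ℝ) (a : Fin A) : ℝ := -Real.log (p a)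

lemma qq_pos (h : Par M A p ρ) (a : Fin A) : 0 < qq M p ρ a :=
  mul_pos h.Mpos (Real.rpow_pos_of_pos (h.p0 a) _)

lemma qq_sum (h : Par M A p ρ) : ∑ a, qq M p ρ a = 1 := by
  simp only [qq, ← Finset.mul_sum, h.hρ]

lemma el_pos (h : Par M A p ρ) (a : Fin A) : 0 < el p a := by
  have := Real.log_neg (h.p0 a) (h.p1 a); simp only [el]; linarith

lemma gg_nonneg (t : ℝ) : 0 ≤ gg ρ t := by unfold gg; positivity

lemma gg_le (h : Par M A p ρ) (t : ℝ) : gg ρ t ≤ 2 * Real.exp (-((2 - ρ) * |t|)) := by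
  unfold gg
  have hε : 0 < 2 - ρ := by linarith [h.ρ2]
  rcases le_or_gt t 0 with ht | ht
  · rw [abs_of_nonpos ht]
    have h1 : Real.exp (-Real.exp t) ≤ 1 := by
      rw [Real.exp_le_one_iff]; linarith [Real.exp_pos t]
    have h2 : (2 - ρ) * t = -((2 - ρ) * -t) := by ring
    rw [← h2]
    nlinarith [Real.exp_pos ((2 - ρ) * t)]
  · rw [abs_of_pos ht]
    have h1 : Real.exp (2 * t) ≤ 2 * Real.exp (Real.exp t) := by
      have := Real.quadratic_le_exp_of_nonneg (Real.exp_pos t).le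
      have h3 : Real.exp (2 * t) = Real.exp t ^ 2 := by rw [← Real.exp_nat_mul]; norm_num
      nlinarith [Real.exp_pos t]
    have h2 : Real.exp ((2 - ρ) * t) ≤ Real.exp (2 * t) * Real.exp (-((2 - ρ) * t)) := by
      rw [← Real.exp_add, Real.exp_le_exp]; nlinarith [h.ρ1]
    calc _ ≤ (Real.exp (2 * t) * Real.exp (-((2 - ρ) * t))) * Real.exp (-Real.exp t) := by gcongr
      _ ≤ ((2 * Real.exp (Real.exp t)) * Real.exp (-((2 - ρ) * t))) * Real.exp (-Real.exp t) := by gcongr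
      _ = 2 * Real.exp (-((2 - ρ) * t)) * (Real.exp (Real.exp t) * Real.exp (-Real.exp t)) := by ring
      _ = _ := by rw [← Real.exp_add]; simp

lemma gg_cont : Continuous (gg ρ) := by unfold gg; fun_prop

lemma gg_tendsto (h : Par M A p ρ) : Tendsto (gg ρ) atTop (𝓝 0) := by
  have hε : 0 < 2 - ρ := by linarith [h.ρ2]
  refine squeeze_zero' (Eventually.of_forall gg_nonneg)
    (g := fun t => 2 * Real.exp (-((2 - ρ) * t))) ?_ ?_
  · filter_upwards [eventually_ge_atTop 0] with t ht
    have := gg_le h t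
    rwa [abs_of_nonneg ht] at this
  · rw [← mul_zero (2 : ℝ)]
    exact (Real.tendsto_exp_neg_atTop_nhds_zero.comp (tendsto_id.const_mul_atTop hε)).const_mul 2

lemma ff_eq (h : Par M A p ρ) (t : ℝ) :
    ff M p ρ t = gg ρ t + ∑ a, qq M p ρ a * ff M p ρ (t - el p a) := by
  unfold ff gg
  rw [FF_eq h (Real.exp_pos t).le, mul_add]
  congr 1
  · rw [← mul_assoc, ← Real.exp_add]; congr 2; ring
  · rw [Finset.mul_sum, Finset.mul_sum]
    refine Finset.sum_congr rfl fun a _ => ?_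
    have h1 : Real.exp (t - el p a) = p a * Real.exp t := by
      simp only [el, sub_neg_eq_add, Real.exp_add, Real.exp_log (h.p0 a)]; ring
    have h2 : Real.exp (-((ρ - 1) * (t - el p a))) * p a ^ ρ = Real.exp (-((ρ - 1) * t)) * p a := by
      rw [Real.rpow_def_of_pos (h.p0 a), ← Real.exp_add]
      conv_rhs => rw [← Real.exp_log (h.p0 a), ← Real.exp_add]
      simp only [el]; congr 1; ring
    rw [h1]; unfold qq
    linear_combination (-(M : ℝ) * FF M p (p a * Real.exp t)) * h2

lemma ff_nonneg (h : Par M A p ρ) (t : ℝ) : 0 ≤ ff M p ρ t :=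
  mul_nonneg (Real.exp_pos _).le (FF_nonneg h (Real.exp_pos t).le)

lemma FF_le' (h : Par M A p ρ) : ∃ C > 0, ∀ y > 0, FF M p y ≤ C * y ^ (ρ - 1) := by
  obtain ⟨C, hC, hF⟩ := FF_le h
  refine ⟨C, hC, fun y hy => (hF y hy).trans ?_⟩
  have h1 := Lg_le_one (ε := 2 - ρ) hy.le
  have h2 : 0 < y ^ (ρ - 1) := Real.rpow_pos_of_pos hy _
  gcongr
  nlinarith

lemma ff_le (h : Par M A p ρ) : ∃ C > 0, ∀ t, ff M p ρ t ≤ C ∧ ff M p ρ t ≤ C * Real.exp ((2 - ρ) * t) := by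
  obtain ⟨C, hC, hF⟩ := FF_le h
  have key : ∀ t, ff M p ρ t ≤ C * Lg (2 - ρ) (Real.exp t) := fun t => by
    have := hF (Real.exp t) (Real.exp_pos t)
    unfold ff
    rw [← Real.exp_mul, mul_comm t] at this
    calc _ ≤ Real.exp (-((ρ - 1) * t)) * (C * (Real.exp ((ρ - 1) * t) * Lg (2 - ρ) (Real.exp t))) := by gcongr
      _ = C * Lg (2 - ρ) (Real.exp t) * (Real.exp (-((ρ - 1) * t)) * Real.exp ((ρ - 1) * t)) := by ring
      _ = _ := by rw [← Real.exp_add]; simp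
  refine ⟨C, hC, fun t => ⟨(key t).trans ?_, (key t).trans ?_⟩⟩
  · have := Lg_le_one (ε := 2 - ρ) (Real.exp_pos t).le
    nlinarith
  · have := Lg_le (ε := 2 - ρ) (Real.exp_pos t).le
    rw [← Real.exp_mul, mul_comm t] at this
    gcongr

lemma ff_mod (h : Par M A p ρ) : ∃ ω : ℝ → ℝ, Tendsto ω (𝓝 0) (𝓝 0) ∧
    ∀ᶠ s in 𝓝 (0:ℝ), ∀ t, |ff M p ρ (t + s) - ff M p ρ t| ≤ ω s := by
  obtain ⟨C, hC, hF⟩ := FF_le' h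
  obtain ⟨C', hC', hf⟩ := ff_le h
  refine ⟨fun s => Real.exp (-((ρ - 1) * s)) * (12 * |Real.exp s - 1| * C) +
    |Real.exp (-((ρ - 1) * s)) - 1| * C', ?_, ?_⟩
  · have : Continuous (fun s => Real.exp (-((ρ - 1) * s)) * (12 * |Real.exp s - 1| * C) +
      |Real.exp (-((ρ - 1) * s)) - 1| * C') := by fun_prop
    have := this.tendsto 0
    simpa using this
  · have : Tendsto (fun s => |Real.exp s - 1|) (𝓝 0) (𝓝 0) := by
      have : Continuous (fun s => |Real.exp s - 1|) := by fun_prop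
      simpa using this.tendsto 0
    filter_upwards [this.eventually (gt_mem_nhds (by norm_num : (0:ℝ) < 1 / 4))] with s hs t
    have hz : |Real.exp (t + s) - Real.exp t| = Real.exp t * |Real.exp s - 1| := by
      rw [Real.exp_add, ← abs_of_pos (Real.exp_pos t), ← abs_mul, abs_of_pos (Real.exp_pos t)]; congr 1; ring
    have h1 := FF_lip h (Real.exp_pos t) (z := Real.exp (t + s)) (by rw [hz]; nlinarith [Real.exp_pos t])
    rw [hz, mul_div_cancel_left₀ _ (Real.exp_pos t).ne'] at h1
    have h2 := hF (Real.exp t / 2) (by positivity)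
    have h3 : (Real.exp t / 2) ^ (ρ - 1) ≤ Real.exp ((ρ - 1) * t) := by
      rw [mul_comm, Real.exp_mul]
      exact Real.rpow_le_rpow (by positivity) (by linarith [Real.exp_pos t]) (by linarith [h.ρ1])
    have e1 : Real.exp (-((ρ - 1) * (t + s))) = Real.exp (-((ρ - 1) * s)) * Real.exp (-((ρ - 1) * t)) := by
      rw [← Real.exp_add]; congr 1; ring
    have e2 : Real.exp (-((ρ - 1) * t)) * Real.exp ((ρ - 1) * t) = 1 := by rw [← Real.exp_add]; simp
    have e3 : ff M p ρ (t + s) - ff M p ρ t = Real.exp (-((ρ - 1) * s)) * (Real.exp (-((ρ - 1) * t)) *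
        (FF M p (Real.exp (t + s)) - FF M p (Real.exp t))) + (Real.exp (-((ρ - 1) * s)) - 1) * ff M p ρ t := by
      unfold ff; rw [e1]; ring
    rw [e3]
    refine (abs_add_le _ _).trans (add_le_add ?_ ?_)
    · rw [abs_mul, abs_mul, abs_of_pos (Real.exp_pos _), abs_of_pos (Real.exp_pos _)]
      refine mul_le_mul_of_nonneg_left ?_ (Real.exp_pos _).le
      calc _ ≤ Real.exp (-((ρ - 1) * t)) * (12 * |Real.exp s - 1| * (C * Real.exp ((ρ - 1) * t))) := by
            gcongr; exact h1.trans (by gcongr; exact h2.trans (by gcongr))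
        _ = 12 * |Real.exp s - 1| * C * (Real.exp (-((ρ - 1) * t)) * Real.exp ((ρ - 1) * t)) := by ring
        _ = _ := by rw [e2, mul_one]
    · rw [abs_mul, abs_of_nonneg (ff_nonneg h t)]
      gcongr
      exact (hf t).1

lemma ff_cont (h : Par M A p ρ) : Continuous (ff M p ρ) := by
  obtain ⟨ω, hω, hm⟩ := ff_mod h
  rw [continuous_iff_continuousAt]
  intro t
  have h1 : Tendsto (fun z => ω (z - t)) (𝓝 t) (𝓝 0) := by
    have : Tendsto (fun z : ℝ => z - t) (𝓝 t) (𝓝 0) := by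
      have : Continuous (fun z : ℝ => z - t) := by fun_prop
      simpa using this.tendsto t
    exact hω.comp this
  have h2 : ∀ᶠ z in 𝓝 t, |ff M p ρ z - ff M p ρ t| ≤ ω (z - t) := by
    have : Tendsto (fun z : ℝ => z - t) (𝓝 t) (𝓝 0) := by
      have : Continuous (fun z : ℝ => z - t) := by fun_prop
      simpa using this.tendsto t
    filter_upwards [this.eventually hm] with z hz
    simpa using hz t
  rw [ContinuousAt, tendsto_iff_dist_tendsto_zero]
  exact squeeze_zero' (Eventually.of_forall fun _ => dist_nonneg) h2 h1

/-- asymptotic periods -/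
def perG (M : ℕ) {A : ℕ} (p : Fin A → ℝ) (ρ : ℝ) : AddSubgroup ℝ where
  carrier := {s | Tendsto (fun t => ff M p ρ (t + s) - ff M p ρ t) atTop (𝓝 0)}
  zero_mem' := by simp
  add_mem' := by
    intro a b ha hb
    simp only [Set.mem_ofPred_eq] at ha hb ⊢
    have := (ha.comp (tendsto_atTop_add_const_right atTop b tendsto_id)).add hb
    simp only [Function.comp_def, id, add_zero] at this
    refine this.congr fun t => ?_
    rw [add_assoc, add_comm b a]; ring
  neg_mem' := by
    intro a ha
    simp only [Set.mem_ofPred_eq] at ha ⊢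
    have := (ha.comp (tendsto_atTop_add_const_right atTop (-a) tendsto_id)).neg
    simp only [Function.comp_def, id, neg_zero] at this
    refine this.congr fun t => ?_
    simp

lemma mem_perG {s : ℝ} : s ∈ perG M p ρ ↔ Tendsto (fun t => ff M p ρ (t + s) - ff M p ρ t) atTop (𝓝 0) := Iff.rfl

lemma el_mem (h : Par M A p ρ) (a : Fin A) : el p a ∈ perG M p ρ := by
  obtain ⟨C', hC', hf⟩ := ff_le h
  have := ren_diff (qq M p ρ) (el p) (qq_pos h) (qq_sum h) (ff M p ρ) (gg ρ) C'
    (fun t => by rw [abs_of_nonneg (ff_nonneg h t)]; exact (hf t).1) (gg_tendsto h) (ff_eq h) a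
  rw [← neg_mem_iff, mem_perG]
  have := this.neg
  simpa [sub_eq_add_neg] using this

lemma perG_closed (h : Par M A p ρ) : IsClosed (perG M p ρ : Set ℝ) := by
  obtain ⟨ω, hω, hm⟩ := ff_mod h
  rw [← isSeqClosed_iff_isClosed]
  intro u s hu hus
  simp only [SetLike.mem_coe, mem_perG] at hu ⊢
  rw [Metric.tendsto_nhds]
  intro η hη
  have hu0 : Tendsto (fun n => s - u n) atTop (𝓝 0) := by
    simpa using hus.const_sub s
  have e1 := hu0.eventually hm
  have e2 := (hω.comp hu0).eventually (gt_mem_nhds (half_pos hη))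
  obtain ⟨n, h1, h2⟩ := (e1.and e2).exists
  filter_upwards [(Metric.tendsto_nhds.1 (hu n)) (η / 2) (half_pos hη)] with t ht
  rw [Real.dist_eq, sub_zero] at ht ⊢
  have h3 := h1 (t + u n)
  simp only [Function.comp] at h2
  have h4 : t + u n + (s - u n) = t + s := by ring
  rw [h4] at h3
  have h5 : ff M p ρ (t + s) - ff M p ρ t = (ff M p ρ (t + s) - ff M p ρ (t + u n)) + (ff M p ρ (t + u n) - ff M p ρ t) := by ring
  rw [h5]
  exact (abs_add_le _ _).trans_lt (by linarith)

lemma FF_scale (h : Par M A p ρ) (a : Fin A) :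
    Tendsto (fun x : ℕ => (p a ^ (ρ - 1) * FF M p x - FF M p (p a * x)) / (x : ℝ) ^ (ρ - 1)) atTop (𝓝 0) := by
  have h1 := mem_perG.1 (neg_mem (el_mem h a))
  have h2 := (h1.comp (Real.tendsto_log_atTop.comp tendsto_natCast_atTop_atTop)).const_mul (-(p a ^ (ρ - 1)))
  rw [mul_zero] at h2
  refine h2.congr' ?_
  filter_upwards [eventually_gt_atTop 0] with x hx
  have hx' : (0:ℝ) < x := by exact_mod_cast hx
  simp only [Function.comp, ff, el, Real.exp_add, neg_neg, Real.exp_log hx', Real.exp_log (h.p0 a)]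
  have e1 : Real.exp (-((ρ - 1) * Real.log x)) = ((x:ℝ) ^ (ρ - 1))⁻¹ := by
    rw [Real.exp_neg, Real.rpow_def_of_pos hx', mul_comm]
  have e2 : Real.exp (-((ρ - 1) * (Real.log x + Real.log (p a)))) = ((x:ℝ) ^ (ρ - 1))⁻¹ * (p a ^ (ρ - 1))⁻¹ := by
    rw [Real.rpow_def_of_pos hx', Real.rpow_def_of_pos (h.p0 a), ← Real.exp_neg, ← Real.exp_neg, ← Real.exp_add]
    congr 1; ring
  rw [e1, e2, mul_comm (x:ℝ) (p a)]
  have := (Real.rpow_pos_of_pos (h.p0 a) (ρ - 1)).ne'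
  field_simp
  ring

end GT

open MeasureTheory ProbabilityTheory Filter Topology
open scoped FourierTransform

namespace GT
variable {M A : ℕ} {p : Fin A → ℝ} {ρ : ℝ}

lemma gam_int (h : Par M A p ρ) (τ : ℝ) :
    ∫ u : ℝ, Complex.exp (-(Complex.I * τ * u)) * (gg ρ u : ℂ) = Complex.Gamma ((2 - ρ : ℝ) - Complex.I * τ) := by
  have hε : 0 < 2 - ρ := by linarith [h.ρ2]
  have hre : (((2 - ρ : ℝ) : ℂ) - Complex.I * τ).re = 2 - ρ := by simp
  have him : (((2 - ρ : ℝ) : ℂ) - Complex.I * τ).im = -τ := by simp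
  rw [Complex.Gamma_eq_integral (by rw [hre]; exact hε), Complex.GammaIntegral_eq_mellin, mellin_eq_fourier,
    Real.fourier_real_eq_integral_exp_smul, ← integral_neg_eq_self]
  refine integral_congr_ae (Eventually.of_forall fun u => ?_)
  simp only [hre, him, smul_eq_mul, Complex.real_smul, gg]
  push_cast
  have hpi : (Real.pi : ℂ) ≠ 0 := by exact_mod_cast Real.pi_ne_zero
  congr 1
  · congr 1; field_simp
  · congr 1
    · congr 1; ring

lemma gg_int_eq (h : Par M A p ρ) : ∫ u : ℝ, gg ρ u = Real.Gamma (2 - ρ) := by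
  have := gam_int h 0
  simp only [Complex.ofReal_zero, mul_zero, zero_mul, neg_zero, Complex.exp_zero, one_mul, sub_zero] at this
  rw [integral_complex_ofReal, Complex.Gamma_ofReal] at this
  exact_mod_cast this

lemma gg_integrable (h : Par M A p ρ) : Integrable (gg ρ) := by
  by_contra hc
  have := gg_int_eq h
  rw [integral_undef hc] at this
  exact (Real.Gamma_pos_of_pos (by linarith [h.ρ2] : 0 < 2 - ρ)).ne this

lemma gam_le (h : Par M A p ρ) : ∃ C, ∀ τ : ℝ,
    ‖Complex.Gamma ((2 - ρ : ℝ) - Complex.I * τ)‖ * τ ^ 2 ≤ C := by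
  have hε : 0 < 2 - ρ := by linarith [h.ρ2]
  refine ⟨Real.Gamma (2 - ρ + 2), fun τ => ?_⟩
  set s : ℂ := (2 - ρ : ℝ) - Complex.I * τ with hs
  have hre : s.re = 2 - ρ := by simp [hs]
  have him : s.im = -τ := by simp [hs]
  have hs0 : s ≠ 0 := fun h0 => by rw [h0] at hre; simp at hre; linarith
  have hs1 : s + 1 ≠ 0 := fun h0 => by
    have := congrArg Complex.re h0; simp [hre] at this; linarith
  have h1 : Complex.Gamma (s + 2) = (s + 1) * s * Complex.Gamma s := by
    have : s + 2 = s + 1 + 1 := by ring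
    rw [this, Complex.Gamma_add_one _ hs1, Complex.Gamma_add_one _ hs0]; ring
  have h2 : ‖Complex.Gamma (s + 2)‖ ≤ Real.Gamma (2 - ρ + 2) := by
    have hre2 : (s + 2).re = 2 - ρ + 2 := by simp [hre]
    rw [Complex.Gamma_eq_integral (by rw [hre2]; linarith), Real.Gamma_eq_integral (by linarith), Complex.GammaIntegral]
    refine norm_integral_le_of_norm_le (Real.GammaIntegral_convergent (by linarith)) ?_
    refine (ae_restrict_iff' measurableSet_Ioi).2 (Eventually.of_forall fun x hx => ?_)
    rw [norm_mul, Complex.norm_real, Complex.norm_cpow_eq_rpow_re_of_pos hx]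
    simp [hre, abs_of_pos (Real.exp_pos _)]
  have h3 : |τ| ≤ ‖s‖ := by have := Complex.abs_im_le_norm s; rwa [him, abs_neg] at this
  have h4 : |τ| ≤ ‖s + 1‖ := by
    have := Complex.abs_im_le_norm (s + 1); simpa [him] using this
  rw [h1, norm_mul, norm_mul] at h2
  calc _ = |τ| * |τ| * ‖Complex.Gamma s‖ := by rw [← sq_abs]; ring
    _ ≤ ‖s + 1‖ * ‖s‖ * ‖Complex.Gamma s‖ := by gcongr
    _ ≤ _ := h2

/-- mean drift -/
noncomputable def mn (M : ℕ) {A : ℕ} (p : Fin A → ℝ) (ρ : ℝ) : ℝ := ∑ a, qq M p ρ a * el p a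

lemma mn_pos (h : Par M A p ρ) : 0 < mn M p ρ := by
  have := h.nonempty
  exact Finset.sum_pos (fun a _ => mul_pos (qq_pos h a) (el_pos h a)) Finset.univ_nonempty

lemma ff_intOn (h : Par M A p ρ) (t : ℝ) : IntegrableOn (ff M p ρ) (Set.Iic t) := by
  have hε : 0 < 2 - ρ := by linarith [h.ρ2]
  obtain ⟨C, hC, hf⟩ := ff_le h
  refine Integrable.mono' ((integrableOn_exp_mul_Iic hε t).const_mul C) (ff_cont h).aestronglyMeasurable.restrict ?_
  refine Eventually.of_forall fun u => ?_
  rw [Real.norm_eq_abs, abs_of_nonneg (ff_nonneg h u)]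
  exact (hf u).2

lemma dense_case (h : Par M A p ρ) (hd : ∀ s, s ∈ perG M p ρ) :
    Tendsto (ff M p ρ) atTop (𝓝 (Real.Gamma (2 - ρ) / mn M p ρ)) := by
  obtain ⟨C, hC, hf⟩ := ff_le h
  have hfc := ff_cont h
  -- integrated equation
  have key : ∀ t, ∑ a, qq M p ρ a * ∫ u in (t - el p a)..t, ff M p ρ u = ∫ u in Set.Iic t, gg ρ u := by
    intro t
    have h1 : ∀ a, ∫ u in Set.Iic t, ff M p ρ (u - el p a) = ∫ u in Set.Iic (t - el p a), ff M p ρ u := by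
      intro a
      have hI : (fun u : ℝ => u - el p a) ⁻¹' Set.Iic (t - el p a) = Set.Iic t := by ext; simp
      rw [← hI]
      exact (measurePreserving_sub_right volume (el p a)).setIntegral_preimage_emb
        (measurableEmbedding_subRight (el p a)) _ _
    have h1' : ∀ a, IntegrableOn (fun u => ff M p ρ (u - el p a)) (Set.Iic t) := by
      intro a
      have hI : (fun u : ℝ => u - el p a) ⁻¹' Set.Iic (t - el p a) = Set.Iic t := by ext; simp
      rw [← hI]
      exact ((measurePreserving_sub_right volume (el p a)).integrableOn_comp_preimage
        (measurableEmbedding_subRight (el p a))).2 (ff_intOn h _)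
    have h2 : ∫ u in Set.Iic t, ff M p ρ u = (∫ u in Set.Iic t, gg ρ u) +
        ∑ a, qq M p ρ a * ∫ u in Set.Iic (t - el p a), ff M p ρ u := by
      rw [integral_congr_ae (Eventually.of_forall (ff_eq h)), integral_add (gg_integrable h).integrableOn
        (integrable_finsetSum _ fun a _ => (h1' a).const_mul _), integral_finsetSum _ fun a _ => (h1' a).const_mul _]
      simp only [integral_const_mul, h1]
    have h3 : ∀ a, ∫ u in (t - el p a)..t, ff M p ρ u =
      (∫ u in Set.Iic t, ff M p ρ u) - ∫ u in Set.Iic (t - el p a), ff M p ρ u := fun a =>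
      (intervalIntegral.integral_Iic_sub_Iic (ff_intOn h _) (ff_intOn h _)).symm
    simp only [h3, mul_sub, Finset.sum_sub_distrib, ← Finset.sum_mul, qq_sum h, one_mul]
    linarith
  have hlim : Tendsto (fun t => ∫ u in Set.Iic t, gg ρ u) atTop (𝓝 (Real.Gamma (2 - ρ))) := by
    rw [← gg_int_eq h]
    exact (aecover_Iic tendsto_id).integral_tendsto_of_countably_generated (gg_integrable h)
  have hloc : ∀ a, Tendsto (fun t => (∫ u in (t - el p a)..t, ff M p ρ u) - el p a * ff M p ρ t) atTop (𝓝 0) := by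
    intro a
    have e1 : ∀ t, (∫ u in (t - el p a)..t, ff M p ρ u) - el p a * ff M p ρ t =
        ∫ s in (-el p a)..0, (ff M p ρ (t + s) - ff M p ρ t) := by
      intro t
      rw [intervalIntegral.integral_sub ((by fun_prop : Continuous fun s => ff M p ρ (t + s)).intervalIntegrable _ _) (by simp),
        intervalIntegral.integral_const, intervalIntegral.integral_comp_add_left (fun s => ff M p ρ s)]
      simp [sub_eq_add_neg]
    simp only [e1]
    have := intervalIntegral.tendsto_integral_filter_of_dominated_convergence (μ := volume) (a := -el p a) (b := 0)
      (F := fun t s => ff M p ρ (t + s) - ff M p ρ t) (f := fun _ => (0:ℝ)) (l := atTop) (fun _ => C + C)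
      (Eventually.of_forall fun t => (by fun_prop : Continuous fun s => ff M p ρ (t + s) - ff M p ρ t).aestronglyMeasurable)
      (Eventually.of_forall fun t => Eventually.of_forall fun s _ => by
        rw [Real.norm_eq_abs, abs_le]
        constructor <;> linarith [ff_nonneg h t, ff_nonneg h (t + s), (hf t).1, (hf (t+s)).1])
      (by simp) (Eventually.of_forall fun s _ => mem_perG.1 (hd s))
    simpa using this
  have hsum : Tendsto (fun t => ∑ a, qq M p ρ a * ((∫ u in (t - el p a)..t, ff M p ρ u) - el p a * ff M p ρ t)) atTop (𝓝 0) := by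
    have := tendsto_finsetSum Finset.univ fun a (_ : a ∈ Finset.univ) => (hloc a).const_mul (qq M p ρ a)
    simpa using this
  have h5 : Tendsto (fun t => ff M p ρ t * mn M p ρ) atTop (𝓝 (Real.Gamma (2 - ρ))) := by
    have := hlim.sub hsum
    rw [sub_zero] at this
    refine this.congr fun t => ?_
    rw [← key t]
    simp only [mul_sub, Finset.sum_sub_distrib, sub_sub_cancel, mn, Finset.mul_sum]
    exact Finset.sum_congr rfl fun a _ => by ring
  have := h5.div_const (mn M p ρ)
  simpa [mul_div_cancel_right₀ _ (mn_pos h).ne'] using this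

end GT

open MeasureTheory ProbabilityTheory Filter Topology
open scoped FourierTransform

namespace GT
variable {M A : ℕ} {p : Fin A → ℝ} {ρ : ℝ}

lemma geo_summable (h : Par M A p ρ) {d : ℝ} (hd : 0 < d) : Summable fun j : ℕ => Real.exp (-((2 - ρ) * d * j)) := by
  have hε : 0 < 2 - ρ := by linarith [h.ρ2]
  have : ∀ j : ℕ, Real.exp (-((2 - ρ) * d * j)) = Real.exp (-((2 - ρ) * d)) ^ j := fun j => by
    rw [← Real.exp_nat_mul]; congr 1; ring
  simp only [this]
  refine summable_geometric_of_lt_one (Real.exp_pos _).le ?_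
  rw [Real.exp_lt_one_iff]
  have := mul_pos hε hd
  linarith

lemma ff_summable (h : Par M A p ρ) {d : ℝ} (hd : 0 < d) (t : ℝ) : Summable fun j : ℕ => ff M p ρ (t - j * d) := by
  obtain ⟨C, hC, hf⟩ := ff_le h
  refine Summable.of_nonneg_of_le (fun j => ff_nonneg h _) (fun j => (hf _).2)
    (((geo_summable h hd).mul_left (Real.exp ((2 - ρ) * t))).mul_left C |>.congr fun j => ?_)
  rw [← Real.exp_add]; congr 2; ring

lemma gg_le1 (t : ℝ) : gg ρ t ≤ Real.exp ((2 - ρ) * t) := by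
  unfold gg
  have h1 : Real.exp (-Real.exp t) ≤ 1 := by
    rw [Real.exp_le_one_iff]; linarith [Real.exp_pos t]
  nlinarith [Real.exp_pos ((2 - ρ) * t)]

lemma gg_summable (h : Par M A p ρ) {d : ℝ} (hd : 0 < d) (t : ℝ) : Summable fun j : ℕ => gg ρ (t - j * d) := by
  refine Summable.of_nonneg_of_le (fun j => gg_nonneg _) (fun j => gg_le1 _)
    (((geo_summable h hd).mul_left (Real.exp ((2 - ρ) * t))) |>.congr fun j => ?_)
  rw [← Real.exp_add]; congr 1; ring

lemma cyc_lat (h : Par M A p ρ) {d : ℝ} (hd : 0 < d) (ν : Fin A → ℕ) (hν : ∀ a, el p a = ν a * d)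
    (t : ℝ) : ∑ a, qq M p ρ a * ∑ j ∈ Finset.range (ν a), ff M p ρ (t - j * d) = ∑' j : ℕ, gg ρ (t - j * d) := by
  set T : ℝ → ℝ := fun t => ∑' j : ℕ, ff M p ρ (t - j * d) with hT
  have h1 : ∀ a, T t = (∑ j ∈ Finset.range (ν a), ff M p ρ (t - j * d)) + T (t - el p a) := by
    intro a
    simp only [hT]
    rw [← (ff_summable h hd t).sum_add_tsum_nat_add (ν a)]
    congr 1
    refine tsum_congr fun j => ?_
    rw [hν]; push_cast; congr 1; ring
  have h2 : T t = (∑' j : ℕ, gg ρ (t - j * d)) + ∑ a, qq M p ρ a * T (t - el p a) := by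
    have hs : ∀ a, Summable fun j : ℕ => qq M p ρ a * ff M p ρ (t - j * d - el p a) := fun a => by
      refine ((ff_summable h hd (t - el p a)).mul_left (qq M p ρ a)).congr fun j => ?_
      congr 2; ring
    have e1 : T t = ∑' j : ℕ, (gg ρ (t - j * d) + ∑ a, qq M p ρ a * ff M p ρ (t - j * d - el p a)) :=
      tsum_congr fun j => ff_eq h _
    rw [e1, (gg_summable h hd t).tsum_add (summable_sum fun a _ => hs a),
      Summable.tsum_finsetSum fun a _ => hs a]
    congr 1
    refine Finset.sum_congr rfl fun a _ => ?_
    rw [tsum_mul_left]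
    congr 1
    refine tsum_congr fun j => ?_
    congr 1; ring
  have h3 : ∀ a, ∑ j ∈ Finset.range (ν a), ff M p ρ (t - j * d) = T t - T (t - el p a) := fun a => by
    rw [h1 a]; ring
  simp only [h3, mul_sub, Finset.sum_sub_distrib, ← Finset.sum_mul, qq_sum h, one_mul]
  linarith

lemma tail_tendsto (h : Par M A p ρ) {d : ℝ} (hd : 0 < d) :
    Tendsto (fun t => ∑' j : ℕ, gg ρ (t + (j + 1) * d)) atTop (𝓝 0) := by
  have hε : 0 < 2 - ρ := by linarith [h.ρ2]
  have hlim : Tendsto (fun t => (2 * Real.exp (-((2 - ρ) * t))) * ∑' j : ℕ, Real.exp (-((2 - ρ) * d * j))) atTop (𝓝 0) := by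
    have := ((Real.tendsto_exp_neg_atTop_nhds_zero.comp (tendsto_id.const_mul_atTop hε)).const_mul 2).mul_const
      (∑' j : ℕ, Real.exp (-((2 - ρ) * d * j)))
    simpa using this
  refine squeeze_zero' (Eventually.of_forall fun t => tsum_nonneg fun j => gg_nonneg _) ?_ hlim
  filter_upwards [eventually_ge_atTop 0] with t ht
  rw [← tsum_mul_left]
  have hle : ∀ j : ℕ, gg ρ (t + (j + 1) * d) ≤ (2 * Real.exp (-((2 - ρ) * t))) * Real.exp (-((2 - ρ) * d * j)) := by
    intro j
    refine (gg_le h _).trans ?_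
    rw [mul_assoc, ← Real.exp_add, abs_of_nonneg (by positivity)]
    gcongr
    have := mul_pos hε hd
    nlinarith
  have hs := (geo_summable h hd).mul_left (2 * Real.exp (-((2 - ρ) * t)))
  exact (Summable.of_nonneg_of_le (fun j => gg_nonneg _) hle hs).tsum_le_tsum hle hs

lemma gg_tail_summable (h : Par M A p ρ) {d : ℝ} (hd : 0 < d) (t : ℝ) (ht : 0 ≤ t) :
    Summable fun j : ℕ => gg ρ (t + (j + 1) * d) := by
  have hε : 0 < 2 - ρ := by linarith [h.ρ2]
  refine Summable.of_nonneg_of_le (fun j => gg_nonneg _) (fun j => ?_) ((geo_summable h hd).mul_left 2)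
  refine (gg_le h _).trans ?_
  rw [abs_of_nonneg (by positivity)]
  refine mul_le_mul_of_nonneg_left (Real.exp_le_exp.2 (neg_le_neg ?_)) (by norm_num)
  have := mul_pos hε hd
  nlinarith

lemma cyc_poisson (h : Par M A p ρ) {d : ℝ} (hd : 0 < d) (t : ℝ) :
    ∑' n : ℤ, (gg ρ (t + n * d) : ℂ) = (d : ℂ)⁻¹ * ∑' n : ℤ,
      Complex.Gamma ((2 - ρ : ℝ) - Complex.I * ((2 * Real.pi * n / d : ℝ) : ℂ)) *
        Complex.exp (Complex.I * ((2 * Real.pi * n / d : ℝ) : ℂ) * t) := by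
  have hε : 0 < 2 - ρ := by linarith [h.ρ2]
  have hεd := mul_pos hε hd
  set G : ℝ → ℂ := fun x => (gg ρ (d * x) : ℂ) with hG
  have hGc : Continuous G := by
    have := gg_cont (ρ := ρ)
    fun_prop
  have hO : G =O[cocompact ℝ] fun x => |x| ^ (-(2:ℝ)) := by
    refine Asymptotics.IsBigO.of_bound (4 / ((2 - ρ) * d) ^ 2) ?_
    have : ∀ᶠ x : ℝ in cocompact ℝ, x ≠ 0 := by
      have := (isCompact_singleton (x := (0:ℝ))).compl_mem_cocompact
      filter_upwards [this] with x hx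
      simpa using hx
    filter_upwards [this] with x hx
    have hx' : 0 < |x| := abs_pos.2 hx
    rw [Complex.norm_real, Real.norm_eq_abs, abs_of_nonneg (gg_nonneg _)]
    refine (gg_le h _).trans ?_
    rw [abs_mul, abs_of_pos hd, Real.norm_of_nonneg (Real.rpow_nonneg hx'.le _), Real.rpow_neg hx'.le]
    have hy : 0 < (2 - ρ) * (d * |x|) := by positivity
    have h1 := Real.quadratic_le_exp_of_nonneg hy.le
    rw [Real.exp_neg]
    have h2 : (|x| ^ (2:ℝ)) = |x| ^ 2 := by norm_cast
    rw [h2]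
    have h3 : (Real.exp ((2 - ρ) * (d * |x|)))⁻¹ ≤ (((2 - ρ) * (d * |x|)) ^ 2 / 2)⁻¹ := by
      apply inv_anti₀ (by positivity); linarith
    calc _ ≤ 2 * (((2 - ρ) * (d * |x|)) ^ 2 / 2)⁻¹ := by gcongr
      _ = _ := by field_simp; norm_num
  have hF : ∀ n : ℤ, 𝓕 G n = (d : ℂ)⁻¹ * Complex.Gamma ((2 - ρ : ℝ) - Complex.I * ((2 * Real.pi * n / d : ℝ) : ℂ)) := by
    intro n
    rw [← gam_int h, Real.fourier_real_eq_integral_exp_smul]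
    have := Measure.integral_comp_mul_left (fun u : ℝ => Complex.exp (-(Complex.I * ((2 * Real.pi * n / d : ℝ) : ℂ) * u)) * (gg ρ u : ℂ)) d
    rw [abs_of_pos (inv_pos.2 hd), Complex.real_smul] at this
    push_cast at this ⊢
    rw [← this]
    refine integral_congr_ae (Eventually.of_forall fun u => ?_)
    simp only [hG, smul_eq_mul]
    congr 2
    have : (d : ℂ) ≠ 0 := by exact_mod_cast hd.ne'
    field_simp
  have hsum : Summable fun n : ℤ => 𝓕 G n := by
    obtain ⟨C, hC⟩ := gam_le h
    have hs : Summable fun n : ℤ => (d⁻¹ * (C * (d / (2 * Real.pi)) ^ 2)) * (1 / (n : ℝ) ^ 2) :=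
      (Real.summable_one_div_int_pow.2 (by norm_num)).mul_left _
    refine Summable.of_norm_bounded_eventually hs ?_
    filter_upwards [(Set.finite_singleton (0:ℤ)).compl_mem_cofinite] with n hn
    have hn0 : (n : ℝ) ≠ 0 := by
      intro h0; apply hn; simpa using h0
    rw [hF, norm_mul, norm_inv, Complex.norm_real, Real.norm_eq_abs, abs_of_pos hd, mul_assoc d⁻¹]
    refine mul_le_mul_of_nonneg_left ?_ (inv_pos.2 hd).le
    have hτ := hC (2 * Real.pi * n / d)
    have hpi := Real.pi_pos
    have hpos : 0 < (2 * Real.pi * n / d) ^ 2 := by positivity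
    rw [← le_div_iff₀ hpos] at hτ
    refine hτ.trans (le_of_eq ?_)
    field_simp
  have hP := Real.tsum_eq_tsum_fourier_of_rpow_decay_of_summable hGc (by norm_num : (1:ℝ) < 2) hO hsum (t / d)
  have e1 : ∀ n : ℤ, (gg ρ (t + n * d) : ℂ) = G (t / d + n) := fun n => by
    simp only [hG]; congr 2; field_simp
  simp only [e1]
  rw [hP, ← tsum_mul_left]
  refine tsum_congr fun n => ?_
  rw [hF, mul_assoc, fourier_coe_apply]
  congr 3
  push_cast
  have : (d : ℂ) ≠ 0 := by exact_mod_cast hd.ne'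
  field_simp

lemma cyc_case (h : Par M A p ρ) {d : ℝ} (hd : 0 < d) (ν : Fin A → ℕ) (hν : ∀ a, el p a = ν a * d)
    (hdp : d ∈ perG M p ρ) :
    Tendsto (fun t : ℝ => (ff M p ρ t * mn M p ρ : ℂ) - ∑' n : ℤ,
      Complex.Gamma ((2 - ρ : ℝ) - Complex.I * ((2 * Real.pi * n / d : ℝ) : ℂ)) *
        Complex.exp (Complex.I * ((2 * Real.pi * n / d : ℝ) : ℂ) * t)) atTop (𝓝 0) := by
  have h1 : Tendsto (fun t => ∑ a, qq M p ρ a * ∑ j ∈ Finset.range (ν a), (ff M p ρ t - ff M p ρ (t - j * d))) atTop (𝓝 0) := by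
    have hj : ∀ j : ℕ, Tendsto (fun t => ff M p ρ t - ff M p ρ (t - j * d)) atTop (𝓝 0) := by
      intro j
      have := (mem_perG.1 (neg_mem (nsmul_mem hdp j))).neg
      simpa [sub_eq_add_neg] using this
    have := tendsto_finsetSum Finset.univ fun a (_ : a ∈ Finset.univ) =>
      (tendsto_finsetSum (Finset.range (ν a)) fun j _ => hj j).const_mul (qq M p ρ a)
    simpa using this
  have h2 : Tendsto (fun t => d * (∑ a, qq M p ρ a * ∑ j ∈ Finset.range (ν a), (ff M p ρ t - ff M p ρ (t - j * d))) -
      d * ∑' j : ℕ, gg ρ (t + (j + 1) * d)) atTop (𝓝 0) := by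
    simpa using (h1.const_mul d).sub ((tail_tendsto h hd).const_mul d)
  have h3 := (Complex.continuous_ofReal.tendsto 0).comp h2
  rw [Complex.ofReal_zero] at h3
  refine h3.congr' ?_
  filter_upwards [eventually_ge_atTop 0] with t ht
  have hd' : (d : ℂ) ≠ 0 := by exact_mod_cast hd.ne'
  have e1 : ∑' n : ℤ, gg ρ (t + n * d) = (∑' j : ℕ, gg ρ (t - j * d)) + ∑' j : ℕ, gg ρ (t + (j + 1) * d) := by
    rw [← (Equiv.neg ℤ).tsum_eq, tsum_of_nat_of_neg_add_one]
    · congr 1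
      · refine tsum_congr fun j => ?_
        simp [sub_eq_add_neg]
      · refine tsum_congr fun j => ?_
        simp
    · refine (gg_summable h hd t).congr fun j => ?_
      simp [sub_eq_add_neg]
    · refine (gg_tail_summable h hd t ht).congr fun j => ?_
      simp
  have e2 := cyc_poisson h hd t
  rw [← Complex.ofReal_tsum, e1, ← cyc_lat h hd ν hν t, ← div_eq_inv_mul, eq_div_iff hd'] at e2
  rw [← e2]
  simp only [Function.comp]
  norm_cast
  simp only [Finset.sum_sub_distrib, Finset.sum_const, Finset.card_range, mul_sub, nsmul_eq_mul, mn, hν, Finset.mul_sum]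
  have : ∑ a, d * (qq M p ρ a * (ν a * ff M p ρ t)) = ∑ a, ff M p ρ t * (qq M p ρ a * (ν a * d)) :=
    Finset.sum_congr rfl fun a _ => by ring
  rw [this, add_mul, Finset.sum_mul]
  have : ∑ i, d * ∑ j ∈ Finset.range (ν i), qq M p ρ i * ff M p ρ (t - j * d) =
    ∑ i, (∑ j ∈ Finset.range (ν i), qq M p ρ i * ff M p ρ (t - j * d)) * d :=
    Finset.sum_congr rfl fun a _ => by ring
  simp only [Finset.mul_sum] at this ⊢
  rw [this]; ring

end GT

open MeasureTheory ProbabilityTheory Filter Topology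
open scoped FourierTransform

namespace GT
variable {M A : ℕ} {p : Fin A → ℝ} {ρ : ℝ}

lemma cp_eq (h : Par M A p ρ) {s : ℂ} (hs : s.re = ρ) (a : Fin A) :
    (p a : ℂ) ^ s = ((p a ^ ρ : ℝ) : ℂ) * Complex.exp (-(s.im * el p a : ℝ) * Complex.I) := by
  have h0 : (p a : ℂ) ≠ 0 := by exact_mod_cast (h.p0 a).ne'
  rw [Complex.cpow_def_of_ne_zero h0, Real.rpow_def_of_pos (h.p0 a), ← Complex.ofReal_log (h.p0 a).le,
    Complex.ofReal_exp, ← Complex.exp_add]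
  congr 1
  conv_lhs => rw [← Complex.re_add_im s, hs]
  simp only [el]; push_cast; ring

lemma roots_iff (h : Par M A p ρ) {s : ℂ} : s ∈ rootsLine M A p ρ ↔
    s.re = ρ ∧ ∀ a, ∃ k : ℤ, s.im * el p a = k * (2 * Real.pi) := by
  constructor
  · rintro ⟨h1, h2⟩
    refine ⟨h2, ?_⟩
    have h3 := congrArg Complex.re h1
    simp only [Pfun, cp_eq h h2] at h3
    have h4 : ∑ a, qq M p ρ a * (1 - Real.cos (s.im * el p a)) = 0 := by
      simp only [mul_sub, mul_one, Finset.sum_sub_distrib, qq_sum h]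
      rw [Complex.sub_re, ← Complex.ofReal_natCast, Complex.re_ofReal_mul, Complex.re_sum] at h3
      simp only [Complex.re_ofReal_mul, ← Complex.ofReal_neg, Complex.exp_ofReal_mul_I_re, Real.cos_neg] at h3
      simp only [qq, mul_assoc, ← Finset.mul_sum]
      simpa using h3
    rw [Finset.sum_eq_zero_iff_of_nonneg fun a _ => mul_nonneg (qq_pos h a).le (by linarith [Real.cos_le_one (s.im * el p a)])] at h4
    intro a
    have h5 := h4 a (Finset.mem_univ a)
    have h6 : Real.cos (s.im * el p a) = 1 := by
      rcases mul_eq_zero.1 h5 with h | h'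
      · exact absurd h (qq_pos ‹_› a).ne'
      · linarith
    obtain ⟨k, hk⟩ := (Real.cos_eq_one_iff _).1 h6
    exact ⟨k, hk.symm⟩
  · rintro ⟨h2, h3⟩
    refine ⟨?_, h2⟩
    have h4 : ∀ a, (p a : ℂ) ^ s = ((p a ^ ρ : ℝ) : ℂ) := by
      intro a
      obtain ⟨k, hk⟩ := h3 a
      rw [cp_eq h h2, hk, Complex.exp_eq_one_iff.2 ⟨-k, by push_cast; ring⟩, mul_one]
    simp only [Pfun, h4]
    have := h.hρ
    norm_cast
    rw [this]; simp

lemma cp_root (h : Par M A p ρ) {s : ℂ} (hs : s ∈ rootsLine M A p ρ) (a : Fin A) :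
    (p a : ℂ) ^ s = ((p a ^ ρ : ℝ) : ℂ) := by
  obtain ⟨h2, h3⟩ := (roots_iff h).1 hs
  obtain ⟨k, hk⟩ := h3 a
  rw [cp_eq h h2, hk, Complex.exp_eq_one_iff.2 ⟨-k, by push_cast; ring⟩, mul_one]

lemma bGE (h : Par M A p ρ) {s : ℂ} (hs : s ∈ rootsLine M A p ρ) :
    s * GE M A p s = Complex.Gamma ((2 - ρ : ℝ) - Complex.I * s.im) / mn M p ρ := by
  have h1 := ((roots_iff h).1 hs).1
  have e1 : (M : ℂ) * ∑ j, (p j : ℂ) ^ s * (Real.log (p j) : ℂ) = -(mn M p ρ : ℂ) := by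
    simp only [cp_root h hs, mn, qq, el]
    push_cast
    rw [Finset.mul_sum, ← Finset.sum_neg_distrib]
    exact Finset.sum_congr rfl fun a _ => by ring
  have e2 : (((2 - ρ : ℝ) : ℂ) - Complex.I * s.im) = -s + 1 + 1 := by
    conv_rhs => rw [← Complex.re_add_im s, h1]
    push_cast; ring
  have n1 : -s ≠ 0 := fun h0 => by
    have := congrArg Complex.re h0; simp [h1] at this; linarith [h.ρ1]
  have n2 : -s + 1 ≠ 0 := fun h0 => by
    have := congrArg Complex.re h0; simp [h1] at this; linarith [h.ρ1]
  have n3 : (mn M p ρ : ℂ) ≠ 0 := by exact_mod_cast (mn_pos h).ne'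
  rw [e2, Complex.Gamma_add_one _ n2, Complex.Gamma_add_one _ n1, GE, e1]
  field_simp
  ring

lemma ff_roots (h : Par M A p ρ) :
    Tendsto (fun t : ℝ => (ff M p ρ t * mn M p ρ : ℂ) - ∑' β : rootsLine M A p ρ,
      Complex.Gamma ((2 - ρ : ℝ) - Complex.I * ((β : ℂ).im : ℂ)) *
        Complex.exp (Complex.I * ((β : ℂ).im : ℂ) * t)) atTop (𝓝 0) := by
  set H := AddSubgroup.closure (Set.range (el p)) with hH
  have hHp : H ≤ perG M p ρ := by
    rw [hH, AddSubgroup.closure_le]; rintro _ ⟨a, rfl⟩; exact el_mem h a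
  have hHr : ∀ s : ℂ, s ∈ rootsLine M A p ρ → ∀ x ∈ H, ∃ k : ℤ, s.im * x = k * (2 * Real.pi) := by
    intro s hs x hx
    induction hx using AddSubgroup.closure_induction with
    | mem x hx => obtain ⟨a, rfl⟩ := hx; exact ((roots_iff h).1 hs).2 a
    | zero => exact ⟨0, by simp⟩
    | add x y _ _ h1 h2 =>
      obtain ⟨k, hk⟩ := h1; obtain ⟨l, hl⟩ := h2
      exact ⟨k + l, by push_cast; linarith⟩
    | neg x _ h1 => obtain ⟨k, hk⟩ := h1; exact ⟨-k, by push_cast; linarith⟩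
  rcases H.dense_or_cyclic with hd | ⟨d, hd⟩
  · have hall : ∀ s, s ∈ perG M p ρ := by
      intro s
      have : closure (H : Set ℝ) ⊆ perG M p ρ := closure_minimal hHp (perG_closed h)
      exact this (by rw [hd.closure_eq]; trivial)
    have hroot : rootsLine M A p ρ = {(ρ : ℂ)} := by
      ext s
      constructor
      · intro hs
        have him : s.im = 0 := by
          by_contra h0
          have hcos : Set.EqOn (fun x => Real.cos (s.im * x)) (fun _ => 1) H := by
            intro x hx
            obtain ⟨k, hk⟩ := hHr s hs x hx
            simp only [hk]
            exact (Real.cos_eq_one_iff _).2 ⟨k, rfl⟩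
          have := (Continuous.ext_on hd (by fun_prop) (by fun_prop) hcos)
          have := congrFun this (Real.pi / s.im)
          simp only [mul_div_cancel₀ _ h0, Real.cos_pi] at this
          norm_num at this
        refine Complex.ext ?_ ?_
        · simpa using ((roots_iff h).1 hs).1
        · simpa using him
      · rintro rfl
        rw [roots_iff h]
        exact ⟨by simp, fun a => ⟨0, by simp⟩⟩
    have h1 := (dense_case h hall).mul_const (mn M p ρ)
    rw [div_mul_cancel₀ _ (mn_pos h).ne'] at h1
    have h2 := (h1.sub_const (Real.Gamma (2 - ρ)))
    rw [sub_self] at h2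
    have h3 := (Complex.continuous_ofReal.tendsto 0).comp h2
    rw [Complex.ofReal_zero] at h3
    refine h3.congr fun t => ?_
    have : ∑' β : rootsLine M A p ρ,
      Complex.Gamma ((2 - ρ : ℝ) - Complex.I * ((β : ℂ).im : ℂ)) *
        Complex.exp (Complex.I * ((β : ℂ).im : ℂ) * t) = Complex.Gamma ((2 - ρ : ℝ)) := by
      rw [hroot, tsum_singleton (ρ : ℂ) (fun β : ℂ => Complex.Gamma ((2 - ρ : ℝ) - Complex.I * (β.im : ℂ)) *
        Complex.exp (Complex.I * (β.im : ℂ) * t))]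
      simp
    rw [this, Complex.Gamma_ofReal]
    simp
  · -- cyclic case
    obtain ⟨a0⟩ := h.nonempty
    have hd0 : d ≠ 0 := by
      rintro rfl
      have : el p a0 ∈ H := AddSubgroup.subset_closure ⟨a0, rfl⟩
      rw [hd, ← AddSubgroup.zmultiples_eq_closure, AddSubgroup.zmultiples_zero_eq_bot, AddSubgroup.mem_bot] at this
      exact (el_pos h a0).ne' this
    wlog hdpos : 0 < d generalizing d
    · refine this (-d) ?_ (by simpa using hd0) ?_
      · rw [hd, ← AddSubgroup.zmultiples_eq_closure, ← AddSubgroup.zmultiples_eq_closure, AddSubgroup.zmultiples_neg]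
      · have := lt_of_le_of_ne (not_lt.1 hdpos) hd0; linarith
    have hdH : d ∈ H := by rw [hd]; exact AddSubgroup.subset_closure rfl
    have hν : ∀ a, ∃ k : ℕ, el p a = k * d := by
      intro a
      have h1 : el p a ∈ H := AddSubgroup.subset_closure ⟨a, rfl⟩
      rw [hd, ← AddSubgroup.zmultiples_eq_closure, AddSubgroup.mem_zmultiples_iff] at h1
      obtain ⟨k, hk⟩ := h1
      rw [zsmul_eq_mul] at hk
      have hk0 : 0 < (k : ℝ) := by
        have := el_pos h a
        rw [← hk] at this
        exact pos_of_mul_pos_left this hdpos.le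
      have hk1 : 0 < k := by exact_mod_cast hk0
      refine ⟨k.toNat, ?_⟩
      rw [← hk]
      congr 1
      exact_mod_cast (Int.toNat_of_nonneg hk1.le).symm
    choose ν hν using hν
    have hmem : ∀ n : ℤ, ((ρ : ℂ) + Complex.I * ((2 * Real.pi * n / d : ℝ) : ℂ)) ∈ rootsLine M A p ρ := by
      intro n
      rw [roots_iff h]
      refine ⟨by simp, fun a => ⟨n * ν a, ?_⟩⟩
      rw [hν]
      simp only [Complex.add_im, Complex.ofReal_im, Complex.I_mul_im, Complex.ofReal_re, zero_add]
      push_cast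
      field_simp
    let e : ℤ ≃ rootsLine M A p ρ := Equiv.ofBijective
      (fun n => ⟨(ρ : ℂ) + Complex.I * ((2 * Real.pi * n / d : ℝ) : ℂ), hmem n⟩) (by
        constructor
        · intro m n hmn
          have := congrArg (fun z : rootsLine M A p ρ => (z : ℂ).im) hmn
          simp only [Complex.add_im, Complex.ofReal_im, Complex.I_mul_im, Complex.ofReal_re, zero_add] at this
          have hpi := Real.pi_pos
          field_simp at this
          exact_mod_cast this
        · rintro ⟨s, hs⟩
          obtain ⟨k, hk⟩ := hHr s hs d hdH
          refine ⟨k, Subtype.ext (Complex.ext ?_ ?_)⟩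
          · simp [((roots_iff h).1 hs).1]
          · simp only [Complex.add_im, Complex.ofReal_im, Complex.I_mul_im, Complex.ofReal_re, zero_add]
            rw [div_eq_iff hd0, hk]; ring)
    refine (cyc_case h hdpos ν hν (hHp hdH)).congr fun t => ?_
    congr 1
    rw [← e.tsum_eq]
    refine tsum_congr fun n => ?_
    have : ((e n : ℂ)).im = 2 * Real.pi * n / d := by
      simp [e, Equiv.ofBijective]
    rw [this]

lemma FF_roots (h : Par M A p ρ) :
    Tendsto (fun n : ℕ => ((FF M p n : ℂ) - ∑' β : rootsLine M A p ρ, (β : ℂ) * GE M A p β * (n : ℂ) ^ ((β : ℂ) - 1)) /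
      ((n : ℝ) ^ (ρ - 1) : ℝ)) atTop (𝓝 0) := by
  have h1 := ((ff_roots h).comp (Real.tendsto_log_atTop.comp tendsto_natCast_atTop_atTop)).div_const (mn M p ρ : ℂ)
  rw [zero_div] at h1
  refine h1.congr' ?_
  filter_upwards [eventually_gt_atTop 0] with n hn
  have hn' : (0:ℝ) < n := by exact_mod_cast hn
  have hnc : (n : ℂ) ≠ 0 := by exact_mod_cast hn.ne'
  have hσ : 0 < (n:ℝ) ^ (ρ - 1) := Real.rpow_pos_of_pos hn' _
  have hσc : (((n:ℝ) ^ (ρ - 1) : ℝ) : ℂ) ≠ 0 := by exact_mod_cast hσ.ne'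
  have n3 : (mn M p ρ : ℂ) ≠ 0 := by exact_mod_cast (mn_pos h).ne'
  simp only [Function.comp]
  have e1 : ff M p ρ (Real.log n) = ((n:ℝ) ^ (ρ - 1))⁻¹ * FF M p n := by
    rw [ff, Real.exp_log hn', Real.exp_neg, Real.rpow_def_of_pos hn', mul_comm (Real.log n)]
  have e2 : ∀ β : rootsLine M A p ρ, (β : ℂ) * GE M A p β * (n : ℂ) ^ ((β : ℂ) - 1) =
      (((n:ℝ) ^ (ρ - 1) : ℝ) / (mn M p ρ) : ℂ) * (Complex.Gamma ((2 - ρ : ℝ) - Complex.I * ((β : ℂ).im : ℂ)) *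
        Complex.exp (Complex.I * ((β : ℂ).im : ℂ) * (Real.log n : ℝ))) := by
    intro β
    have hb := ((roots_iff h).1 β.2).1
    rw [bGE h β.2, Complex.cpow_def_of_ne_zero hnc, Real.rpow_def_of_pos hn']
    have : Complex.exp (Complex.log n * ((β : ℂ) - 1)) = ((Real.exp (Real.log n * (ρ - 1)) : ℝ) : ℂ) *
        Complex.exp (Complex.I * ((β : ℂ).im : ℂ) * (Real.log n : ℝ)) := by
      rw [Complex.ofReal_exp, ← Complex.exp_add, ← Complex.natCast_log]
      congr 1
      conv_lhs => rw [← Complex.re_add_im (β : ℂ), hb]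
      push_cast; ring
    rw [this]; ring
  simp only [e2]
  rw [tsum_mul_left, e1]
  generalize (∑' β : rootsLine M A p ρ, (Complex.Gamma ((2 - ρ : ℝ) - Complex.I * ((β : ℂ).im : ℂ)) *
        Complex.exp (Complex.I * ((β : ℂ).im : ℂ) * (Real.log n : ℝ)))) = Z
  rw [Complex.ofReal_mul, Complex.ofReal_inv]
  field_simp

end GT

open MeasureTheory ProbabilityTheory Filter Topology

namespace GT

/-- bounded measurable -/
def BM {Ω : Type*} [MeasurableSpace Ω] (f : Ω → ℝ) : Prop := Measurable f ∧ ∃ C, ∀ ω, |f ω| ≤ C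

section BM
variable {Ω Ω' : Type*} [MeasurableSpace Ω] [MeasurableSpace Ω'] {f g : Ω → ℝ}

lemma BM.meas (hf : BM f) : Measurable f := hf.1

lemma BM.int (hf : BM f) (μ : Measure Ω) [IsFiniteMeasure μ] : Integrable f μ := by
  obtain ⟨h1, C, hC⟩ := hf
  exact Integrable.of_bound h1.aestronglyMeasurable C (Eventually.of_forall hC)

lemma BM.const (c : ℝ) : BM (fun _ : Ω => c) := ⟨measurable_const, |c|, fun _ => le_rfl⟩

lemma BM.add (hf : BM f) (hg : BM g) : BM (fun ω => f ω + g ω) := by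
  obtain ⟨h1, C, hC⟩ := hf
  obtain ⟨h2, D, hD⟩ := hg
  exact ⟨h1.add h2, C + D, fun ω => (abs_add_le _ _).trans (add_le_add (hC ω) (hD ω))⟩

lemma BM.neg (hf : BM f) : BM (fun ω => -f ω) := by
  obtain ⟨h1, C, hC⟩ := hf
  exact ⟨h1.neg, C, fun ω => by rw [abs_neg]; exact hC ω⟩

lemma BM.sub (hf : BM f) (hg : BM g) : BM (fun ω => f ω - g ω) := by
  simpa [sub_eq_add_neg] using hf.add hg.neg

lemma BM.mul (hf : BM f) (hg : BM g) : BM (fun ω => f ω * g ω) := by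
  obtain ⟨h1, C, hC⟩ := hf
  obtain ⟨h2, D, hD⟩ := hg
  refine ⟨h1.mul h2, C * D, fun ω => ?_⟩
  rw [abs_mul]
  exact mul_le_mul (hC ω) (hD ω) (abs_nonneg _) ((abs_nonneg _).trans (hC ω))

lemma BM.pow (hf : BM f) (k : ℕ) : BM (fun ω => f ω ^ k) := by
  induction k with
  | zero => simpa using BM.const 1
  | succ k ih => simpa [pow_succ] using ih.mul hf

lemma BM.sum {ι : Type*} (s : Finset ι) {F : ι → Ω → ℝ} (hF : ∀ i ∈ s, BM (F i)) : BM (fun ω => ∑ i ∈ s, F i ω) := by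
  classical
  induction s using Finset.induction_on with
  | empty => simpa using BM.const 0
  | insert a s ha ih =>
    simp only [Finset.sum_insert ha]
    exact (hF a (Finset.mem_insert_self a s)).add (ih fun i hi => hF i (Finset.mem_insert_of_mem hi))

lemma BM.comp (hf : BM f) {φ : Ω' → Ω} (hφ : Measurable φ) : BM (fun ω => f (φ ω)) :=
  ⟨hf.1.comp hφ, hf.2.imp fun _ h ω => h _⟩

lemma BM.abs (hf : BM f) : BM (fun ω => |f ω|) := by
  obtain ⟨h1, C, hC⟩ := hf
  exact ⟨h1.abs, C, fun ω => by rw [abs_abs]; exact hC ω⟩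

lemma BM.integral {F : Ω' × Ω → ℝ} (hF : BM F) (μ : Measure Ω) [IsProbabilityMeasure μ] :
    BM (fun y => ∫ x, F (y, x) ∂μ) := by
  obtain ⟨h1, C, hC⟩ := hF
  refine ⟨?_, C, fun y => ?_⟩
  · exact (h1.stronglyMeasurable.integral_prod_right').measurable
  · have := norm_integral_le_of_norm_le_const (μ := μ) (f := fun x => F (y, x)) (C := C)
      (Eventually.of_forall fun x => hC _)
    simpa using this

/-- Jensen for even powers -/
lemma jensen_even (hf : BM f) (μ : Measure Ω) [IsProbabilityMeasure μ] (q : ℕ) :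
    (∫ ω, f ω ∂μ) ^ (2 * q) ≤ ∫ ω, f ω ^ (2 * q) ∂μ := by
  exact (Even.convexOn_pow (even_two_mul q)).map_integral_le (continuous_pow _).continuousOn isClosed_univ
    (Eventually.of_forall fun _ => trivial) (hf.int μ) ((hf.pow _).int μ)

end BM

variable {Ω : Type*} [MeasurableSpace Ω]

/-- Separate coordinate zero. -/
lemma int_cons (ν : Measure Ω) [IsProbabilityMeasure ν] (n : ℕ) {f : (Fin (n + 1) → Ω) → ℝ} (hf : BM f) :
    ∫ ω, f ω ∂(Measure.pi fun _ => ν) = ∫ y, ∫ x, f (Fin.cons x y) ∂ν ∂(Measure.pi fun _ : Fin n => ν) := by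
  rw [← ((measurePreserving_piFinSuccAbove (fun _ : Fin (n + 1) => ν) 0).symm).integral_comp']
  simp_rw [MeasurableEquiv.piFinSuccAbove_symm_apply, Fin.insertNthEquiv, Equiv.coe_fn_mk, Fin.insertNth_zero]
  rw [integral_prod_symm]
  · simp only [cast_eq]
  · have h1 := ((measurePreserving_piFinSuccAbove (fun _ : Fin (n + 1) => ν) 0).symm).measurable
    have := (hf.comp h1).int (ν.prod (Measure.pi fun _ : Fin n => ν))
    refine this.congr (Eventually.of_forall fun x => ?_)
    simp only [MeasurableEquiv.piFinSuccAbove_symm_apply, Fin.insertNthEquiv, Equiv.coe_fn_mk, Fin.insertNth_zero]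

lemma meas_cons (n : ℕ) : Measurable (fun z : (Fin n → Ω) × Ω => (Fin.cons z.2 z.1 : Fin (n + 1) → Ω)) := by
  rw [measurable_pi_iff]
  intro i
  refine Fin.cases ?_ (fun j => ?_) i
  · simpa using measurable_snd
  · simp only [Fin.cons_succ]
    exact (measurable_pi_apply j).comp measurable_fst

lemma meas_cons' (n : ℕ) (y : Fin n → Ω) : Measurable (fun x : Ω => (Fin.cons x y : Fin (n + 1) → Ω)) :=
  (meas_cons n).comp (measurable_const.prodMk measurable_id)

/-- Moment bound of Efron-Stein type. -/
lemma ES_gen (ν : Measure Ω) [IsProbabilityMeasure ν] (q : ℕ) (hq : 1 ≤ q) (a b : ℕ → ℝ) (K : ℝ) (hK : 0 ≤ K)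
    (ha : ∀ n, 0 ≤ a n) (hb : ∀ n, 0 ≤ b n)
    (hab : ∀ n z δ, (z + δ) ^ (2 * q) ≤ a n * z ^ (2 * q) + 2 * q * z ^ (2 * q - 1) * δ + b n * δ ^ (2 * q))
    (hrec : ∀ n : ℕ, a n * (K * n ^ q) + b n * 4 ^ q ≤ K * ((n + 1 : ℕ) : ℝ) ^ q) (B : ℝ) (hB : 0 ≤ B) (n : ℕ) :
    ∀ (f : (Fin n → Ω) → ℝ) (X : Fin n → (Fin n → Ω) → ℝ), BM f → (∀ i, BM (X i)) →
    (∀ i ω b, f (Function.update ω i b) - X i (Function.update ω i b) = f ω - X i ω) →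
    (∀ i, ∫ ω, X i ω ^ (2 * q) ∂(Measure.pi fun _ => ν) ≤ B) →
    ∫ ω, (f ω - ∫ ω', f ω' ∂(Measure.pi fun _ => ν)) ^ (2 * q) ∂(Measure.pi fun _ => ν) ≤ K * n ^ q * B := by
  induction n with
  | zero =>
    intro f X hf hX hfX hXB
    have hc : ∀ ω, f ω = f (fun i => i.elim0) := fun ω => congrArg f (Subsingleton.elim _ _)
    simp only [hc, integral_const, probReal_univ, one_smul, sub_self]
    rw [zero_pow (by omega)]
    positivity
  | succ n ih =>
    intro f X hf hX hfX hXB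
    set P := Measure.pi fun _ : Fin n => ν with hP
    set f1 : (Fin n → Ω) → ℝ := fun y => ∫ x, f (Fin.cons x y) ∂ν with hf1
    have hf1b : BM f1 := BM.integral (hf.comp (meas_cons n)) ν
    have hXc : ∀ i, BM fun y => ∫ x, X i (Fin.cons x y) ∂ν := fun i => BM.integral ((hX i).comp (meas_cons n)) ν
    have hEf : ∫ ω', f ω' ∂(Measure.pi fun _ => ν) = ∫ y, f1 y ∂P := int_cons ν n hf
    have h1 := ih f1 (fun i y => ∫ x, X i.succ (Fin.cons x y) ∂ν) hf1b (fun i => hXc i.succ) ?_ ?_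
    rotate_left
    · intro i y b
      simp only [hf1]
      rw [← integral_sub ((hf.comp (meas_cons' n _)).int ν) (((hX i.succ).comp (meas_cons' n _)).int ν),
        ← integral_sub ((hf.comp (meas_cons' n _)).int ν) (((hX i.succ).comp (meas_cons' n _)).int ν)]
      refine integral_congr_ae (Eventually.of_forall fun x => ?_)
      have := hfX i.succ (Fin.cons x y) b
      simp only [← Fin.cons_update] at this
      exact this
    · intro i
      refine le_trans ?_ (hXB i.succ)
      rw [int_cons ν n ((hX i.succ).pow _)]
      refine integral_mono (((hXc i.succ).pow _).int P) ((BM.integral (((hX i.succ).pow _).comp (meas_cons n)) ν).int P) fun y => ?_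
      exact jensen_even ((hX i.succ).comp (meas_cons' n y)) ν q
    -- the increment
    set m := ∫ y, f1 y ∂P with hm
    rw [hEf, int_cons ν n ((hf.sub (BM.const m)).pow _)]
    have hpt : ∀ y, ∫ x, (f (Fin.cons x y) - m) ^ (2 * q) ∂ν ≤
        a n * (f1 y - m) ^ (2 * q) + b n * (4 ^ q * ∫ x, X 0 (Fin.cons x y) ^ (2 * q) ∂ν) := by
      intro y
      have hfy := hf.comp (meas_cons' n y)
      have hXy := (hX 0).comp (meas_cons' n y)
      set xb := ∫ x, X 0 (Fin.cons x y) ∂ν with hxb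
      have hD : ∀ x, f (Fin.cons x y) - f1 y = X 0 (Fin.cons x y) - xb := by
        intro x
        have h2 : ∀ x', f (Fin.cons x' y) = X 0 (Fin.cons x' y) + (f (Fin.cons x y) - X 0 (Fin.cons x y)) := by
          intro x'
          have := hfX 0 (Fin.cons x y) x'
          rw [Fin.update_cons_zero] at this
          linarith
        have h3 : f1 y = xb + (f (Fin.cons x y) - X 0 (Fin.cons x y)) := by
          simp only [hf1]
          rw [integral_congr_ae (Eventually.of_forall h2), integral_add (hXy.int ν) (integrable_const _)]
          simp [hxb]
        rw [h3]; ring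
      have hDb : BM fun x => f (Fin.cons x y) - f1 y := hfy.sub (BM.const _)
      have hD0 : ∫ x, (f (Fin.cons x y) - f1 y) ∂ν = 0 := by
        rw [integral_sub (hfy.int ν) (integrable_const _)]; simp [hf1]
      have hDq : ∫ x, (f (Fin.cons x y) - f1 y) ^ (2 * q) ∂ν ≤ 4 ^ q * ∫ x, X 0 (Fin.cons x y) ^ (2 * q) ∂ν := by
        simp only [hD]
        have hpw : ∀ x, (X 0 (Fin.cons x y) - xb) ^ (2 * q) ≤
            2 ^ (2 * q - 1) * (X 0 (Fin.cons x y) ^ (2 * q) + xb ^ (2 * q)) := by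
          intro x
          have := (even_two_mul q).add_pow_le (a := X 0 (Fin.cons x y)) (b := -xb)
          rwa [(even_two_mul q).neg_pow, ← sub_eq_add_neg] at this
        refine (integral_mono (((hXy.sub (BM.const _)).pow _).int ν)
          ((((hXy.pow _).add (BM.const _)).int ν).const_mul _) hpw).trans ?_
        rw [integral_const_mul, integral_add ((hXy.pow _).int ν) (integrable_const _)]
        simp only [integral_const, probReal_univ, one_smul]
        have hj := jensen_even hXy ν q
        have : (4:ℝ) ^ q = 2 ^ (2 * q - 1) * 2 := by
          rw [← pow_succ, Nat.sub_add_cancel (by omega), pow_mul]; norm_num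
        rw [this, mul_assoc]
        refine mul_le_mul_of_nonneg_left ?_ (by positivity)
        linarith
      have hle : ∀ x, (f (Fin.cons x y) - m) ^ (2 * q) ≤ a n * (f1 y - m) ^ (2 * q) +
          2 * q * (f1 y - m) ^ (2 * q - 1) * (f (Fin.cons x y) - f1 y) + b n * (f (Fin.cons x y) - f1 y) ^ (2 * q) := by
        intro x
        have := hab n (f1 y - m) (f (Fin.cons x y) - f1 y)
        convert this using 2; ring
      refine (integral_mono (((hfy.sub (BM.const _)).pow _).int ν) ((((BM.const _).add ((BM.const _).mul hDb)).add
        ((BM.const _).mul (hDb.pow _))).int ν) hle).trans ?_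
      rw [integral_add (((BM.const _).add ((BM.const _).mul hDb)).int ν) (((BM.const _).mul (hDb.pow _)).int ν),
        integral_add ((BM.const _).int ν) (((BM.const _).mul hDb).int ν)]
      simp only [integral_const_mul, hD0, integral_const, probReal_univ, one_smul, mul_zero, add_zero]
      have := mul_le_mul_of_nonneg_left hDq (hb n)
      linarith
    have hXq := BM.integral (((hX 0).pow (2 * q)).comp (meas_cons n)) ν
    refine (integral_mono ((BM.integral (((hf.sub (BM.const m)).pow _).comp (meas_cons n)) ν).int P)
      ((((BM.const _).mul ((hf1b.sub (BM.const _)).pow _)).add ((BM.const _).mul ((BM.const _).mul hXq))).int P) hpt).trans ?_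
    rw [integral_add (((BM.const _).mul ((hf1b.sub (BM.const _)).pow _)).int P) (((BM.const _).mul ((BM.const _).mul hXq)).int P),
      integral_const_mul, integral_const_mul, integral_const_mul]
    have hX0 := hXB 0
    rw [int_cons ν n ((hX 0).pow _)] at hX0
    have := hrec n
    calc _ ≤ a n * (K * n ^ q * B) + b n * (4 ^ q * B) := by
          gcongr
          · exact ha n
          · exact hb n
      _ = (a n * (K * n ^ q) + b n * 4 ^ q) * B := by ring
      _ ≤ _ := by gcongr

lemma ES_two (ν : Measure Ω) [IsProbabilityMeasure ν] (B : ℝ) (hB : 0 ≤ B) (n : ℕ)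
    (f : (Fin n → Ω) → ℝ) (X : Fin n → (Fin n → Ω) → ℝ) (hf : BM f) (hX : ∀ i, BM (X i))
    (h1 : ∀ i ω b, f (Function.update ω i b) - X i (Function.update ω i b) = f ω - X i ω)
    (h2 : ∀ i, ∫ ω, X i ω ^ 2 ∂(Measure.pi fun _ => ν) ≤ B) :
    ∫ ω, (f ω - ∫ ω', f ω' ∂(Measure.pi fun _ => ν)) ^ 2 ∂(Measure.pi fun _ => ν) ≤ 4 * n * B := by
  have := ES_gen ν 1 le_rfl (fun _ => 1) (fun _ => 1) 4 (by norm_num) (by simp) (by simp)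
    (fun n z δ => by norm_num; nlinarith) (fun n => by norm_num; linarith) B hB n f X hf hX h1 (by simpa using h2)
  simpa using this

lemma pow_ineq (q : ℕ) (hq : 1 ≤ q) (z δ : ℝ) : (z + δ) ^ (2 * q) ≤ z ^ (2 * q) + 2 * q * z ^ (2 * q - 1) * δ +
    4 ^ q * (z ^ (2 * q - 2) * δ ^ 2 + δ ^ (2 * q)) := by
  obtain ⟨r, rfl⟩ : ∃ r, q = r + 1 := ⟨q - 1, by omega⟩
  have e1 : 2 * (r + 1) - 2 = 2 * r := by omega
  have e2 : 2 * (r + 1) - 1 = 2 * r + 1 := by omega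
  rw [e1, e2]
  set Q := z ^ (2 * r) * δ ^ 2 + δ ^ (2 * (r + 1)) with hQ
  have hQ0 : 0 ≤ Q := by
    have h1 : 0 ≤ z ^ (2 * r) := (even_two_mul r).pow_nonneg z
    have h2 : 0 ≤ δ ^ (2 * (r + 1)) := (even_two_mul _).pow_nonneg δ
    positivity
  rw [add_comm z δ, add_pow, show 2 * (r + 1) + 1 = 2 * r + 1 + 1 + 1 by ring, Finset.sum_range_succ', Finset.sum_range_succ']
  have hk : ∀ k ∈ Finset.range (2 * r + 1), δ ^ (k + 1 + 1) * z ^ (2 * (r + 1) - (k + 1 + 1)) * ((2 * (r + 1)).choose (k + 1 + 1) : ℝ) ≤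
      Q * ((2 * (r + 1)).choose (k + 1 + 1) : ℝ) := by
    intro k hk
    rw [Finset.mem_range] at hk
    gcongr
    have hs : 2 * (r + 1) - (k + 1 + 1) = 2 * r - k := by omega
    rw [hs]
    refine (le_abs_self _).trans ?_
    rw [abs_mul, abs_pow, abs_pow]
    have ez : z ^ (2 * r) = |z| ^ (2 * r) := ((even_two_mul r).pow_abs z).symm
    have ed : δ ^ (2 * (r + 1)) = |δ| ^ (2 * (r + 1)) := ((even_two_mul _).pow_abs δ).symm
    rw [hQ, ez, ed, ← sq_abs δ]
    rcases le_total |δ| |z| with hh | hh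
    · calc |δ| ^ (k + 1 + 1) * |z| ^ (2 * r - k) = |δ| ^ k * |z| ^ (2 * r - k) * |δ| ^ 2 := by ring
        _ ≤ |z| ^ k * |z| ^ (2 * r - k) * |δ| ^ 2 := by gcongr
        _ = |z| ^ (2 * r) * |δ| ^ 2 := by rw [← pow_add]; congr 2; omega
        _ ≤ _ := le_add_of_nonneg_right (by positivity)
    · calc |δ| ^ (k + 1 + 1) * |z| ^ (2 * r - k) ≤ |δ| ^ (k + 1 + 1) * |δ| ^ (2 * r - k) := by gcongr
        _ = |δ| ^ (2 * (r + 1)) := by rw [← pow_add]; congr 1; omega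
        _ ≤ _ := le_add_of_nonneg_left (by positivity)
  have hs := Finset.sum_le_sum hk
  rw [← Finset.mul_sum] at hs
  have hch : ∑ k ∈ Finset.range (2 * r + 1), ((2 * (r + 1)).choose (k + 1 + 1) : ℝ) ≤ 4 ^ (r + 1) := by
    have h1 := Nat.sum_range_choose (2 * (r + 1))
    rw [show 2 * (r + 1) + 1 = 2 * r + 1 + 1 + 1 by ring, Finset.sum_range_succ', Finset.sum_range_succ', pow_mul] at h1
    have h2 : ∑ k ∈ Finset.range (2 * r + 1), ((2 * (r + 1)).choose (k + 1 + 1)) ≤ 4 ^ (r + 1) := by norm_num at h1 ⊢; omega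
    exact_mod_cast h2
  have := mul_le_mul_of_nonneg_left hch hQ0
  have e3 : 2 * (r + 1) - (0 + 1) = 2 * r + 1 := by omega
  rw [e3]
  simp only [zero_add, pow_one, Nat.choose_one_right, pow_zero, one_mul, Nat.sub_zero, Nat.choose_zero_right, Nat.cast_one, mul_one]
  push_cast
  nlinarith

lemma young_ineq (r : ℕ) {η : ℝ} (hη : 0 < η) (z δ : ℝ) :
    z ^ (2 * r) * δ ^ 2 ≤ η * z ^ (2 * (r + 1)) + η⁻¹ ^ r * δ ^ (2 * (r + 1)) := by
  simp only [pow_mul, pow_succ (z ^ 2), pow_succ (δ ^ 2)]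
  have hz := sq_nonneg z
  have hd := sq_nonneg δ
  generalize z ^ 2 = x at *
  generalize δ ^ 2 = y at *
  rcases le_total y (η * x) with hh | hh
  · calc x ^ r * y ≤ x ^ r * (η * x) := by gcongr
      _ = η * (x ^ r * x) := by ring
      _ ≤ _ := le_add_of_nonneg_right (by positivity)
  · have : x ≤ η⁻¹ * y := by rw [← div_eq_inv_mul, le_div_iff₀ hη]; linarith
    calc x ^ r * y ≤ (η⁻¹ * y) ^ r * y := by gcongr
      _ = η⁻¹ ^ r * (y ^ r * y) := by rw [mul_pow]; ring
      _ ≤ _ := le_add_of_nonneg_left (by positivity)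

lemma ES_even (q : ℕ) (hq : 1 ≤ q) : ∃ K ≥ 0, ∀ (Ω : Type) [MeasurableSpace Ω] (ν : Measure Ω) [IsProbabilityMeasure ν] (B : ℝ), 0 ≤ B → ∀ (n : ℕ)
    (f : (Fin n → Ω) → ℝ) (X : Fin n → (Fin n → Ω) → ℝ), BM f → (∀ i, BM (X i)) →
    (∀ i ω b, f (Function.update ω i b) - X i (Function.update ω i b) = f ω - X i ω) →
    (∀ i, ∫ ω, X i ω ^ (2 * q) ∂(Measure.pi fun _ => ν) ≤ B) →
    ∫ ω, (f ω - ∫ ω', f ω' ∂(Measure.pi fun _ => ν)) ^ (2 * q) ∂(Measure.pi fun _ => ν) ≤ K * n ^ q * B := by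
  rcases Nat.lt_or_ge 1 q with h1 | h1
  · obtain ⟨r, rfl⟩ : ∃ r, q = r + 2 := ⟨q - 2, by omega⟩
    set C : ℝ := 4 ^ (r + 2) with hC
    have hC1 : 1 ≤ C := one_le_pow₀ (by norm_num)
    set K : ℝ := C * (C ^ (r + 1) + 1) * 4 ^ (r + 2) with hK
    have hK0 : 0 ≤ K := by positivity
    refine ⟨K, hK0, fun Ω _ ν _ B hB n f X hf hX h2 h3 => ?_⟩
    refine ES_gen ν (r + 2) hq (fun n => 1 + 1 / (n + 1)) (fun n => C * ((C * (n + 1)) ^ (r + 1) + 1)) K hK0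
      (fun n => by positivity) (fun n => by positivity) ?_ ?_ B hB n f X hf hX h2 h3
    · intro n z δ
      refine (pow_ineq (r + 2) hq z δ).trans ?_
      have hη : 0 < (C * (n + 1))⁻¹ := by positivity
      have hy := young_ineq (r + 1) hη z δ
      have e1 : 2 * (r + 2) - 2 = 2 * (r + 1) := by omega
      rw [e1]
      rw [inv_inv] at hy
      have hC0 : 0 < C := by positivity
      have := mul_le_mul_of_nonneg_left hy hC0.le
      have e2 : C * ((C * (n + 1))⁻¹ * z ^ (2 * (r + 1 + 1)) + (C * (n + 1)) ^ (r + 1) * δ ^ (2 * (r + 1 + 1))) =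
        1 / (n + 1) * z ^ (2 * (r + 2)) + C * (C * (n + 1)) ^ (r + 1) * δ ^ (2 * (r + 2)) := by
        have : (n : ℝ) + 1 ≠ 0 := by positivity
        field_simp
      rw [e2] at this
      rw [← hC]
      linarith
    · intro n
      have e1 : C * ((C * (n + 1)) ^ (r + 1) + 1) * 4 ^ (r + 2) ≤ K * (n + 1) ^ (r + 1) := by
        have h4 : (1:ℝ) ≤ (n + 1) ^ (r + 1) := one_le_pow₀ (by linarith [Nat.cast_nonneg (α := ℝ) n])
        rw [hK, mul_pow]
        calc _ ≤ C * (C ^ (r + 1) * (n + 1) ^ (r + 1) + (n + 1) ^ (r + 1)) * 4 ^ (r + 2) := by gcongr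
          _ = _ := by ring
      have e2 : (1 + 1 / ((n:ℝ) + 1)) * (n:ℝ) ^ (r + 2) ≤ n * ((n:ℝ) + 1) ^ (r + 1) := by
        have h5 : (n:ℝ) ^ (r + 2) / (n + 1) ≤ n ^ (r + 1) := by
          rw [div_le_iff₀ (by positivity), pow_succ]
          gcongr; linarith
        have h6 : (n:ℝ) ^ r ≤ (n + 1) ^ r := by gcongr; linarith
        calc _ = (n:ℝ) ^ (r + 2) + (n:ℝ) ^ (r + 2) / (n + 1) := by ring
          _ ≤ (n:ℝ) ^ (r + 2) + n ^ (r + 1) := by gcongr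
          _ = n * (n + 1) * n ^ r := by ring
          _ ≤ n * (n + 1) * (n + 1) ^ r := by gcongr
          _ = _ := by ring
      push_cast
      calc _ ≤ K * (n * ((n:ℝ) + 1) ^ (r + 1)) + K * (n + 1) ^ (r + 1) := by
            refine add_le_add ?_ e1
            calc _ = K * ((1 + 1 / ((n:ℝ) + 1)) * (n:ℝ) ^ (r + 2)) := by ring
              _ ≤ _ := by gcongr
        _ = _ := by ring
  · obtain rfl : q = 1 := by omega
    refine ⟨4, by norm_num, fun Ω _ ν _ B hB n f X hf hX h2 h3 => ?_⟩
    have := ES_two ν B hB n f X hf hX h2 (by simpa using h3)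
    simpa using this

end GT

open MeasureTheory ProbabilityTheory Filter Topology

namespace GT

lemma gaussianMoment_succ (m : ℕ) : gaussianMoment (m + 2) = (m + 1) * gaussianMoment m := by
  unfold gaussianMoment
  rcases Nat.even_or_odd m with h | h
  · obtain ⟨r, rfl⟩ := h
    have h1 : Even (r + r + 2) := ⟨r + 1, by ring⟩
    have h2 : Even (r + r) := ⟨r, rfl⟩
    rw [if_pos h1, if_pos h2]
    have e1 : (r + r + 2) / 2 = r + 1 := by omega
    have e2 : (r + r) / 2 = r := by omega
    rw [e1, e2, Nat.factorial_succ, Nat.factorial_succ (r + r), Nat.factorial_succ r]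
    push_cast
    have : (r.factorial : ℝ) ≠ 0 := by positivity
    field_simp
    ring
  · have h1 : ¬ Even (m + 2) := by rw [Nat.not_even_iff_odd]; obtain ⟨r, rfl⟩ := h; exact ⟨r + 1, by ring⟩
    have h2 : ¬ Even m := Nat.not_even_iff_odd.mpr h
    rw [if_neg h1, if_neg h2, mul_zero]

lemma sqrt_diff (m : ℕ) : Tendsto (fun j : ℕ => (√((j + 1 : ℕ) : ℝ) ^ (m + 2) - √(j : ℝ) ^ (m + 2)) / √(j : ℝ) ^ m)
    atTop (𝓝 (((m : ℝ) + 2) / 2)) := by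
  have hd : HasDerivAt (fun x : ℝ => x ^ (((m : ℝ) + 2) / 2)) (((m : ℝ) + 2) / 2) 1 := by
    have := Real.hasDerivAt_rpow_const (x := 1) (p := ((m : ℝ) + 2) / 2) (Or.inl one_ne_zero)
    simpa using this
  have h1 := hd.tendsto_slope
  have h2 : Tendsto (fun j : ℕ => 1 + 1 / (j : ℝ)) atTop (𝓝[≠] 1) := by
    rw [tendsto_nhdsWithin_iff]
    constructor
    · simpa using (tendsto_one_div_atTop_nhds_zero_nat (𝕜 := ℝ)).const_add 1
    · filter_upwards [eventually_gt_atTop 0] with j hj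
      have : (0:ℝ) < 1 / j := by positivity
      simp only [Set.mem_compl_iff, Set.mem_singleton_iff]
      linarith
  refine (h1.comp h2).congr' ?_
  filter_upwards [eventually_gt_atTop 0] with j hj
  have hj' : (0:ℝ) < j := by exact_mod_cast hj
  simp only [Function.comp, slope_def_field, Real.one_rpow]
  have e : ∀ x : ℝ, 0 ≤ x → √x ^ (m + 2) = x ^ (((m : ℝ) + 2) / 2) := by
    intro x hx
    rw [Real.sqrt_eq_rpow, ← Real.rpow_natCast, ← Real.rpow_mul hx]
    congr 1; push_cast; ring
  have e2 : √(j : ℝ) ^ m = √(j : ℝ) ^ (m + 2) / j := by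
    rw [pow_add, Real.sq_sqrt hj'.le]; field_simp
  rw [e2, e _ (Nat.cast_nonneg _), e _ hj'.le]
  have e3 : ((j + 1 : ℕ) : ℝ) = j * (1 + 1 / j) := by push_cast; field_simp
  rw [e3, Real.mul_rpow hj'.le (by positivity)]
  have : (j : ℝ) ^ (((m : ℝ) + 2) / 2) ≠ 0 := by positivity
  field_simp
  ring

lemma stolz (m : ℕ) (D : ℕ → ℝ) (d : ℝ) (hD : Tendsto (fun n : ℕ => D n / √(n : ℝ) ^ m) atTop (𝓝 d)) :
    Tendsto (fun n : ℕ => (∑ j ∈ Finset.range n, D j) / √(n : ℝ) ^ (m + 2)) atTop (𝓝 (d * (2 / (m + 2)))) := by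
  set g : ℕ → ℝ := fun j => √((j + 1 : ℕ) : ℝ) ^ (m + 2) - √(j : ℝ) ^ (m + 2) with hg
  have hg0 : ∀ j, 0 ≤ g j := by
    intro j
    simp only [hg, sub_nonneg]
    gcongr; simp
  have hsum : ∀ n, ∑ j ∈ Finset.range n, g j = √(n : ℝ) ^ (m + 2) := by
    intro n
    rw [hg, Finset.sum_range_sub (fun j : ℕ => √(j : ℝ) ^ (m + 2))]
    simp
  have hgt := sqrt_diff m
  have hm : (0:ℝ) < (m + 2) / 2 := by positivity
  have hq : Tendsto (fun n => D n / g n) atTop (𝓝 (d * (2 / (m + 2)))) := by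
    have := hD.div hgt hm.ne'
    rw [show d / (((m : ℝ) + 2) / 2) = d * (2 / (m + 2)) by field_simp] at this
    refine this.congr' ?_
    filter_upwards [eventually_gt_atTop 0] with j hj
    have hj' : (0:ℝ) < j := by exact_mod_cast hj
    have : 0 < √(j:ℝ) ^ m := by positivity
    simp only [Pi.div_apply, hg]
    rw [div_div_div_cancel_right₀ this.ne']
  have hgpos : ∀ᶠ j in atTop, 0 < g j := by
    filter_upwards with j
    simp only [hg, sub_pos]
    refine pow_lt_pow_left₀ (Real.sqrt_lt_sqrt (by positivity) (by push_cast; linarith)) (Real.sqrt_nonneg _) (by omega)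
  have hlo : (fun n => D n - d * (2 / (m + 2)) * g n) =o[atTop] g := by
    rw [Asymptotics.isLittleO_iff_tendsto' (hgpos.mono fun j hj h => absurd h hj.ne')]
    have := hq.sub_const (d * (2 / (m + 2)))
    rw [sub_self] at this
    refine this.congr' ?_
    filter_upwards [hgpos] with j hj
    field_simp
  have htop : Tendsto (fun n : ℕ => √(n : ℝ) ^ (m + 2)) atTop atTop :=
    (tendsto_pow_atTop (by omega)).comp (Real.tendsto_sqrt_atTop.comp tendsto_natCast_atTop_atTop)
  have h3 := hlo.sum_range hg0 (by simpa only [hsum] using htop)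
  simp only [Finset.sum_sub_distrib, ← Finset.mul_sum, hsum] at h3
  have h4 := (h3.tendsto_div_nhds_zero).add_const (d * (2 / (m + 2)))
  rw [zero_add] at h4
  refine h4.congr' ?_
  filter_upwards [eventually_gt_atTop 0] with j hj
  have hj' : (0:ℝ) < j := by exact_mod_cast hj
  have : 0 < √(j:ℝ) ^ (m + 2) := by positivity
  field_simp
  ring

lemma clt_abs (a : ℕ → ℕ → ℝ) (e : ℕ → ℝ) (s : ℝ) (hs : s ^ 2 = e 2) (e0 : e 0 = 1) (e1 : e 1 = 0)
    (h0 : a 0 0 = 1) (hm0 : ∀ m, 0 < m → a m 0 = 0)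
    (hrec : ∀ m n, a m (n + 1) = ∑ k ∈ Finset.range (m + 1), (m.choose k : ℝ) * e k * a (m - k) n) (m : ℕ) :
    Tendsto (fun n : ℕ => a m n / √(n : ℝ) ^ m) atTop (𝓝 (gaussianMoment m * s ^ m)) := by
  induction m using Nat.strong_induction_on with
  | _ m ih =>
  match m, ih with
  | 0, _ =>
    have : ∀ n, a 0 n = 1 := by
      intro n
      induction n with
      | zero => exact h0
      | succ n ih => rw [hrec]; simp [ih, e0]
    simp [this, gaussianMoment]
  | 1, _ =>
    have : ∀ n, a 1 n = 0 := by
      intro n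
      induction n with
      | zero => exact hm0 1 (by omega)
      | succ n ih => rw [hrec]; simp [Finset.sum_range_succ, ih, e1]
    simp [this, gaussianMoment]
  | m + 2, ih =>
    have hD : ∀ n, a (m + 2) (n + 1) - a (m + 2) n =
        ((m + 2).choose 2 : ℝ) * e 2 * a m n + ∑ k ∈ Finset.range m, ((m + 2).choose (k + 3) : ℝ) * e (k + 3) * a (m + 2 - (k + 3)) n := by
      intro n
      rw [hrec, Finset.sum_range_succ', Finset.sum_range_succ', Finset.sum_range_succ']
      simp [e0, e1]
      ring
    have hDt : Tendsto (fun n : ℕ => (a (m + 2) (n + 1) - a (m + 2) n) / √(n : ℝ) ^ m) atTop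
        (𝓝 (((m + 2).choose 2 : ℝ) * e 2 * (gaussianMoment m * s ^ m))) := by
      simp only [hD, add_div, Finset.sum_div]
      rw [show ((m + 2).choose 2 : ℝ) * e 2 * (gaussianMoment m * s ^ m) = ((m + 2).choose 2 : ℝ) * e 2 * (gaussianMoment m * s ^ m) +
        ∑ k ∈ Finset.range m, (0:ℝ) by simp]
      refine Tendsto.add ?_ (tendsto_finsetSum _ fun k hk => ?_)
      · simp only [mul_div_assoc]
        exact (ih m (by omega)).const_mul _
      · rw [Finset.mem_range] at hk
        have h1 := (ih (m + 2 - (k + 3)) (by omega)).const_mul (((m + 2).choose (k + 3) : ℝ) * e (k + 3))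
        have h2 : Tendsto (fun n : ℕ => (√(n : ℝ) ^ (k + 1))⁻¹) atTop (𝓝 0) :=
          tendsto_inv_atTop_zero.comp ((tendsto_pow_atTop (by omega)).comp (Real.tendsto_sqrt_atTop.comp tendsto_natCast_atTop_atTop))
        have h3 := h1.mul h2
        rw [mul_zero] at h3
        refine h3.congr fun n => ?_
        have : √(n : ℝ) ^ m = √(n : ℝ) ^ (m + 2 - (k + 3)) * √(n : ℝ) ^ (k + 1) := by
          rw [← pow_add]; congr 1; omega
        rw [this, div_eq_mul_inv, div_eq_mul_inv, mul_inv]; ring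
    have h4 := stolz m _ _ hDt
    have h5 : ((m + 2).choose 2 : ℝ) * e 2 * (gaussianMoment m * s ^ m) * (2 / (m + 2)) = gaussianMoment (m + 2) * s ^ (m + 2) := by
      rw [gaussianMoment_succ, ← hs, Nat.cast_choose_two]
      push_cast
      have : (m:ℝ) + 2 ≠ 0 := by positivity
      field_simp
      ring
    rw [h5] at h4
    refine h4.congr fun n => ?_
    rw [Finset.sum_range_sub (fun j => a (m + 2) j), hm0 _ (by omega), sub_zero]

/-- Moment CLT for bounded centered i.i.d. variables. -/
lemma clt {Ω : Type*} [MeasurableSpace Ω] (ν : Measure Ω) [IsProbabilityMeasure ν] (ξ : Ω → ℝ) (hξ : BM ξ)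
    (h0 : ∫ x, ξ x ∂ν = 0) (s : ℝ) (hs : s ^ 2 = ∫ x, ξ x ^ 2 ∂ν) (m : ℕ) :
    Tendsto (fun n : ℕ => (∫ ω, (∑ i, ξ (ω i)) ^ m ∂(Measure.pi fun _ : Fin n => ν)) / √(n : ℝ) ^ m) atTop
      (𝓝 (gaussianMoment m * s ^ m)) := by
  refine clt_abs (fun m n => ∫ ω, (∑ i, ξ (ω i)) ^ m ∂(Measure.pi fun _ : Fin n => ν)) (fun k => ∫ x, ξ x ^ k ∂ν) s hs
    (by simp) (by simpa using h0) (by simp) (fun m hm => by simp [zero_pow hm.ne']) ?_ m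
  intro m n
  have hS : ∀ n, BM fun ω : Fin n → Ω => ∑ i, ξ (ω i) := fun n => BM.sum _ fun i _ => hξ.comp (measurable_pi_apply i)
  rw [int_cons ν n ((hS (n + 1)).pow m)]
  simp only [Fin.sum_univ_succ, Fin.cons_zero, Fin.cons_succ, add_pow]
  have h1 : ∀ y : Fin n → Ω, ∫ x, ∑ k ∈ Finset.range (m + 1), ξ x ^ k * (∑ i, ξ (y i)) ^ (m - k) * (m.choose k : ℝ) ∂ν =
      ∑ k ∈ Finset.range (m + 1), (m.choose k : ℝ) * (∫ x, ξ x ^ k ∂ν) * (∑ i, ξ (y i)) ^ (m - k) := by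
    intro y
    rw [integral_finsetSum _ fun k _ => (((hξ.pow k).mul (BM.const _)).mul (BM.const _)).int ν]
    refine Finset.sum_congr rfl fun k _ => ?_
    rw [integral_mul_const, integral_mul_const]; ring
  simp only [h1]
  rw [integral_finsetSum _ fun k _ => ((BM.const _).mul ((hS n).pow _)).int _]
  refine Finset.sum_congr rfl fun k _ => ?_
  rw [integral_const_mul]

end GT

open MeasureTheory ProbabilityTheory Filter Topology

namespace GT

/-- cylinder set -/
def Cyl {n M A : ℕ} (s : Finset (Fin n × List (Fin M))) (f : Fin n × List (Fin M) → Fin A) :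
    Set (Fin n → List (Fin M) → Fin A) := {Ls | ∀ x ∈ s, Ls x.1 x.2 = f x}

lemma Cyl_meas {n M A : ℕ} (s : Finset (Fin n × List (Fin M))) (f : Fin n × List (Fin M) → Fin A) :
    MeasurableSet (Cyl s f) := by
  have : Cyl s f = ⋂ x ∈ s, {Ls | Ls x.1 x.2 = f x} := by ext; simp [Cyl]
  rw [this]
  refine Finset.measurableSet_biInter _ fun x _ => ?_
  have h : Measurable fun Ls : Fin n → List (Fin M) → Fin A => Ls x.1 x.2 := (measurable_pi_apply x.2).comp (measurable_pi_apply x.1)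
  exact h (measurableSet_singleton (f x))

lemma cyl_ext {n M A : ℕ} {P Q : Measure (Fin n → List (Fin M) → Fin A)} [IsProbabilityMeasure P] [IsProbabilityMeasure Q]
    (h : ∀ s f, P (Cyl s f) = Q (Cyl s f)) : P = Q := by
  classical
  set C : Set (Set (Fin n → List (Fin M) → Fin A)) := insert ∅ {S | ∃ s f, S = Cyl s f} with hC
  refine ext_of_generate_finite C ?_ ?_ ?_ (by simp)
  · apply le_antisymm
    · have : @Measurable _ _ (MeasurableSpace.generateFrom C) MeasurableSpace.pi (id : (Fin n → List (Fin M) → Fin A) → _) := by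
        refine @measurable_pi_lambda _ _ _ (MeasurableSpace.generateFrom C) _ _ fun j => ?_
        refine @measurable_pi_lambda _ _ _ (MeasurableSpace.generateFrom C) _ _ fun v => ?_
        refine @measurable_to_countable' _ _ _ _ (MeasurableSpace.generateFrom C) _ fun b => ?_
        apply MeasurableSpace.measurableSet_generateFrom
        refine Or.inr ⟨{(j, v)}, fun _ => b, ?_⟩
        ext Ls; simp [Cyl]
      intro S hS
      exact this hS
    · refine MeasurableSpace.generateFrom_le ?_
      rintro S (rfl | ⟨s, f, rfl⟩)
      · exact MeasurableSet.empty
      · exact Cyl_meas s f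
  · rintro S (rfl | ⟨s, f, rfl⟩) T (rfl | ⟨t, g, rfl⟩) hne
    · simp at hne
    · simp at hne
    · simp at hne
    · obtain ⟨Ls, h1, h2⟩ := hne
      refine Or.inr ⟨s ∪ t, fun x => Ls x.1 x.2, ?_⟩
      ext Ls'
      simp only [Cyl, Set.mem_inter_iff, Set.mem_ofPred_eq, Finset.mem_union] at h1 h2 ⊢
      constructor
      · rintro ⟨h3, h4⟩ x (hx | hx)
        · rw [h3 x hx, h1 x hx]
        · rw [h4 x hx, h2 x hx]
      · intro h3
        exact ⟨fun x hx => by rw [h3 x (Or.inl hx), h1 x hx], fun x hx => by rw [h3 x (Or.inr hx), h2 x hx]⟩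
  · rintro S (rfl | ⟨s, f, rfl⟩)
    · simp
    · exact h s f

section
variable {n M A : ℕ} {p : Fin A → ℝ} {μL : Measure (List (Fin M) → Fin A)} [IsProbabilityMeasure μL]

lemma P_cyl (hμ : IsLabelingMeasure p μL) (s : Finset (Fin n × List (Fin M))) (f : Fin n × List (Fin M) → Fin A) :
    (Measure.pi fun _ : Fin n => μL) (Cyl s f) = ∏ x ∈ s, ENNReal.ofReal (p (f x)) := by
  classical
  have h1 : Cyl s f = Set.pi Set.univ fun j => {L | ∀ v ∈ (s.filter (fun x => x.1 = j)).image Prod.snd, L v = f (j, v)} := by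
    ext Ls
    simp only [Cyl, Set.mem_ofPred_eq, Set.mem_pi, Set.mem_univ, true_imp_iff, Finset.mem_image, Finset.mem_filter]
    constructor
    · rintro h j v ⟨⟨j', v'⟩, ⟨h2, rfl⟩, rfl⟩
      exact h _ h2
    · rintro h ⟨j, v⟩ hx
      exact h j v ⟨(j, v), ⟨hx, rfl⟩, rfl⟩
  rw [h1, Measure.pi_pi]
  have h2 : ∀ j, μL {L | ∀ v ∈ (s.filter (fun x => x.1 = j)).image Prod.snd, L v = f (j, v)} =
      ∏ x ∈ s with x.1 = j, ENNReal.ofReal (p (f x)) := by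
    intro j
    rw [hμ _ (fun v => f (j, v)), Finset.prod_image]
    · refine Finset.prod_congr rfl fun x hx => ?_
      rw [Finset.mem_filter] at hx
      rw [← hx.2]
    · rintro ⟨j1, v1⟩ h1 ⟨j2, v2⟩ h2 hv
      simp only [Finset.coe_filter, Set.mem_ofPred_eq] at h1 h2 hv
      rw [h1.2, h2.2, hv]
  simp only [h2]
  exact Finset.prod_fiberwise s (fun x => x.1) _

/-- Mix two labelings according to a predicate. -/
def mix (T : Fin n → List (Fin M) → Prop) [∀ j v, Decidable (T j v)]
    (z : (Fin n → List (Fin M) → Fin A) × (Fin n → List (Fin M) → Fin A)) : Fin n → List (Fin M) → Fin A :=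
  fun j v => if T j v then z.1 j v else z.2 j v

lemma mix_meas (T : Fin n → List (Fin M) → Prop) [∀ j v, Decidable (T j v)] : Measurable (mix (A := A) T) := by
  refine measurable_pi_lambda _ fun j => measurable_pi_lambda _ fun v => ?_
  unfold mix
  split_ifs
  · exact (measurable_pi_apply v).comp ((measurable_pi_apply j).comp measurable_fst)
  · exact (measurable_pi_apply v).comp ((measurable_pi_apply j).comp measurable_snd)

lemma mix_mp (hμ : IsLabelingMeasure p μL) (T : Fin n → List (Fin M) → Prop) [∀ j v, Decidable (T j v)] :
    MeasurePreserving (mix (A := A) T) ((Measure.pi fun _ : Fin n => μL).prod (Measure.pi fun _ : Fin n => μL))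
      (Measure.pi fun _ : Fin n => μL) := by
  refine ⟨mix_meas T, ?_⟩
  have : IsProbabilityMeasure (((Measure.pi fun _ : Fin n => μL).prod (Measure.pi fun _ : Fin n => μL)).map (mix (A := A) T)) :=
    Measure.isProbabilityMeasure_map (mix_meas T).aemeasurable
  refine cyl_ext fun s f => ?_
  rw [Measure.map_apply (mix_meas T) (Cyl_meas s f)]
  have : mix (A := A) T ⁻¹' (Cyl s f) = Cyl (s.filter fun x => T x.1 x.2) f ×ˢ Cyl (s.filter fun x => ¬ T x.1 x.2) f := by
    ext z
    simp only [Cyl, mix, Set.mem_preimage, Set.mem_ofPred_eq, Set.mem_prod, Finset.mem_filter]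
    constructor
    · intro h
      refine ⟨fun x hx => ?_, fun x hx => ?_⟩
      · have := h x hx.1; rwa [if_pos hx.2] at this
      · have := h x hx.1; rwa [if_neg hx.2] at this
    · rintro ⟨h1, h2⟩ x hx
      split_ifs with hT
      · exact h1 x ⟨hx, hT⟩
      · exact h2 x ⟨hx, hT⟩
  rw [this, Measure.prod_prod, P_cyl hμ, P_cyl hμ, P_cyl hμ, Finset.prod_filter_mul_prod_filter_not]

/-- shift to subtree -/
def shift (i : Fin M) (Ls : Fin n → List (Fin M) → Fin A) : Fin n → List (Fin M) → Fin A := fun j v => Ls j (i :: v)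

lemma shift_meas (i : Fin M) : Measurable (shift (n := n) (A := A) i) :=
  measurable_pi_lambda _ fun j => measurable_pi_lambda _ fun v => (measurable_pi_apply (i :: v)).comp (measurable_pi_apply j)

lemma shift_mp (hμ : IsLabelingMeasure p μL) (i : Fin M) : MeasurePreserving (shift (n := n) (A := A) i)
    (Measure.pi fun _ : Fin n => μL) (Measure.pi fun _ : Fin n => μL) := by
  classical
  refine ⟨shift_meas i, ?_⟩
  have : IsProbabilityMeasure ((Measure.pi fun _ : Fin n => μL).map (shift (A := A) i)) :=
    Measure.isProbabilityMeasure_map (shift_meas i).aemeasurable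
  refine cyl_ext fun s f => ?_
  rw [Measure.map_apply (shift_meas i) (Cyl_meas s f)]
  have : shift (A := A) i ⁻¹' (Cyl s f) = Cyl (s.image fun x => (x.1, i :: x.2)) (fun x => f (x.1, x.2.tail)) := by
    ext Ls
    simp [Cyl, shift]
    grind
  rw [this, P_cyl hμ, P_cyl hμ, Finset.prod_image]
  · simp
  · rintro ⟨a, b⟩ _ ⟨c, d⟩ _ h
    simpa using h

lemma int_shift (hμ : IsLabelingMeasure p μL) (i : Fin M) {Z : (Fin n → List (Fin M) → Fin A) → ℝ} (hZ : BM Z) :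
    ∫ Ls, Z (shift i Ls) ∂(Measure.pi fun _ : Fin n => μL) = ∫ Ls, Z Ls ∂(Measure.pi fun _ : Fin n => μL) := by
  have h := shift_mp (n := n) hμ i
  rw [← integral_map h.measurable.aemeasurable hZ.1.aestronglyMeasurable, h.map_eq]

lemma int_mix (hμ : IsLabelingMeasure p μL) (T : Fin n → List (Fin M) → Prop) [∀ j v, Decidable (T j v)]
    {Z : (Fin n → List (Fin M) → Fin A) → ℝ} (hZ : BM Z) :
    ∫ Ls, Z Ls ∂(Measure.pi fun _ : Fin n => μL) =
      ∫ a, ∫ b, Z (mix T (a, b)) ∂(Measure.pi fun _ : Fin n => μL) ∂(Measure.pi fun _ : Fin n => μL) := by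
  have h := mix_mp (n := n) hμ T
  rw [← h.map_eq, integral_map h.measurable.aemeasurable hZ.1.aestronglyMeasurable, h.map_eq]
  rw [integral_prod _ ((hZ.comp h.measurable).int _)]

lemma int_shift_mul (hμ : IsLabelingMeasure p μL) {i i' : Fin M} (hi : i ≠ i') {Z Z' : (Fin n → List (Fin M) → Fin A) → ℝ}
    (hZ : BM Z) (hZ' : BM Z') :
    ∫ Ls, Z (shift i Ls) * Z' (shift i' Ls) ∂(Measure.pi fun _ : Fin n => μL) =
      (∫ Ls, Z Ls ∂(Measure.pi fun _ : Fin n => μL)) * ∫ Ls, Z' Ls ∂(Measure.pi fun _ : Fin n => μL) := by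
  classical
  rw [int_mix hμ (fun _ v => ∃ w, v = i :: w) ((hZ.comp (shift_meas i)).mul (hZ'.comp (shift_meas i')))]
  have h1 : ∀ a b, shift i (mix (A := A) (n := n) (fun _ v => ∃ w, v = i :: w) (a, b)) = shift i a := by
    intro a b
    funext j v
    simp [shift, mix]
  have h2 : ∀ a b, shift i' (mix (A := A) (n := n) (fun _ v => ∃ w, v = i :: w) (a, b)) = shift i' b := by
    intro a b
    funext j v
    simp [shift, mix, hi.symm]
  simp only [h1, h2, integral_const_mul, integral_mul_const]
  rw [int_shift hμ i hZ, int_shift hμ i' hZ']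

lemma int_root (hμ : IsLabelingMeasure p μL) (hp : ∀ a, 0 ≤ p a) (j : Fin n) (ψ : Fin A → ℝ) :
    ∫ Ls, ψ (Ls j []) ∂(Measure.pi fun _ : Fin n => μL) = ∑ a, p a * ψ a := by
  classical
  have h1 : ∀ Ls : Fin n → List (Fin M) → Fin A, ψ (Ls j []) = ∑ a, (Cyl {(j, [])} (fun _ => a)).indicator (fun _ => ψ a) Ls := by
    intro Ls
    simp [Set.indicator_apply, Cyl]
  simp only [h1]
  rw [integral_finsetSum _ fun a _ => (integrable_const _).indicator (Cyl_meas _ _)]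
  refine Finset.sum_congr rfl fun a _ => ?_
  rw [integral_indicator_const _ (Cyl_meas _ _), measureReal_def, P_cyl hμ]
  simp [hp a]

lemma BM.fin {Ω T : Type*} [MeasurableSpace Ω] [Fintype T] {g : Ω → T} (hg : ∀ t, MeasurableSet {ω | g ω = t})
    {Φ : T → Ω → ℝ} (hΦ : ∀ t, BM (Φ t)) : BM (fun ω => Φ (g ω) ω) := by
  classical
  have h1 : (fun ω => Φ (g ω) ω) = fun ω => ∑ t, ({ω | g ω = t} : Set Ω).indicator (fun _ => (1:ℝ)) ω * Φ t ω := by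
    funext ω
    simp [Set.indicator_apply]
  rw [h1]
  refine BM.sum _ fun t _ => BM.mul ⟨measurable_const.indicator (hg t), 1, fun ω => ?_⟩ (hΦ t)
  rw [Set.indicator_apply]; split_ifs <;> simp

/-- those agreeing with `i0` at the root -/
def agr (i0 : Fin n) (J : Finset (Fin n)) (Ls : Fin n → List (Fin M) → Fin A) : Finset (Fin n) :=
  J.filter fun j => Ls j [] = Ls i0 []

lemma agr_sub (i0 : Fin n) (J : Finset (Fin n)) (Ls : Fin n → List (Fin M) → Fin A) : agr i0 J Ls ⊆ J := Finset.filter_subset _ _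

lemma root_meas (i0 : Fin n) (J : Finset (Fin n)) (t : Fin A × Finset (Fin n)) :
    MeasurableSet {Ls : Fin n → List (Fin M) → Fin A | (Ls i0 [], agr i0 J Ls) = t} := by
  have h : Measurable fun Ls : Fin n → List (Fin M) → Fin A => fun j => Ls j [] :=
    measurable_pi_lambda _ fun j => (measurable_pi_apply []).comp (measurable_pi_apply j)
  have : {Ls : Fin n → List (Fin M) → Fin A | (Ls i0 [], agr i0 J Ls) = t} =
      (fun Ls : Fin n → List (Fin M) → Fin A => fun j => Ls j []) ⁻¹' {r | (r i0, J.filter fun j => r j = r i0) = t} := rfl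
  rw [this]
  exact h (Set.toFinite _).measurableSet

lemma BM.root (i0 : Fin n) (J : Finset (Fin n)) {Φ : Fin A → Finset (Fin n) → (Fin n → List (Fin M) → Fin A) → ℝ}
    (hΦ : ∀ a K, BM (Φ a K)) : BM (fun Ls => Φ (Ls i0 []) (agr i0 J Ls) Ls) :=
  BM.fin (T := Fin A × Finset (Fin n)) (root_meas i0 J) (Φ := fun t => Φ t.1 t.2) fun t => hΦ t.1 t.2

lemma root_exp (hμ : IsLabelingMeasure p μL) (hp : ∀ a, 0 ≤ p a) (hs : ∑ a, p a = 1) (i0 : Fin n) (J : Finset (Fin n)) (hJ : i0 ∉ J)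
    (φ : Fin A → ℕ → ℝ) :
    ∫ Ls, φ (Ls i0 []) (agr i0 J Ls).card ∂(Measure.pi fun _ : Fin n => μL) = ∑ a, p a * Bop (p a) J.card (φ a) := by
  classical
  induction J using Finset.induction_on generalizing φ with
  | empty => 
    simp only [agr, Finset.filter_empty, Finset.card_empty]
    rw [int_root hμ hp i0 (fun a => φ a 0)]
    simp [Bop]
  | insert j J hj ih =>
    have hne : i0 ≠ j := fun h => hJ (h ▸ Finset.mem_insert_self j J)
    have hJ' : i0 ∉ J := fun h => hJ (Finset.mem_insert_of_mem h)
    rw [int_mix hμ (fun j' v => ¬ (j' = j ∧ v = [])) (BM.root i0 (insert j J) (Φ := fun a K _ => φ a K.card) fun _ _ => BM.const _)]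
    have h1 : ∀ a b : Fin n → List (Fin M) → Fin A, mix (fun j' v => ¬ (j' = j ∧ v = [])) (a, b) i0 [] = a i0 [] := by
      intro a b; simp [mix, hne]
    have h2 : ∀ a b : Fin n → List (Fin M) → Fin A, (agr i0 (insert j J) (mix (fun j' v => ¬ (j' = j ∧ v = [])) (a, b))).card =
        if b j [] = a i0 [] then (agr i0 J a).card + 1 else (agr i0 J a).card := by
      intro a b
      have e1 : mix (fun j' v => ¬ (j' = j ∧ v = [])) (a, b) j [] = b j [] := by simp [mix]
      have e2 : J.filter (fun j' => mix (fun j' v => ¬ (j' = j ∧ v = [])) (a, b) j' [] = a i0 []) = agr i0 J a := by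
        refine Finset.filter_congr fun x hx => ?_
        have : x ≠ j := fun h => hj (h ▸ hx)
        simp [mix, this]
      rw [agr, h1, Finset.filter_insert, e1, e2]
      split_ifs
      · rw [Finset.card_insert_of_notMem]
        exact fun h => hj (agr_sub _ _ _ h)
      · rfl
    simp only [h1, h2]
    have h3 : ∀ a : Fin n → List (Fin M) → Fin A, ∫ b, φ (a i0 []) (if b j [] = a i0 [] then (agr i0 J a).card + 1 else (agr i0 J a).card)
        ∂(Measure.pi fun _ : Fin n => μL) = p (a i0 []) * φ (a i0 []) ((agr i0 J a).card + 1) + (1 - p (a i0 [])) * φ (a i0 []) (agr i0 J a).card := by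
      intro a
      rw [int_root hμ hp j (fun x => φ (a i0 []) (if x = a i0 [] then (agr i0 J a).card + 1 else (agr i0 J a).card))]
      generalize a i0 [] = c
      have : ∀ x, p x * φ c (if x = c then (agr i0 J a).card + 1 else (agr i0 J a).card) =
          p x * φ c (agr i0 J a).card + if x = c then p c * (φ c ((agr i0 J a).card + 1) - φ c (agr i0 J a).card) else 0 := by
        intro x
        split_ifs with h
        · rw [h]; ring
        · simp
      simp only [this, Finset.sum_add_distrib, ← Finset.sum_mul, hs]
      simp
      ring
    simp only [h3]
    rw [ih hJ' (fun a k => p a * φ a (k + 1) + (1 - p a) * φ a k), Finset.card_insert_of_notMem hj]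
    refine Finset.sum_congr rfl fun a _ => ?_
    rw [Bop_add, Bop_mul, Bop_mul]
    rfl

/-- not depending on root labels -/
def NoRoot (Z : (Fin n → List (Fin M) → Fin A) → ℝ) : Prop :=
  ∀ Ls Ls', (∀ j v, v ≠ [] → Ls j v = Ls' j v) → Z Ls = Z Ls'

lemma root_sep (hμ : IsLabelingMeasure p μL) (i0 : Fin n) (J : Finset (Fin n))
    {Φ : Fin A → Finset (Fin n) → (Fin n → List (Fin M) → Fin A) → ℝ}
    (hΦ : ∀ a K, BM (Φ a K)) (hN : ∀ a K, NoRoot (Φ a K)) :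
    ∫ Ls, Φ (Ls i0 []) (agr i0 J Ls) Ls ∂(Measure.pi fun _ : Fin n => μL) =
      ∫ Ls, (∫ Ls', Φ (Ls i0 []) (agr i0 J Ls) Ls' ∂(Measure.pi fun _ : Fin n => μL)) ∂(Measure.pi fun _ : Fin n => μL) := by
  classical
  rw [int_mix hμ (fun j' v => v = []) (BM.root i0 J hΦ)]
  have h1 : ∀ a b : Fin n → List (Fin M) → Fin A, ∀ j, mix (fun j' v => v = []) (a, b) j [] = a j [] := by
    intro a b j; simp [mix]
  have h2 : ∀ a b : Fin n → List (Fin M) → Fin A, agr i0 J (mix (fun j' v => v = []) (a, b)) = agr i0 J a := by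
    intro a b; simp [agr, h1]
  simp only [h1, h2]
  refine integral_congr_ae (Eventually.of_forall fun a => integral_congr_ae (Eventually.of_forall fun b => ?_))
  refine hN _ _ _ _ fun j v hv => ?_
  simp [mix, hv]

lemma root_le (hμ : IsLabelingMeasure p μL) (hp : ∀ a, 0 ≤ p a) (hs : ∑ a, p a = 1) (i0 : Fin n) (J : Finset (Fin n)) (hJ : i0 ∉ J)
    {Φ : Fin A → Finset (Fin n) → (Fin n → List (Fin M) → Fin A) → ℝ}
    (hΦ : ∀ a K, BM (Φ a K)) (hN : ∀ a K, NoRoot (Φ a K)) (φ : Fin A → ℕ → ℝ)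
    (hφ : ∀ a K, K ⊆ J → ∫ Ls, Φ a K Ls ∂(Measure.pi fun _ : Fin n => μL) ≤ φ a K.card) :
    ∫ Ls, Φ (Ls i0 []) (agr i0 J Ls) Ls ∂(Measure.pi fun _ : Fin n => μL) ≤ ∑ a, p a * Bop (p a) J.card (φ a) := by
  rw [root_sep hμ i0 J hΦ hN, ← root_exp hμ hp hs i0 J hJ φ]
  refine integral_mono ((BM.root i0 J (Φ := fun a K _ => ∫ Ls', Φ a K Ls' ∂(Measure.pi fun _ : Fin n => μL)) fun _ _ => BM.const _).int _)
    ((BM.root i0 J (Φ := fun a K _ => φ a K.card) fun _ _ => BM.const _).int _) fun Ls => ?_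
  exact hφ _ _ (agr_sub _ _ _)

lemma root_eq (hμ : IsLabelingMeasure p μL) (hp : ∀ a, 0 ≤ p a) (hs : ∑ a, p a = 1) (i0 : Fin n) (J : Finset (Fin n)) (hJ : i0 ∉ J)
    {Φ : Fin A → Finset (Fin n) → (Fin n → List (Fin M) → Fin A) → ℝ}
    (hΦ : ∀ a K, BM (Φ a K)) (hN : ∀ a K, NoRoot (Φ a K)) (φ : Fin A → ℕ → ℝ)
    (hφ : ∀ a K, K ⊆ J → ∫ Ls, Φ a K Ls ∂(Measure.pi fun _ : Fin n => μL) = φ a K.card) :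
    ∫ Ls, Φ (Ls i0 []) (agr i0 J Ls) Ls ∂(Measure.pi fun _ : Fin n => μL) = ∑ a, p a * Bop (p a) J.card (φ a) := by
  rw [root_sep hμ i0 J hΦ hN, ← root_exp hμ hp hs i0 J hJ φ]
  refine integral_congr_ae (Eventually.of_forall fun Ls => ?_)
  exact hφ _ _ (agr_sub _ _ _)

end

end GT

open MeasureTheory ProbabilityTheory Filter Topology

namespace GT

section
variable {n M A : ℕ} {p : Fin A → ℝ} {μL : Measure (List (Fin M) → Fin A)} [IsProbabilityMeasure μL]

lemma tree1 (hμ : IsLabelingMeasure p μL) {Z : (Fin n → List (Fin M) → Fin A) → ℝ} (hZ : BM Z) :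
    ∫ Ls, ∑ i, Z (shift i Ls) ∂(Measure.pi fun _ : Fin n => μL) = M * ∫ Ls, Z Ls ∂(Measure.pi fun _ : Fin n => μL) := by
  rw [integral_finsetSum _ fun i _ => (hZ.comp (shift_meas i)).int _]
  simp only [int_shift hμ _ hZ]
  simp

lemma offdiag {M : ℕ} (c : ℝ) : ∑ i : Fin M, ∑ j ∈ Finset.univ.erase i, c = M * (M - 1) * c := by
  rcases Nat.eq_zero_or_pos M with rfl | h
  · simp
  · simp [Finset.card_erase_of_mem, Nat.cast_sub h]; ring

lemma tree2 (hμ : IsLabelingMeasure p μL) {Z : (Fin n → List (Fin M) → Fin A) → ℝ} (hZ : BM Z) :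
    ∫ Ls, (∑ i, Z (shift i Ls)) ^ 2 ∂(Measure.pi fun _ : Fin n => μL) = M * ∫ Ls, Z Ls ^ 2 ∂(Measure.pi fun _ : Fin n => μL)
      + M * (M - 1) * (∫ Ls, Z Ls ∂(Measure.pi fun _ : Fin n => μL)) ^ 2 := by
  have h1 : ∀ Ls : Fin n → List (Fin M) → Fin A, (∑ i, Z (shift i Ls)) ^ 2 = ∑ i, Z (shift i Ls) ^ 2 +
      ∑ i, ∑ j ∈ Finset.univ.erase i, Z (shift i Ls) * Z (shift j Ls) := by
    intro Ls
    rw [sq, Finset.sum_mul_sum, ← Finset.sum_add_distrib]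
    refine Finset.sum_congr rfl fun i _ => ?_
    rw [← Finset.add_sum_erase _ _ (Finset.mem_univ i), sq]
  simp only [h1]
  have hb : ∀ i j, BM fun Ls => Z (shift (n := n) i Ls) * Z (shift j Ls) := fun i j => (hZ.comp (shift_meas i)).mul (hZ.comp (shift_meas j))
  rw [integral_add ((BM.sum _ fun i _ => (hZ.pow 2).comp (shift_meas i)).int _)
    ((BM.sum _ fun i _ => BM.sum _ fun j _ => hb i j).int _), tree1 hμ (hZ.pow 2),
    integral_finsetSum _ fun i _ => (BM.sum _ fun j _ => hb i j).int _]
  congr 1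
  rw [← offdiag]
  refine Finset.sum_congr rfl fun i _ => ?_
  rw [integral_finsetSum _ fun j _ => (hb i j).int _]
  refine Finset.sum_congr rfl fun j hj => ?_
  rw [int_shift_mul hμ (Finset.ne_of_mem_erase hj).symm hZ hZ, sq]

lemma two_pow_ineq (m : ℕ) : ∃ C ≥ (0:ℝ), ∀ a b : ℝ, 0 ≤ a → 0 ≤ b → (a + b) ^ (m + 1) ≤ a ^ (m + 1) + C * (b ^ (m + 1) + b * a ^ m) := by
  induction m with
  | zero => exact ⟨1, by norm_num, fun a b ha hb => by simp; linarith⟩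
  | succ m ih =>
    obtain ⟨C, hC, h⟩ := ih
    refine ⟨3 * C + 1, by positivity, fun a b ha hb => ?_⟩
    have h1 := mul_le_mul_of_nonneg_left (h a b ha hb) (add_nonneg ha hb)
    have h2 : a * b ^ (m + 1) ≤ b * a ^ (m + 1) + b ^ (m + 2) := by
      rcases le_total a b with hh | hh
      · calc a * b ^ (m + 1) ≤ b * b ^ (m + 1) := by gcongr
          _ = b ^ (m + 2) := by ring
          _ ≤ _ := le_add_of_nonneg_left (by positivity)
      · calc a * b ^ (m + 1) = a * b * b ^ m := by ring
          _ ≤ a * b * a ^ m := by gcongr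
          _ = b * a ^ (m + 1) := by ring
          _ ≤ _ := le_add_of_nonneg_right (by positivity)
    have h3 : b ^ 2 * a ^ m ≤ b * a ^ (m + 1) + b ^ (m + 2) := by
      rcases le_total a b with hh | hh
      · calc b ^ 2 * a ^ m ≤ b ^ 2 * b ^ m := by gcongr
          _ = b ^ (m + 2) := by ring
          _ ≤ _ := le_add_of_nonneg_left (by positivity)
      · calc b ^ 2 * a ^ m = b * b * a ^ m := by ring
          _ ≤ b * a * a ^ m := by gcongr
          _ = b * a ^ (m + 1) := by ring
          _ ≤ _ := le_add_of_nonneg_right (by positivity)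
    have h4 : 0 ≤ b ^ (m + 2) := by positivity
    have h5 : 0 ≤ b * a ^ (m + 1) := by positivity
    calc (a + b) ^ (m + 1 + 1) = (a + b) * (a + b) ^ (m + 1) := by ring
      _ ≤ _ := h1
      _ = a ^ (m + 2) + b * a ^ (m + 1) + C * (a * b ^ (m + 1) + b * a ^ (m + 1) + b ^ (m + 2) + b ^ 2 * a ^ m) := by ring
      _ ≤ a ^ (m + 2) + b * a ^ (m + 1) + C * ((b * a ^ (m + 1) + b ^ (m + 2)) + b * a ^ (m + 1) + b ^ (m + 2) + (b * a ^ (m + 1) + b ^ (m + 2))) := by gcongr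
      _ ≤ _ := by ring_nf at h4 h5 ⊢; nlinarith

lemma sum_pow_ineq (M m : ℕ) : ∃ C ≥ (0:ℝ), ∀ y : Fin M → ℝ, (∀ i, 0 ≤ y i) → (∑ i, y i) ^ (m + 2) ≤
    ∑ i, y i ^ (m + 2) + C * ∑ j, ∑ i ∈ Finset.univ.erase j, (y i ^ (m + 1) * y j + y i * y j ^ (m + 1)) := by
  obtain ⟨C, hC, h⟩ := two_pow_ineq m
  refine ⟨C * ((M : ℝ) ^ m + 1), by positivity, fun y hy => ?_⟩
  have h1 : ∀ j, y j * (∑ i, y i) ^ (m + 1) ≤ y j ^ (m + 2) +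
      C * ((M : ℝ) ^ m + 1) * ∑ i ∈ Finset.univ.erase j, (y i ^ (m + 1) * y j + y i * y j ^ (m + 1)) := by
    intro j
    rw [← Finset.add_sum_erase _ _ (Finset.mem_univ j)]
    set S := ∑ i ∈ Finset.univ.erase j, y i with hS
    have hS0 : 0 ≤ S := Finset.sum_nonneg fun i _ => hy i
    have h2 := mul_le_mul_of_nonneg_left (h (y j) S (hy j) hS0) (hy j)
    have h3 : S ^ (m + 1) ≤ (M : ℝ) ^ m * ∑ i ∈ Finset.univ.erase j, y i ^ (m + 1) := by
      refine (pow_sum_le_card_mul_sum_pow (fun i _ => hy i) m).trans ?_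
      gcongr
      · exact Finset.sum_nonneg fun i _ => by have := hy i; positivity
      · exact (Finset.card_le_univ _).trans (by simp)
    rw [Finset.sum_add_distrib, ← Finset.sum_mul, ← Finset.sum_mul, ← hS]
    set T := ∑ i ∈ Finset.univ.erase j, y i ^ (m + 1) with hT
    have hT0 : 0 ≤ T := Finset.sum_nonneg fun i _ => by have := hy i; positivity
    have hyj := hy j
    calc _ ≤ _ := h2
      _ = y j ^ (m + 2) + C * (S ^ (m + 1) * y j + S * y j ^ (m + 1)) := by ring
      _ ≤ y j ^ (m + 2) + C * ((M : ℝ) ^ m * T * y j + S * y j ^ (m + 1)) := by gcongr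
      _ ≤ _ := by
        have h7 : 0 ≤ C * (T * y j) := by positivity
        have h8 : 0 ≤ C * (M : ℝ) ^ m * (S * y j ^ (m + 1)) := by positivity
        nlinarith
  calc (∑ i, y i) ^ (m + 2) = ∑ j, y j * (∑ i, y i) ^ (m + 1) := by rw [← Finset.sum_mul]; ring
    _ ≤ _ := Finset.sum_le_sum fun j _ => h1 j
    _ = _ := by rw [Finset.sum_add_distrib, Finset.mul_sum]

end

lemma treem (M m : ℕ) : ∃ C ≥ (0:ℝ), ∀ (A n : ℕ) (p : Fin A → ℝ) (μL : Measure (List (Fin M) → Fin A)) [IsProbabilityMeasure μL],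
    IsLabelingMeasure p μL → ∀ Z : (Fin n → List (Fin M) → Fin A) → ℝ, BM Z → (∀ Ls, 0 ≤ Z Ls) →
    ∫ Ls, (∑ i, Z (shift i Ls)) ^ (m + 2) ∂(Measure.pi fun _ : Fin n => μL) ≤ M * ∫ Ls, Z Ls ^ (m + 2) ∂(Measure.pi fun _ : Fin n => μL)
      + C * ((∫ Ls, Z Ls ^ (m + 1) ∂(Measure.pi fun _ : Fin n => μL)) * ∫ Ls, Z Ls ∂(Measure.pi fun _ : Fin n => μL)) := by
  obtain ⟨C, hC, h⟩ := sum_pow_ineq M m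
  refine ⟨C * (M * (M - 1) * 2), ?_, fun A n p μL _ hμ Z hZ hZ0 => ?_⟩
  · rcases Nat.eq_zero_or_pos M with rfl | hM
    · simp
    · have : (1:ℝ) ≤ M := by exact_mod_cast hM
      have : 0 ≤ (M:ℝ) - 1 := by linarith
      positivity
  have hb : ∀ i j : Fin M, BM fun Ls => Z (shift (n := n) i Ls) ^ (m + 1) * Z (shift j Ls) + Z (shift i Ls) * Z (shift j Ls) ^ (m + 1) :=
    fun i j => (((hZ.pow _).comp (shift_meas i)).mul (hZ.comp (shift_meas j))).add ((hZ.comp (shift_meas i)).mul ((hZ.pow _).comp (shift_meas j)))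
  have hb2 : BM fun Ls => ∑ j, ∑ i ∈ Finset.univ.erase j, (Z (shift (n := n) i Ls) ^ (m + 1) * Z (shift j Ls) + Z (shift i Ls) * Z (shift j Ls) ^ (m + 1)) :=
    BM.sum _ fun j _ => BM.sum _ fun i _ => hb i j
  have hb1 : BM fun Ls => ∑ i, Z (shift (n := n) i Ls) ^ (m + 2) := BM.sum _ fun i _ => (hZ.pow _).comp (shift_meas i)
  refine (integral_mono (((BM.sum _ fun i _ => hZ.comp (shift_meas i)).pow _).int _) ((hb1.add ((BM.const _).mul hb2)).int _)
    fun Ls => h (fun i => Z (shift i Ls)) fun i => hZ0 _).trans ?_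
  rw [integral_add (hb1.int _) (((BM.const _).mul hb2).int _), tree1 hμ (hZ.pow _), integral_const_mul, mul_assoc C]
  refine add_le_add le_rfl (mul_le_mul_of_nonneg_left (le_of_eq ?_) hC)
  rw [integral_finsetSum _ fun j _ => (BM.sum _ fun i _ => hb i j).int _, mul_assoc, ← offdiag]
  refine Finset.sum_congr rfl fun j _ => ?_
  rw [integral_finsetSum _ fun i _ => (hb i j).int _]
  refine Finset.sum_congr rfl fun i hi => ?_
  have hne := Finset.ne_of_mem_erase hi
  rw [integral_add ((((hZ.pow _).comp (shift_meas i)).mul (hZ.comp (shift_meas j))).int _) (((hZ.comp (shift_meas i)).mul ((hZ.pow _).comp (shift_meas j))).int _)]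
  rw [int_shift_mul hμ hne (hZ.pow _) hZ, int_shift_mul hμ hne hZ (hZ.pow _)]
  ring

section
variable {n M A : ℕ}

/-- the increment functional -/
noncomputable def U : ℕ → Fin n → Finset (Fin n) → (Fin n → List (Fin M) → Fin A) → ℝ
  | 0, _, _, _ => 0
  | d + 1, i0, J, Ls => (if J.card = 1 then 1 else 0) + ∑ i, U d i0 (agr i0 J (shift i Ls)) (shift i Ls)

/-- increment functional including the root label -/
noncomputable def Y (d : ℕ) (i0 : Fin n) (J : Finset (Fin n)) (Ls : Fin n → List (Fin M) → Fin A) : ℝ := U d i0 (agr i0 J Ls) Ls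

lemma U_succ (d : ℕ) (i0 : Fin n) (J : Finset (Fin n)) (Ls : Fin n → List (Fin M) → Fin A) :
    U (d + 1) i0 J Ls = (if J.card = 1 then 1 else 0) + ∑ i, Y d i0 J (shift i Ls) := rfl

lemma U_nonneg (d : ℕ) (i0 : Fin n) (J : Finset (Fin n)) (Ls : Fin n → List (Fin M) → Fin A) : 0 ≤ U d i0 J Ls := by
  induction d generalizing J Ls with
  | zero => exact le_rfl
  | succ d ih =>
    rw [U_succ]
    have : 0 ≤ ∑ i, Y d i0 J (shift i Ls) := Finset.sum_nonneg fun i _ => ih _ _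
    split_ifs <;> linarith

lemma U_empty (d : ℕ) (i0 : Fin n) (Ls : Fin n → List (Fin M) → Fin A) : U d i0 ∅ Ls = 0 := by
  induction d generalizing Ls with
  | zero => rfl
  | succ d ih => simp [U, agr, ih]

lemma U_BM (d : ℕ) (i0 : Fin n) (J : Finset (Fin n)) : BM (U (M := M) (A := A) d i0 J) := by
  induction d generalizing J with
  | zero => exact BM.const 0
  | succ d ih =>
    have h1 : BM (Y (M := M) (A := A) d i0 J) := BM.root i0 J (Φ := fun _ K Ls => U d i0 K Ls) fun _ K => ih K
    exact (BM.const _).add (BM.sum _ fun i _ => h1.comp (shift_meas i))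

lemma Y_BM (d : ℕ) (i0 : Fin n) (J : Finset (Fin n)) : BM (Y (M := M) (A := A) d i0 J) :=
  BM.root i0 J (Φ := fun _ K Ls => U d i0 K Ls) fun _ K => U_BM d i0 K

lemma Y_nonneg (d : ℕ) (i0 : Fin n) (J : Finset (Fin n)) (Ls : Fin n → List (Fin M) → Fin A) : 0 ≤ Y d i0 J Ls := U_nonneg _ _ _ _

lemma shift_noroot {Ls Ls' : Fin n → List (Fin M) → Fin A} (h : ∀ j v, v ≠ [] → Ls j v = Ls' j v) (i : Fin M) :
    shift i Ls = shift i Ls' := by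
  funext j v
  exact h j _ (by simp)

lemma U_NoRoot (d : ℕ) (i0 : Fin n) (J : Finset (Fin n)) : NoRoot (U (M := M) (A := A) d i0 J) := by
  intro Ls Ls' h
  cases d with
  | zero => rfl
  | succ d => simp only [U, shift_noroot h]

/-- the martingale -/
noncomputable def W (p : Fin A → ℝ) (σ : ℝ) : ℕ → (List (Fin M) → Fin A) → ℝ
  | 0, _ => 1
  | k + 1, L => ∑ i, p (L [i]) ^ σ * W p σ k (fun v => L (i :: v))

lemma W_succ (p : Fin A → ℝ) (σ : ℝ) (k : ℕ) (Ls : Fin n → List (Fin M) → Fin A) (i0 : Fin n) :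
    W p σ (k + 1) (Ls i0) = ∑ i, p (shift i Ls i0 []) ^ σ * W p σ k (shift i Ls i0) := rfl

lemma W_BM1 (p : Fin A → ℝ) (σ : ℝ) (k : ℕ) : BM (W (M := M) p σ k) := by
  induction k with
  | zero => exact BM.const 1
  | succ k ih =>
    refine BM.sum _ fun i _ => BM.mul ?_ (ih.comp (measurable_pi_lambda _ fun v => measurable_pi_apply (i :: v)))
    have : BM (fun a : Fin A => p a ^ σ) := ⟨measurable_of_finite _, ∑ b, |p b ^ σ|, fun a => Finset.single_le_sum (f := fun b => |p b ^ σ|) (fun b _ => abs_nonneg _) (Finset.mem_univ a)⟩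
    exact this.comp (measurable_pi_apply [i])

lemma W_BM (p : Fin A → ℝ) (σ : ℝ) (k : ℕ) (i0 : Fin n) : BM (fun Ls : Fin n → List (Fin M) → Fin A => W p σ k (Ls i0)) :=
  (W_BM1 p σ k).comp (measurable_pi_apply i0)

lemma W_NoRoot (p : Fin A → ℝ) (σ : ℝ) (k : ℕ) (i0 : Fin n) : NoRoot (fun Ls : Fin n → List (Fin M) → Fin A => W p σ k (Ls i0)) := by
  intro Ls Ls' h
  cases k with
  | zero => rfl
  | succ k => simp only [W_succ, shift_noroot h]

variable {p : Fin A → ℝ} {ρ : ℝ} {μL : Measure (List (Fin M) → Fin A)} [IsProbabilityMeasure μL]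

lemma U_mean (h : Par M A p ρ) (hμ : IsLabelingMeasure p μL) (d : ℕ) (i0 : Fin n) (J : Finset (Fin n)) (hJ : i0 ∉ J) :
    ∫ Ls, U d i0 J Ls ∂(Measure.pi fun _ : Fin n => μL) = ud M p d J.card := by
  induction d generalizing J with
  | zero => simp [U, ud]
  | succ d ih =>
    simp only [U_succ]
    rw [integral_add ((BM.const _).int _) ((BM.sum _ fun i _ => (Y_BM d i0 J).comp (shift_meas i)).int _), tree1 hμ (Y_BM d i0 J)]
    simp only [Y]
    rw [root_eq hμ (fun a => (h.p0 a).le) h.sum1 i0 J hJ (Φ := fun _ K Ls => U d i0 K Ls) (fun _ K => U_BM d i0 K)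
      (fun _ K => U_NoRoot d i0 K) (fun _ x => ud M p d x) (fun _ K hK => ih K fun h' => hJ (hK h'))]
    simp [ud]

end
end GT

open MeasureTheory ProbabilityTheory Filter Topology

namespace GT

variable {M A : ℕ} {p : Fin A → ℝ} {ρ : ℝ} {μL : Measure (List (Fin M) → Fin A)} [IsProbabilityMeasure μL]

lemma p_mul_rpow (h : Par M A p ρ) (a : Fin A) (τ : ℝ) : p a * p a ^ τ = p a ^ (1 + τ) := by
  rw [Real.rpow_add (h.p0 a), Real.rpow_one]

lemma BK_ev (h : Par M A p ρ) {τ : ℝ} (hτ : 0 < τ) {δ : ℝ} (hδ : 0 < δ) :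
    ∀ᶠ x : ℕ in atTop, M * ∑ a, p a * Bop (p a) x (fun k => (k : ℝ) ^ τ) ≤ (M * ∑ a, p a ^ (1 + τ) + δ) * (x : ℝ) ^ τ := by
  have hM := h.Mpos
  have h1 : ∀ a, ∀ᶠ x : ℕ in atTop, Bop (p a) x (fun k => (k : ℝ) ^ τ) ≤ (p a ^ τ + δ / M) * (x : ℝ) ^ τ :=
    fun a => Bop_rpow_eventually (h.p0 a) (h.p1 a).le hτ (by positivity)
  filter_upwards [eventually_all.2 h1] with x hx
  calc _ ≤ M * ∑ a, p a * ((p a ^ τ + δ / M) * (x : ℝ) ^ τ) := by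
        gcongr with a _
        · exact (h.p0 a).le
        · exact hx a
    _ = M * ∑ a, (p a ^ (1 + τ) * (x : ℝ) ^ τ + p a * (δ / M * (x : ℝ) ^ τ)) := by
        congr 1; refine Finset.sum_congr rfl fun a _ => ?_
        rw [← p_mul_rpow h]; ring
    _ = _ := by
        rw [Finset.sum_add_distrib, ← Finset.sum_mul, ← Finset.sum_mul, h.sum1]
        field_simp

lemma sumB_le (h : Par M A p ρ) (x : ℕ) (φ : Fin A → ℕ → ℝ) (c : ℝ) (hφ : ∀ a, ∀ k ≤ x, φ a k ≤ c) :
    ∑ a, p a * Bop (p a) x (φ a) ≤ c := by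
  calc _ ≤ ∑ a, p a * c := by
        gcongr with a _
        · exact (h.p0 a).le
        · rw [← Bop_const (p a) c x]
          exact Bop_mono (h.p0 a).le (h.p1 a).le x _ _ (hφ a)
    _ = c := by rw [← Finset.sum_mul, h.sum1, one_mul]

lemma supersol (h : Par M A p ρ) {τ : ℝ} (hτ : ρ - 1 < τ) (C' : ℝ) (hC : 0 ≤ C') : ∃ K0 ≥ (0:ℝ), ∃ B ≥ (0:ℝ), ∀ x : ℕ,
    M * ∑ a, p a * Bop (p a) x (fun k => K0 * (k : ℝ) ^ τ + B * (k : ℝ) ^ (min τ 1)) + C' * (x : ℝ) ^ τ ≤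
      K0 * (x : ℝ) ^ τ + B * (x : ℝ) ^ (min τ 1) := by
  have hM := h.Mpos
  have hρ := h.ρ1
  have hτ0 : 0 < τ := by linarith
  set θ := min τ 1 with hθ
  have hθ0 : 0 < θ := lt_min hτ0 one_pos
  set κ := M * ∑ a, p a ^ (1 + τ) with hκ
  set l := M * ∑ a, p a ^ (1 + θ) with hl
  have hκ1 : κ < 1 := h.kappa_lt (by linarith)
  have hl1 : l < 1 := h.kappa_lt (by have : ρ - 1 < θ := lt_min hτ (by linarith [h.ρ2])
                                     linarith)
  obtain ⟨N, hN⟩ := eventually_atTop.1 (BK_ev h hτ0 (δ := (1 - κ) / 2) (by linarith))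
  rw [← hκ] at hN
  have h1 : ∀ x : ℕ, M * ∑ a, p a * Bop (p a) x (fun k => (k : ℝ) ^ τ) ≤ (κ + (1 - κ) / 2) * (x : ℝ) ^ τ + M * (N : ℝ) ^ τ * (x : ℝ) ^ θ := by
    intro x
    have hκ0 : 0 ≤ κ := by
      have : ∀ a, 0 ≤ p a ^ (1 + τ) := fun a => by have := h.p0 a; positivity
      have := Finset.sum_nonneg (s := Finset.univ) fun a _ => this a
      positivity
    rcases le_or_gt N x with hx | hx
    · exact (hN x hx).trans (le_add_of_nonneg_right (by positivity))
    · have h2 := sumB_le h x (fun _ k => (k : ℝ) ^ τ) ((x : ℝ) ^ τ) fun a k hk => by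
        have : (k : ℝ) ≤ x := by exact_mod_cast hk
        gcongr
      have h3 : (x : ℝ) ^ τ ≤ (N : ℝ) ^ τ * (x : ℝ) ^ θ := by
        rcases Nat.eq_zero_or_pos x with rfl | hx0
        · simp [Real.zero_rpow hτ0.ne', Real.zero_rpow hθ0.ne']
        · have h4 : (1:ℝ) ≤ (x : ℝ) ^ θ := Real.one_le_rpow (by exact_mod_cast hx0) hθ0.le
          have h5 : (x : ℝ) ^ τ ≤ (N : ℝ) ^ τ := by
            have : (x : ℝ) ≤ N := by exact_mod_cast hx.le
            gcongr
          calc (x : ℝ) ^ τ ≤ (N : ℝ) ^ τ * 1 := by rw [mul_one]; exact h5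
            _ ≤ _ := by gcongr
      have h6 : 0 ≤ κ + (1 - κ) / 2 := by linarith
      calc _ ≤ M * ((N : ℝ) ^ τ * (x : ℝ) ^ θ) := by gcongr; exact h2.trans h3
        _ = M * (N : ℝ) ^ τ * (x : ℝ) ^ θ := by ring
        _ ≤ _ := le_add_of_nonneg_left (by positivity)
  have h2 : ∀ x : ℕ, M * ∑ a, p a * Bop (p a) x (fun k => (k : ℝ) ^ θ) ≤ l * (x : ℝ) ^ θ := by
    intro x
    calc _ ≤ M * ∑ a, p a * (p a ^ θ * (x : ℝ) ^ θ) := by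
          gcongr with a _
          · exact (h.p0 a).le
          · exact Bop_rpow_le (h.p0 a) (h.p1 a).le hθ0 (min_le_right _ _) x
      _ = _ := by
          rw [hl, mul_assoc, Finset.sum_mul]
          congr 1; refine Finset.sum_congr rfl fun a _ => ?_
          rw [← p_mul_rpow h]; ring
  set K0 := C' / ((1 - κ) / 2) with hK0
  have hK : 0 ≤ K0 := div_nonneg hC (by linarith)
  set C1 := M * (N : ℝ) ^ τ with hC1
  have hC10 : 0 ≤ C1 := by positivity
  refine ⟨K0, hK, K0 * C1 / (1 - l), div_nonneg (by positivity) (by linarith), fun x => ?_⟩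
  set B := K0 * C1 / (1 - l) with hB
  have hB0 : 0 ≤ B := div_nonneg (by positivity) (by linarith)
  simp only [Bop_add, Bop_mul, mul_add, Finset.sum_add_distrib]
  have e1 : ∀ (c : ℝ) (g : Fin A → ℝ), M * ∑ a, p a * (c * g a) = c * (M * ∑ a, p a * g a) := by
    intro c g
    rw [Finset.mul_sum, Finset.mul_sum, Finset.mul_sum]
    refine Finset.sum_congr rfl fun a _ => by ring
  rw [e1, e1]
  have h3 := mul_le_mul_of_nonneg_left (h1 x) hK
  have h4 := mul_le_mul_of_nonneg_left (h2 x) hB0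
  have e2 : K0 * ((1 - κ) / 2) = C' := by rw [hK0]; field_simp [(by linarith : (1 - κ) ≠ 0)]
  have e3 : B * (1 - l) = K0 * C1 := by rw [hB]; field_simp [(by linarith : (1 - l) ≠ 0)]
  have h5 : 0 ≤ (x : ℝ) ^ θ := by positivity
  have h6 : 0 ≤ (x : ℝ) ^ τ := by positivity
  have e4 : K0 * ((κ + (1 - κ) / 2) * (x : ℝ) ^ τ + C1 * (x : ℝ) ^ θ) = K0 * (x : ℝ) ^ τ - K0 * ((1 - κ) / 2) * (x : ℝ) ^ τ + K0 * C1 * (x : ℝ) ^ θ := by ring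
  rw [e4, e2, ← e3] at h3
  linarith

lemma Y_mom (h : Par M A p ρ) (hμ : IsLabelingMeasure p μL) {n : ℕ} (m d : ℕ) (φ : ℕ → ℝ) (i0 : Fin n) (J : Finset (Fin n)) (hJ : i0 ∉ J)
    (hU : ∀ K ⊆ J, ∫ Ls, U d i0 K Ls ^ m ∂(Measure.pi fun _ : Fin n => μL) ≤ φ K.card) :
    ∫ Ls, Y d i0 J Ls ^ m ∂(Measure.pi fun _ : Fin n => μL) ≤ ∑ a, p a * Bop (p a) J.card φ :=
  root_le hμ (fun a => (h.p0 a).le) h.sum1 i0 J hJ (Φ := fun _ K Ls => U d i0 K Ls ^ m) (fun _ K => (U_BM d i0 K).pow m)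
    (fun _ K Ls Ls' hh => by simp only [U_NoRoot d i0 K Ls Ls' hh]) (fun _ => φ) fun _ K hK => hU K hK

lemma U_mom (h : Par M A p ρ) (hμ : IsLabelingMeasure p μL) (m : ℕ) : ∃ C > (0:ℝ), ∀ (n d : ℕ) (i0 : Fin n) (J : Finset (Fin n)), i0 ∉ J →
    ∫ Ls, U d i0 J Ls ^ m ∂(Measure.pi fun _ : Fin n => μL) ≤ C * (J.card : ℝ) ^ ((ρ - 1) * m) := by
  have hσ : 0 < ρ - 1 := by linarith [h.ρ1]
  induction m using Nat.strong_induction_on with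
  | _ m ih =>
  match m, ih with
  | 0, _ => exact ⟨1, one_pos, fun n d i0 J hJ => by simp⟩
  | 1, _ =>
    obtain ⟨C1, hC1, h1⟩ := Fd_le h
    obtain ⟨C2, hC2, h2⟩ := ud_Fd h
    refine ⟨C1 + C2, by positivity, fun n d i0 J hJ => ?_⟩
    simp only [pow_one, Nat.cast_one, mul_one]
    rcases J.eq_empty_or_nonempty with rfl | hne
    · simp [U_empty, Real.zero_rpow hσ.ne']
    rw [U_mean h hμ d i0 J hJ]
    have hx : (1:ℝ) ≤ J.card := by exact_mod_cast hne.card_pos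
    have hx0 : (0:ℝ) < J.card := by linarith
    have h3 := h1 d J.card hx0
    have h4 := (abs_le.1 (h2 d J.card)).2
    have h5 := Lg_le_one (ε := 2 - ρ) hx0.le
    have h6 : 1 ≤ (J.card : ℝ) ^ (ρ - 1) := Real.one_le_rpow hx hσ.le
    have h7 : C1 * ((J.card : ℝ) ^ (ρ - 1) * Lg (2 - ρ) J.card) ≤ C1 * ((J.card : ℝ) ^ (ρ - 1) * 1) := by gcongr
    nlinarith
  | m + 2, ih =>
    obtain ⟨C1, hC1, h1⟩ := ih 1 (by omega)
    obtain ⟨Cm, hCm, hm⟩ := ih (m + 1) (by omega)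
    obtain ⟨Ct, hCt, ht⟩ := treem M m
    obtain ⟨C0, hC0, h0⟩ := two_pow_ineq (m + 1)
    set τ : ℝ := (ρ - 1) * ((m + 2 : ℕ) : ℝ) with hτ
    have hτσ : ρ - 1 < τ := by
      rw [hτ]; push_cast; nlinarith [Nat.cast_nonneg (α := ℝ) m]
    have hM := h.Mpos
    set C' := Ct * (Cm * C1) + C0 * (1 + (M:ℝ) ^ (m + 1) * Cm) with hC'
    have hC'0 : 0 ≤ C' := by positivity
    obtain ⟨K0, hK0, B, hB, hs⟩ := supersol h hτσ C' hC'0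
    have hτ0 : 0 < τ := by linarith
    have hθ0 : 0 < min τ 1 := lt_min hτ0 one_pos
    refine ⟨K0 + B + 1, by positivity, ?_⟩
    have key : ∀ (n d : ℕ) (i0 : Fin n) (J : Finset (Fin n)), i0 ∉ J →
        ∫ Ls, U d i0 J Ls ^ (m + 2) ∂(Measure.pi fun _ : Fin n => μL) ≤ K0 * (J.card : ℝ) ^ τ + B * (J.card : ℝ) ^ (min τ 1) := by
      intro n d i0
      induction d with
      | zero => intro J hJ; simp only [U, zero_pow (Nat.succ_ne_zero (m + 1)), integral_zero]; positivity
      | succ d ihd =>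
        intro J hJ
        rcases J.eq_empty_or_nonempty with rfl | hne
        · simp [U_empty, Real.zero_rpow hτ0.ne', Real.zero_rpow hθ0.ne']
        have hx : (1:ℝ) ≤ J.card := by exact_mod_cast hne.card_pos
        refine le_trans ?_ (hs J.card)
        have hY1 : ∫ Ls, Y d i0 J Ls ∂(Measure.pi fun _ : Fin n => μL) ≤ C1 * (J.card : ℝ) ^ (ρ - 1) := by
          have := Y_mom h hμ 1 d (fun k => C1 * (k : ℝ) ^ (ρ - 1)) i0 J hJ fun K hK => by
            simpa using h1 n d i0 K fun hh => hJ (hK hh)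
          simp only [pow_one] at this
          refine this.trans (sumB_le h _ _ _ fun a k hk => ?_)
          have : (k : ℝ) ≤ J.card := by exact_mod_cast hk
          gcongr
        have hYm : ∫ Ls, Y d i0 J Ls ^ (m + 1) ∂(Measure.pi fun _ : Fin n => μL) ≤ Cm * (J.card : ℝ) ^ ((ρ - 1) * ((m + 1 : ℕ) : ℝ)) := by
          have := Y_mom h hμ (m + 1) d (fun k => Cm * (k : ℝ) ^ ((ρ - 1) * ((m + 1 : ℕ) : ℝ))) i0 J hJ fun K hK =>
            hm n d i0 K fun hh => hJ (hK hh)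
          refine this.trans (sumB_le h _ _ _ fun a k hk => ?_)
          have : (k : ℝ) ≤ J.card := by exact_mod_cast hk
          gcongr
        have hYm2 := Y_mom h hμ (m + 2) d (fun k => K0 * (k : ℝ) ^ τ + B * (k : ℝ) ^ (min τ 1)) i0 J hJ fun K hK =>
            ihd K fun hh => hJ (hK hh)
        have hz : BM fun Ls => ∑ i, Y (M := M) (A := A) d i0 J (shift i Ls) := BM.sum _ fun i _ => (Y_BM d i0 J).comp (shift_meas i)
        have hpt : ∀ Ls : Fin n → List (Fin M) → Fin A, U (d + 1) i0 J Ls ^ (m + 2) ≤ (∑ i, Y d i0 J (shift i Ls)) ^ (m + 2) +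
            C0 * (1 + (M : ℝ) ^ m * ∑ i, Y d i0 J (shift i Ls) ^ (m + 1)) := by
          intro Ls
          rw [U_succ]
          have hz0 : 0 ≤ ∑ i, Y d i0 J (shift i Ls) := Finset.sum_nonneg fun i _ => Y_nonneg _ _ _ _
          have hp := pow_sum_le_card_mul_sum_pow (s := Finset.univ) (f := fun i => Y d i0 J (shift i Ls)) (fun i _ => Y_nonneg _ _ _ _) m
          simp only [Finset.card_univ, Fintype.card_fin] at hp
          have h2 : 0 ≤ (M : ℝ) ^ m * ∑ i, Y d i0 J (shift i Ls) ^ (m + 1) := le_trans (by positivity) hp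
          split_ifs
          · have := h0 _ 1 hz0 zero_le_one
            rw [add_comm (1:ℝ)]
            refine this.trans ?_
            rw [one_pow, one_mul]
            have h8 := mul_le_mul_of_nonneg_left hp hC0
            have h9 : ∀ u v w : ℝ, C0 * v ≤ C0 * w → u + C0 * (1 + v) ≤ u + C0 * (1 + w) := fun u v w hh => by linarith
            exact h9 _ _ _ h8
          · rw [zero_add]
            exact le_add_of_nonneg_right (by positivity)
        have hbs : BM fun Ls => ∑ i, Y (M := M) (A := A) d i0 J (shift i Ls) ^ (m + 1) := BM.sum _ fun i _ => ((Y_BM d i0 J).pow _).comp (shift_meas i)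
        refine (integral_mono (((U_BM (d + 1) i0 J).pow _).int _) (((hz.pow _).add ((BM.const C0).mul ((BM.const 1).add ((BM.const ((M : ℝ) ^ m)).mul hbs)))).int _) hpt).trans ?_
        rw [integral_add ((hz.pow _).int _) (((BM.const C0).mul ((BM.const 1).add ((BM.const ((M : ℝ) ^ m)).mul hbs))).int _), integral_const_mul,
          integral_add ((BM.const 1).int _) (((BM.const ((M : ℝ) ^ m)).mul hbs).int _), integral_const_mul, tree1 hμ ((Y_BM d i0 J).pow _)]
        simp only [integral_const, probReal_univ, one_smul]
        have htt := ht A n p μL hμ (Y d i0 J) (Y_BM d i0 J) (Y_nonneg d i0 J)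
        have hY0 : 0 ≤ ∫ Ls, Y d i0 J Ls ∂(Measure.pi fun _ : Fin n => μL) := integral_nonneg fun Ls => Y_nonneg _ _ _ _
        set x : ℝ := (J.card : ℝ) with hxd
        have e1 : x ^ ((ρ - 1) * ((m + 1 : ℕ) : ℝ)) * x ^ (ρ - 1) = x ^ τ := by
          rw [← Real.rpow_add (by linarith)]; congr 1; rw [hτ]; push_cast; ring
        have e2 : x ^ ((ρ - 1) * ((m + 1 : ℕ) : ℝ)) ≤ x ^ τ := by
          refine Real.rpow_le_rpow_of_exponent_le hx ?_
          rw [hτ]; push_cast; nlinarith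
        have e3 : 1 ≤ x ^ τ := Real.one_le_rpow hx hτ0.le
        have f1 : Ct * ((∫ Ls, Y d i0 J Ls ^ (m + 1) ∂(Measure.pi fun _ : Fin n => μL)) * ∫ Ls, Y d i0 J Ls ∂(Measure.pi fun _ : Fin n => μL)) ≤
            Ct * (Cm * C1) * x ^ τ := by
          rw [← e1]
          calc _ ≤ Ct * ((Cm * x ^ ((ρ - 1) * ((m + 1 : ℕ) : ℝ))) * (C1 * x ^ (ρ - 1))) := by gcongr
            _ = _ := by ring
        have f2 : C0 * (1 + (M:ℝ) ^ m * (M * ∫ Ls, Y d i0 J Ls ^ (m + 1) ∂(Measure.pi fun _ : Fin n => μL))) ≤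
            C0 * (1 + (M:ℝ) ^ (m + 1) * Cm) * x ^ τ := by
          calc _ ≤ C0 * (1 * x ^ τ + (M:ℝ) ^ m * (M * (Cm * x ^ τ))) := by
                gcongr
                · rw [one_mul]; exact e3
                · exact hYm.trans (by gcongr)
            _ = _ := by ring
        have f3 := mul_le_mul_of_nonneg_left hYm2 hM.le
        have e5 : C' * x ^ τ = Ct * (Cm * C1) * x ^ τ + C0 * (1 + (M:ℝ) ^ (m + 1) * Cm) * x ^ τ := by rw [hC']; ring
        rw [e5]
        linarith
    intro n d i0 J hJ
    rcases J.eq_empty_or_nonempty with rfl | hne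
    · have : (ρ - 1) * ((m + 2 : ℕ) : ℝ) ≠ 0 := hτ0.ne'
      simp only [U_empty, zero_pow (Nat.succ_ne_zero (m + 1)), integral_zero]
      positivity
    have hx : (1:ℝ) ≤ J.card := by exact_mod_cast hne.card_pos
    refine (key n d i0 J hJ).trans ?_
    have e3 : (J.card : ℝ) ^ (min τ 1) ≤ (J.card : ℝ) ^ τ := Real.rpow_le_rpow_of_exponent_le hx (min_le_left _ _)
    have e4 : 0 ≤ (J.card : ℝ) ^ τ := by positivity
    have := mul_le_mul_of_nonneg_left e3 hB
    nlinarith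

end GT

open MeasureTheory ProbabilityTheory Filter Topology

namespace GT

variable {n M A : ℕ} {p : Fin A → ℝ} {ρ : ℝ} {μL : Measure (List (Fin M) → Fin A)} [IsProbabilityMeasure μL]

/-- factor kappa -/
noncomputable def kap (M : ℕ) (p : Fin A → ℝ) (ρ : ℝ) : ℝ := M * ∑ a, p a ^ (2 * ρ - 1)

lemma kap_lt (h : Par M A p ρ) : kap M p ρ < 1 := h.kappa_lt (by linarith [h.ρ1])

lemma kap_pos (h : Par M A p ρ) : 0 < kap M p ρ := by
  have hM := h.Mpos
  have := h.nonempty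
  have : 0 < ∑ a, p a ^ (2 * ρ - 1) := Finset.sum_pos (fun a _ => by have := h.p0 a; positivity) Finset.univ_nonempty
  unfold kap
  positivity

/-- second moment of the martingale -/
noncomputable def ww (M : ℕ) (p : Fin A → ℝ) (ρ : ℝ) : ℕ → ℝ
  | 0 => 1
  | k + 1 => kap M p ρ * ww M p ρ k + ((M : ℝ) - 1) / M

lemma BMp (σ : ℝ) : BM (fun a : Fin A => p a ^ σ) :=
  ⟨measurable_of_finite _, ∑ b, |p b ^ σ|, fun a => Finset.single_le_sum (f := fun b => |p b ^ σ|) (fun _ _ => abs_nonneg _) (Finset.mem_univ a)⟩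

lemma BMroot (σ : ℝ) (i0 : Fin n) : BM (fun Ls : Fin n → List (Fin M) → Fin A => p (Ls i0 []) ^ σ) :=
  (BMp σ).comp ((measurable_pi_apply ([] : List (Fin M))).comp (measurable_pi_apply i0))

lemma W_Z1 (h : Par M A p ρ) (hμ : IsLabelingMeasure p μL) (k : ℕ) (i0 : Fin n)
    (ih : ∫ Ls, W p (ρ - 1) k (Ls i0) ∂(Measure.pi fun _ : Fin n => μL) = 1) :
    M * ∫ Ls, p (Ls i0 []) ^ (ρ - 1) * W p (ρ - 1) k (Ls i0) ∂(Measure.pi fun _ : Fin n => μL) = 1 := by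
  have := root_eq hμ (fun a => (h.p0 a).le) h.sum1 i0 ∅ (by simp) (Φ := fun a _ Ls => p a ^ (ρ - 1) * W p (ρ - 1) k (Ls i0))
    (fun a K => (BM.const _).mul (W_BM _ _ _ _)) (fun a K Ls Ls' hh => by have := W_NoRoot p (ρ - 1) k i0 Ls Ls' hh; dsimp only at this ⊢; rw [this])
    (fun a _ => p a ^ (ρ - 1)) (fun a K hK => by rw [integral_const_mul, ih, mul_one])
  rw [this]
  refine Eq.trans ?_ h.hρ
  congr 1
  refine Finset.sum_congr rfl fun a _ => ?_
  rw [Bop_const, p_mul_rpow h]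
  congr 1; ring

lemma W_mean (h : Par M A p ρ) (hμ : IsLabelingMeasure p μL) (k : ℕ) (i0 : Fin n) :
    ∫ Ls, W p (ρ - 1) k (Ls i0) ∂(Measure.pi fun _ : Fin n => μL) = 1 := by
  induction k with
  | zero => simp [W]
  | succ k ih =>
    simp only [W_succ]
    rw [tree1 hμ (Z := fun Ls => p (Ls i0 []) ^ (ρ - 1) * W p (ρ - 1) k (Ls i0)) ((BMroot _ _).mul (W_BM _ _ _ _))]
    exact W_Z1 h hμ k i0 ih

lemma W_sq (h : Par M A p ρ) (hμ : IsLabelingMeasure p μL) (k : ℕ) (i0 : Fin n) :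
    ∫ Ls, W p (ρ - 1) k (Ls i0) ^ 2 ∂(Measure.pi fun _ : Fin n => μL) = ww M p ρ k := by
  induction k with
  | zero => simp [W, ww]
  | succ k ih =>
    simp only [W_succ]
    have hM := h.Mpos
    rw [tree2 hμ (Z := fun Ls => p (Ls i0 []) ^ (ρ - 1) * W p (ρ - 1) k (Ls i0)) ((BMroot _ _).mul (W_BM _ _ _ _))]
    have h1 := W_Z1 h hμ k i0 (W_mean h hμ k i0)
    have h2 := root_eq hμ (fun a => (h.p0 a).le) h.sum1 i0 ∅ (by simp) (Φ := fun a _ Ls => (p a ^ (ρ - 1) * W p (ρ - 1) k (Ls i0)) ^ 2)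
      (fun a K => ((BM.const _).mul (W_BM _ _ _ _)).pow 2) (fun a K Ls Ls' hh => by have := W_NoRoot p (ρ - 1) k i0 Ls Ls' hh; dsimp only at this ⊢; rw [this])
      (fun a _ => (p a ^ (ρ - 1)) ^ 2 * ww M p ρ k) (fun a K hK => by simp only [mul_pow]; rw [integral_const_mul, ih])
    rw [h2, ww, kap]
    have h3 : ∫ Ls, p (Ls i0 []) ^ (ρ - 1) * W p (ρ - 1) k (Ls i0) ∂(Measure.pi fun _ : Fin n => μL) = 1 / M := by
      rw [eq_div_iff hM.ne']; linarith
    rw [h3]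
    congr 1
    · rw [mul_assoc, Finset.sum_mul]
      congr 1
      refine Finset.sum_congr rfl fun a _ => ?_
      rw [Bop_const, ← mul_assoc, ← Real.rpow_natCast, ← Real.rpow_mul (h.p0 a).le, p_mul_rpow h]
      congr 2; push_cast; ring
    · field_simp

lemma ww_lim (h : Par M A p ρ) : Tendsto (ww M p ρ) atTop (𝓝 (((M : ℝ) - 1) / (M * (1 - kap M p ρ)))) := by
  have hM := h.Mpos
  have h1 := kap_lt h
  have h0 := kap_pos h
  set L := ((M : ℝ) - 1) / (M * (1 - kap M p ρ)) with hL
  have h2 : ∀ k, ww M p ρ k = L + kap M p ρ ^ k * (1 - L) := by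
    intro k
    induction k with
    | zero => simp [ww]
    | succ k ih =>
      have : ((M : ℝ) - 1) / M = L * (1 - kap M p ρ) := by
        rw [hL]; have : 1 - kap M p ρ ≠ 0 := by linarith
        field_simp
      rw [ww, ih, this]; ring
  have h3 : Tendsto (fun k : ℕ => L + kap M p ρ ^ k * (1 - L)) atTop (𝓝 (L + 0 * (1 - L))) :=
    ((tendsto_pow_atTop_nhds_zero_of_lt_one h0.le h1).mul_const _).const_add _
  simp only [zero_mul, add_zero] at h3
  exact h3.congr fun k => (h2 k).symm

lemma ww_nonneg (h : Par M A p ρ) (k : ℕ) : 0 ≤ ww M p ρ k := by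
  have h0 := kap_pos h
  have : (1:ℝ) ≤ M := by exact_mod_cast h.hM
  induction k with
  | zero => simp [ww]
  | succ k ih => rw [ww]; have : 0 ≤ (M:ℝ) - 1 := by linarith
                 positivity

lemma FF_dev (h : Par M A p ρ) (a : Fin A) : ∃ C > 0, ∀ (x k : ℕ), 1 ≤ x → k ≤ x →
    (FF M p k - FF M p (p a * x)) ^ 2 ≤ C * (x : ℝ) ^ (2 * (ρ - 1)) * ((k - x * p a) ^ 2 / (x : ℝ) ^ 2) := by
  obtain ⟨C, hC, hF⟩ := FF_le' h
  have hp := h.p0 a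
  have hp1 := h.p1 a
  have hσ : 0 < ρ - 1 := by linarith [h.ρ1]
  refine ⟨(12 * C / p a) ^ 2, by positivity, fun x k hx hk => ?_⟩
  have hx0 : (0:ℝ) < x := by exact_mod_cast hx
  have hkx : (k:ℝ) ≤ x := by exact_mod_cast hk
  have hb : ∀ y : ℝ, 0 ≤ y → y ≤ x → FF M p y ≤ C * (x : ℝ) ^ (ρ - 1) + 0 := by
    intro y hy hyx
    rcases hy.eq_or_lt with rfl | hy
    · have : ∀ d, Fd M p d 0 = 0 := fun d => by
        induction d with
        | zero => simp [Fd]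
        | succ d ih => simp [Fd, ih]
      rw [FF]; simp only [this, ciSup_const]; positivity
    · rw [add_zero]; refine (hF y hy).trans ?_; gcongr
  simp only [add_zero] at hb
  have key : |FF M p k - FF M p (p a * x)| ≤ 12 * C / p a * (x : ℝ) ^ (ρ - 1) * (|k - x * p a| / x) := by
    rcases le_or_gt |(k:ℝ) - p a * x| (p a * x / 4) with hc | hc
    · refine (FF_lip h (by positivity) hc).trans ?_
      have := hb (p a * x / 2) (by positivity) (by nlinarith)
      calc _ ≤ 12 * (|(k:ℝ) - p a * x| / (p a * x)) * (C * (x : ℝ) ^ (ρ - 1)) := by gcongr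
        _ = _ := by rw [mul_comm (x:ℝ) (p a)]; field_simp
    · have h1 := hb k (by positivity) hkx
      have h2 := hb (p a * x) (by positivity) (by nlinarith)
      have h3 := FF_nonneg h (y := k) (by positivity)
      have h4 := FF_nonneg h (y := p a * x) (by positivity)
      have h5 : |FF M p k - FF M p (p a * x)| ≤ C * (x : ℝ) ^ (ρ - 1) := by rw [abs_le]; constructor <;> linarith
      have h6 : 1 ≤ 12 / p a * (|k - x * p a| / x) := by
        rw [mul_comm (x:ℝ) (p a)]
        rw [div_mul_div_comm, le_div_iff₀ (by positivity)]
        nlinarith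
      calc _ ≤ C * (x : ℝ) ^ (ρ - 1) * 1 := by rw [mul_one]; exact h5
        _ ≤ C * (x : ℝ) ^ (ρ - 1) * (12 / p a * (|k - x * p a| / x)) := by gcongr
        _ = _ := by ring
  have := pow_le_pow_left₀ (abs_nonneg _) key 2
  rw [sq_abs] at this
  refine this.trans (le_of_eq ?_)
  rw [mul_pow, mul_pow, div_pow (|_|), sq_abs, ← Real.rpow_natCast ((x:ℝ) ^ (ρ - 1)), ← Real.rpow_mul hx0.le]
  congr 3; push_cast; ring

lemma err_ev (h : Par M A p ρ) {δ : ℝ} (hδ : 0 < δ) :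
    ∀ᶠ x : ℕ in atTop, ∑ a, p a * Bop (p a) x (fun k => (FF M p k - p a ^ (ρ - 1) * FF M p x) ^ 2) ≤ δ * (x : ℝ) ^ (2 * (ρ - 1)) := by
  have hσ : 0 < ρ - 1 := by linarith [h.ρ1]
  suffices hs : ∀ a, ∀ᶠ x : ℕ in atTop, Bop (p a) x (fun k => (FF M p k - p a ^ (ρ - 1) * FF M p x) ^ 2) ≤ δ * (x : ℝ) ^ (2 * (ρ - 1)) by
    filter_upwards [eventually_all.2 hs] with x hx
    calc _ ≤ ∑ a, p a * (δ * (x : ℝ) ^ (2 * (ρ - 1))) := by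
          gcongr with a _
          · exact (h.p0 a).le
          · exact hx a
      _ = _ := by rw [← Finset.sum_mul, h.sum1, one_mul]
  intro a
  obtain ⟨C, hC, hF⟩ := FF_dev h a
  have hp := h.p0 a
  have hp1 := h.p1 a
  have e1 : ∀ᶠ x : ℕ in atTop, 2 * C / (x:ℝ) < δ / 2 := by
    have : Tendsto (fun x : ℕ => 2 * C / (x:ℝ)) atTop (𝓝 0) := tendsto_const_nhds.div_atTop tendsto_natCast_atTop_atTop
    exact this.eventually_lt_const (by positivity)
  have e2 : ∀ᶠ x : ℕ in atTop, 2 * ((p a ^ (ρ - 1) * FF M p x - FF M p (p a * x)) / (x:ℝ) ^ (ρ - 1)) ^ 2 < δ / 2 := by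
    have := ((FF_scale h a).pow 2).const_mul 2
    refine this.eventually_lt_const (by simp; positivity)
  filter_upwards [e1, e2, eventually_ge_atTop 1] with x h1 h2 hx
  have hx0 : (0:ℝ) < x := by exact_mod_cast hx
  have hxx : (x:ℝ) ^ (2 * (ρ - 1)) = ((x:ℝ) ^ (ρ - 1)) ^ 2 := by
    rw [← Real.rpow_natCast ((x:ℝ) ^ (ρ - 1)), ← Real.rpow_mul hx0.le]; congr 1; push_cast; ring
  have hX : 0 < (x:ℝ) ^ (2 * (ρ - 1)) := by positivity
  set D := (p a ^ (ρ - 1) * FF M p x - FF M p (p a * x)) with hD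
  calc _ ≤ Bop (p a) x (fun k => (2 * (C * (x : ℝ) ^ (2 * (ρ - 1)) / (x : ℝ) ^ 2)) * (k - x * p a) ^ 2 + 2 * D ^ 2) := by
        refine Bop_mono hp.le hp1.le x _ _ fun k hk => ?_
        have h3 := hF x k hx hk
        have : (FF M p k - p a ^ (ρ - 1) * FF M p x) ^ 2 ≤ 2 * (FF M p k - FF M p (p a * x)) ^ 2 + 2 * D ^ 2 := by
          rw [hD]; nlinarith [sq_nonneg (FF M p k - FF M p (p a * x) + (p a ^ (ρ - 1) * FF M p x - FF M p (p a * x)))]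
        refine this.trans ?_
        have e : C * (x : ℝ) ^ (2 * (ρ - 1)) * ((k - x * p a) ^ 2 / (x : ℝ) ^ 2) = (C * (x : ℝ) ^ (2 * (ρ - 1)) / (x : ℝ) ^ 2) * (k - x * p a) ^ 2 := by ring
        rw [e] at h3
        linarith
    _ = (2 * (C * (x : ℝ) ^ (2 * (ρ - 1)) / (x : ℝ) ^ 2)) * (x * p a * (1 - p a)) + 2 * D ^ 2 := by
        rw [Bop_add, Bop_mul, Bop_var, Bop_const]
    _ ≤ (2 * C / x) * (x : ℝ) ^ (2 * (ρ - 1)) + 2 * D ^ 2 := by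
        gcongr ?_ + _
        have : (x:ℝ) * p a * (1 - p a) ≤ x := by nlinarith [mul_pos hx0 hp, mul_pos hp hp, sq_nonneg (p a)]
        calc _ ≤ (2 * (C * (x : ℝ) ^ (2 * (ρ - 1)) / (x : ℝ) ^ 2)) * x := by gcongr
          _ = _ := by field_simp
    _ ≤ δ / 2 * (x : ℝ) ^ (2 * (ρ - 1)) + δ / 2 * (x : ℝ) ^ (2 * (ρ - 1)) := by
        have h4 : 2 * D ^ 2 ≤ δ / 2 * (x : ℝ) ^ (2 * (ρ - 1)) := by
          rw [div_pow, ← hxx, ← mul_div_assoc, div_lt_iff₀ hX] at h2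
          exact h2.le
        gcongr
    _ = _ := by ring

end GT

open MeasureTheory ProbabilityTheory Filter Topology

namespace GT

variable {M A : ℕ} {p : Fin A → ℝ} {ρ : ℝ} {μL : Measure (List (Fin M) → Fin A)} [IsProbabilityMeasure μL]

lemma FF_zero : FF M p 0 = 0 := by
  have : ∀ d, Fd M p d 0 = 0 := fun d => by
    induction d with
    | zero => simp [Fd]
    | succ d ih => simp [Fd, ih]
  rw [FF]; simp only [this, ciSup_const]

lemma FF_nat (h : Par M A p ρ) : ∃ C > 0, ∀ x : ℕ, FF M p x ≤ C * (x : ℝ) ^ (ρ - 1) := by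
  obtain ⟨C, hC, hF⟩ := FF_le' h
  refine ⟨C, hC, fun x => ?_⟩
  rcases Nat.eq_zero_or_pos x with rfl | hx
  · rw [Nat.cast_zero, FF_zero]; positivity
  · exact hF x (by exact_mod_cast hx)

/-- the difference controlled in the mean square -/
noncomputable def Df (p : Fin A → ℝ) (ρ : ℝ) {n : ℕ} (d k : ℕ) (i0 : Fin n) (J : Finset (Fin n)) (Ls : Fin n → List (Fin M) → Fin A) : ℝ :=
  U d i0 J Ls - FF M p J.card * W p (ρ - 1) k (Ls i0)

lemma Df_BM {n : ℕ} (d k : ℕ) (i0 : Fin n) (J : Finset (Fin n)) : BM (Df (M := M) p ρ d k i0 J) :=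
  (U_BM d i0 J).sub ((BM.const _).mul (W_BM _ _ _ _))

lemma L2_crude (h : Par M A p ρ) (hμ : IsLabelingMeasure p μL) (k : ℕ) : ∃ C > 0, ∀ (n d : ℕ) (i0 : Fin n) (J : Finset (Fin n)), i0 ∉ J →
    ∫ Ls, Df p ρ d k i0 J Ls ^ 2 ∂(Measure.pi fun _ : Fin n => μL) ≤ C * (J.card : ℝ) ^ (2 * (ρ - 1)) := by
  obtain ⟨C, hC, hF⟩ := FF_nat h
  obtain ⟨C2, hC2, hU⟩ := U_mom h hμ 2
  have hw := ww_nonneg h k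
  refine ⟨2 * C2 + 2 * (C ^ 2 * ww M p ρ k), by positivity, fun n d i0 J hJ => ?_⟩
  have h1 := hU n d i0 J hJ
  have e1 : (ρ - 1) * ((2 : ℕ) : ℝ) = 2 * (ρ - 1) := by push_cast; ring
  rw [e1] at h1
  have h2 : FF M p J.card ^ 2 ≤ C ^ 2 * (J.card : ℝ) ^ (2 * (ρ - 1)) := by
    have := pow_le_pow_left₀ (FF_nonneg h (Nat.cast_nonneg _)) (hF J.card) 2
    rw [mul_pow, ← Real.rpow_natCast ((J.card : ℝ) ^ (ρ - 1)), ← Real.rpow_mul (Nat.cast_nonneg _), e1] at this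
    exact this
  have hb : BM fun Ls : Fin n → List (Fin M) → Fin A => U d i0 J Ls ^ 2 := (U_BM d i0 J).pow 2
  have hb2 : BM fun Ls : Fin n → List (Fin M) → Fin A => W p (ρ - 1) k (Ls i0) ^ 2 := (W_BM _ _ _ _).pow 2
  calc _ ≤ ∫ Ls, (2 * U d i0 J Ls ^ 2 + 2 * FF M p J.card ^ 2 * W p (ρ - 1) k (Ls i0) ^ 2) ∂(Measure.pi fun _ : Fin n => μL) := by
        refine integral_mono (((Df_BM d k i0 J).pow 2).int _) ((((BM.const _).mul hb).add ((BM.const _).mul hb2)).int _) fun Ls => ?_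
        simp only [Df]
        nlinarith [sq_nonneg (U d i0 J Ls + FF M p J.card * W p (ρ - 1) k (Ls i0))]
    _ = 2 * ∫ Ls, U d i0 J Ls ^ 2 ∂(Measure.pi fun _ : Fin n => μL) + 2 * FF M p J.card ^ 2 * ww M p ρ k := by
        rw [integral_add (((BM.const _).mul hb).int _) (((BM.const _).mul hb2).int _), integral_const_mul, integral_const_mul, W_sq h hμ]
    _ ≤ 2 * (C2 * (J.card : ℝ) ^ (2 * (ρ - 1))) + 2 * (C ^ 2 * (J.card : ℝ) ^ (2 * (ρ - 1))) * ww M p ρ k := by gcongr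
    _ = _ := by ring

/-- the mean square induction hypothesis -/
def HH (p : Fin A → ℝ) (ρ : ℝ) (μL : Measure (List (Fin M) → Fin A)) (k : ℕ) (r : ℝ) : Prop :=
  ∃ C ≥ (0:ℝ), ∀ x : ℕ, ∃ d0 : ℕ, ∀ d ≥ d0, ∀ (n : ℕ) (i0 : Fin n) (J : Finset (Fin n)), i0 ∉ J → J.card = x →
    ∫ Ls, Df p ρ d k i0 J Ls ^ 2 ∂(Measure.pi fun _ : Fin n => μL) ≤ r * (x : ℝ) ^ (2 * (ρ - 1)) + C

lemma HH.mono {k : ℕ} {r r' : ℝ} (hr : r ≤ r') (H : HH p ρ μL k r) : HH p ρ μL k r' := by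
  obtain ⟨C, hC, H⟩ := H
  refine ⟨C, hC, fun x => ?_⟩
  obtain ⟨d0, hd⟩ := H x
  refine ⟨d0, fun d hd' n i0 J hJ hx => (hd d hd' n i0 J hJ hx).trans ?_⟩
  gcongr

lemma Z_bound (h : Par M A p ρ) (hμ : IsLabelingMeasure p μL) {n : ℕ} (d k : ℕ) (i0 : Fin n) (K : Finset (Fin n)) (q f b t : ℝ) (ht : 0 < t)
    (hb : ∫ Ls, Df p ρ d k i0 K Ls ^ 2 ∂(Measure.pi fun _ : Fin n => μL) ≤ b) :
    ∫ Ls, (U d i0 K Ls - f * (q * W p (ρ - 1) k (Ls i0))) ^ 2 ∂(Measure.pi fun _ : Fin n => μL) ≤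
      (1 + t) * b + (1 + 1 / t) * ww M p ρ k * (FF M p K.card - q * f) ^ 2 := by
  have hb1 : BM fun Ls : Fin n → List (Fin M) → Fin A => Df p ρ d k i0 K Ls ^ 2 := (Df_BM d k i0 K).pow 2
  have hb2 : BM fun Ls : Fin n → List (Fin M) → Fin A => W p (ρ - 1) k (Ls i0) ^ 2 := (W_BM _ _ _ _).pow 2
  calc _ ≤ ∫ Ls, ((1 + t) * Df p ρ d k i0 K Ls ^ 2 + (1 + 1 / t) * (FF M p K.card - q * f) ^ 2 * W p (ρ - 1) k (Ls i0) ^ 2) ∂(Measure.pi fun _ : Fin n => μL) := by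
        refine integral_mono ((((U_BM d i0 K).sub ((BM.const f).mul ((BM.const q).mul (W_BM _ _ _ _)))).pow 2).int _) ((((BM.const _).mul hb1).add ((BM.const _).mul hb2)).int _) fun Ls => ?_
        have key : ∀ u v : ℝ, (u + v) ^ 2 ≤ (1 + t) * u ^ 2 + (1 + 1 / t) * v ^ 2 := fun u v => by
          have : (1 + t) * u ^ 2 + (1 + 1 / t) * v ^ 2 - (u + v) ^ 2 = (t * u - v) ^ 2 / t := by field_simp; ring
          have h2 : 0 ≤ (t * u - v) ^ 2 / t := by positivity
          linarith
        have := key (Df p ρ d k i0 K Ls) ((FF M p K.card - q * f) * W p (ρ - 1) k (Ls i0))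
        refine le_trans (le_of_eq ?_) (this.trans (le_of_eq ?_))
        · simp only [Df]; ring
        · ring
    _ = (1 + t) * ∫ Ls, Df p ρ d k i0 K Ls ^ 2 ∂(Measure.pi fun _ : Fin n => μL) + (1 + 1 / t) * (FF M p K.card - q * f) ^ 2 * ww M p ρ k := by
        rw [integral_add (((BM.const _).mul hb1).int _) (((BM.const _).mul hb2).int _), integral_const_mul, integral_const_mul, W_sq h hμ]
    _ ≤ _ := by
        have : (1 + t) * ∫ Ls, Df p ρ d k i0 K Ls ^ 2 ∂(Measure.pi fun _ : Fin n => μL) ≤ (1 + t) * b := by gcongr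
        linarith

lemma HH_step (h : Par M A p ρ) (hμ : IsLabelingMeasure p μL) {k : ℕ} {r : ℝ} (hr : 0 < r) (H : HH p ρ μL k r) :
    HH p ρ μL (k + 1) ((1 + kap M p ρ) / 2 * r) := by
  obtain ⟨C, hC, H⟩ := H
  choose D hD using H
  obtain ⟨C2, hC2, hud⟩ := ud_Fd h
  obtain ⟨Cc, hCc, hcr⟩ := L2_crude h hμ (k + 1)
  have hM := h.Mpos
  have hM1 : (1:ℝ) ≤ M := by exact_mod_cast h.hM
  have hκ := kap_lt h
  have hκ0 := kap_pos h
  have hσ : 0 < ρ - 1 := by linarith [h.ρ1]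
  have hw := ww_nonneg h k
  set t := (1 - kap M p ρ) / 8 with ht
  have ht0 : 0 < t := by rw [ht]; linarith
  set δ := t * r / (M * ((1 + 1 / t) * (ww M p ρ k + 1))) with hδ
  have hδ0 : 0 < δ := by positivity
  obtain ⟨N, hN⟩ := eventually_atTop.1 ((BK_ev h (τ := 2 * (ρ - 1)) (by linarith) ht0).and (err_ev h hδ0))
  have hN' : 0 ≤ Cc * ((N + 2 : ℕ) : ℝ) ^ (2 * (ρ - 1)) := by positivity
  have hMM : 0 ≤ (M:ℝ) * (M - 1) * (C2 + 1) ^ 2 := by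
    have : 0 ≤ (M:ℝ) - 1 := by linarith
    positivity
  have hMC : 0 ≤ M * ((1 + t) * C) := by positivity
  refine ⟨M * ((1 + t) * C) + M * (M - 1) * (C2 + 1) ^ 2 + Cc * ((N + 2 : ℕ) : ℝ) ^ (2 * (ρ - 1)), by positivity, fun x => ?_⟩
  rcases lt_or_ge x (N + 2) with hx | hx
  · refine ⟨0, fun d _ n i0 J hJ hxJ => (hcr n d i0 J hJ).trans ?_⟩
    rw [hxJ]
    have h1 : (x : ℝ) ^ (2 * (ρ - 1)) ≤ ((N + 2 : ℕ) : ℝ) ^ (2 * (ρ - 1)) := by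
      have : (x:ℝ) ≤ (N + 2 : ℕ) := by exact_mod_cast hx.le
      gcongr
    have h2 := mul_le_mul_of_nonneg_left h1 hCc.le
    have h3 : 0 ≤ (1 + kap M p ρ) / 2 * r * (x : ℝ) ^ (2 * (ρ - 1)) := by positivity
    linarith
  · obtain ⟨hBK, hER⟩ := hN x (by omega)
    have hF := (Metric.tendsto_atTop.1 (Fd_tendsto h (y := x) (Nat.cast_nonneg _)) 1 one_pos)
    obtain ⟨d1, hd1⟩ := hF
    refine ⟨(Finset.range (x + 1)).sup D + d1 + 1, fun d hd n i0 J hJ hxJ => ?_⟩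
    obtain ⟨d, rfl⟩ : ∃ d', d = d' + 1 := ⟨d - 1, by omega⟩
    set Z : (Fin n → List (Fin M) → Fin A) → ℝ := fun Ls => Y d i0 J Ls - FF M p x * (p (Ls i0 []) ^ (ρ - 1) * W p (ρ - 1) k (Ls i0)) with hZ
    have hZB : BM Z := (Y_BM d i0 J).sub ((BM.const _).mul ((BMroot _ _).mul (W_BM _ _ _ _)))
    have hDf : ∀ Ls, Df p ρ (d + 1) (k + 1) i0 J Ls = ∑ i, Z (shift i Ls) := fun Ls => by
      simp only [Df, hZ]
      rw [U_succ, if_neg (by omega), zero_add, W_succ, hxJ, Finset.mul_sum, ← Finset.sum_sub_distrib]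
    have hmean : M * ∫ Ls, Z Ls ∂(Measure.pi fun _ : Fin n => μL) = ud M p (d + 1) x - FF M p x := by
      rw [← tree1 hμ hZB]
      simp only [← hDf, Df]
      rw [integral_sub ((U_BM _ _ _).int _) (((BM.const _).mul (W_BM _ _ _ _)).int _), integral_const_mul, W_mean h hμ, U_mean h hμ _ _ _ hJ, hxJ, mul_one]
    simp only [hDf]
    rw [tree2 hμ hZB]
    have hm2 : (∫ Ls, Z Ls ∂(Measure.pi fun _ : Fin n => μL)) ^ 2 ≤ (C2 + 1) ^ 2 := by
      have h1 : |M * ∫ Ls, Z Ls ∂(Measure.pi fun _ : Fin n => μL)| ≤ C2 + 1 := by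
        rw [hmean]
        have h2 := hud (d + 1) x
        have h3 := hd1 (d + 1) (by omega)
        rw [Real.dist_eq] at h3
        calc _ = |(ud M p (d + 1) x - Fd M p (d + 1) x) + (Fd M p (d + 1) x - FF M p x)| := by ring_nf
          _ ≤ _ := (abs_add_le _ _).trans (by linarith)
      rw [abs_mul, abs_of_pos hM] at h1
      have h2 : |∫ Ls, Z Ls ∂(Measure.pi fun _ : Fin n => μL)| ≤ C2 + 1 := by nlinarith [abs_nonneg (∫ Ls, Z Ls ∂(Measure.pi fun _ : Fin n => μL))]
      rw [← sq_abs]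
      gcongr
    have hZ2 := root_le hμ (fun a => (h.p0 a).le) h.sum1 i0 J hJ
      (Φ := fun a K Ls => (U d i0 K Ls - FF M p x * (p a ^ (ρ - 1) * W p (ρ - 1) k (Ls i0))) ^ 2)
      (fun a K => (((U_BM d i0 K).sub ((BM.const _).mul ((BM.const _).mul (W_BM _ _ _ _)))).pow 2))
      (fun a K Ls Ls' hh => by
        have h1 := W_NoRoot p (ρ - 1) k i0 Ls Ls' hh
        have h2 := U_NoRoot d i0 K Ls Ls' hh
        dsimp only at h1 h2 ⊢; rw [h1, h2])
      (fun a y => (1 + t) * (r * (y : ℝ) ^ (2 * (ρ - 1)) + C) + (1 + 1 / t) * ww M p ρ k * (FF M p y - p a ^ (ρ - 1) * FF M p x) ^ 2)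
      (fun a K hK => Z_bound h hμ d k i0 K _ _ _ t ht0 (by
        refine hD K.card d ?_ n i0 K (fun hh => hJ (hK hh)) rfl
        have h1 : D K.card ≤ (Finset.range (x + 1)).sup D := Finset.le_sup (f := D) (Finset.mem_range.2 (by
          have := Finset.card_le_card hK; omega))
        omega))
    have hZ2' : ∫ Ls, Z Ls ^ 2 ∂(Measure.pi fun _ : Fin n => μL) ≤ (1 + t) * (r * ∑ a, p a * Bop (p a) x (fun y => (y : ℝ) ^ (2 * (ρ - 1))) + C) +
        (1 + 1 / t) * ww M p ρ k * ∑ a, p a * Bop (p a) x (fun y => (FF M p y - p a ^ (ρ - 1) * FF M p x) ^ 2) := by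
      refine hZ2.trans (le_of_eq ?_)
      rw [hxJ]
      simp only [Bop_add, Bop_mul, Bop_const]
      simp only [mul_add, Finset.sum_add_distrib]
      rw [Finset.mul_sum, Finset.mul_sum, Finset.mul_sum, ← Finset.sum_mul, h.sum1, one_mul]
      congr 1
      · congr 1
        exact Finset.sum_congr rfl fun a _ => by ring
      · exact Finset.sum_congr rfl fun a _ => by ring
    have eκ : M * ∑ a, p a ^ (1 + 2 * (ρ - 1)) = kap M p ρ := by
      rw [kap]; congr 1; refine Finset.sum_congr rfl fun a _ => ?_; congr 1; ring
    rw [eκ] at hBK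
    set X := (x : ℝ) ^ (2 * (ρ - 1)) with hX
    have hX0 : 0 ≤ X := by positivity
    have g1 : M * ((1 + 1 / t) * ww M p ρ k * ∑ a, p a * Bop (p a) x (fun y => (FF M p y - p a ^ (ρ - 1) * FF M p x) ^ 2)) ≤ t * r * X := by
      calc _ ≤ M * ((1 + 1 / t) * ww M p ρ k * (δ * X)) := by gcongr
        _ ≤ M * ((1 + 1 / t) * (ww M p ρ k + 1) * (δ * X)) := by gcongr; linarith
        _ = _ := by rw [hδ]; field_simp
    have g2 : (1 + t) * r * (M * ∑ a, p a * Bop (p a) x (fun y => (y : ℝ) ^ (2 * (ρ - 1)))) ≤ (1 + t) * r * ((kap M p ρ + t) * X) := by gcongr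
    have g3 := mul_le_mul_of_nonneg_left hZ2' hM.le
    have g4 : (M:ℝ) * (M - 1) * (∫ Ls, Z Ls ∂(Measure.pi fun _ : Fin n => μL)) ^ 2 ≤ M * (M - 1) * (C2 + 1) ^ 2 := by
      have : 0 ≤ (M:ℝ) * (M - 1) := mul_nonneg hM.le (by linarith)
      gcongr
    have g5 : ((1 + t) * (kap M p ρ + t) + t) * (r * X) ≤ (1 + kap M p ρ) / 2 * (r * X) := by
      have : (1 + t) * (kap M p ρ + t) + t ≤ (1 + kap M p ρ) / 2 := by
        rw [ht]; nlinarith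
      gcongr
    linarith

lemma HH_small (h : Par M A p ρ) (hμ : IsLabelingMeasure p μL) {ε : ℝ} (hε : 0 < ε) : ∀ᶠ k in atTop, HH p ρ μL k ε := by
  obtain ⟨C, hC, hc⟩ := L2_crude h hμ 0
  have hκ := kap_lt h
  have hκ0 := kap_pos h
  have h0 : ∀ k : ℕ, HH p ρ μL k (((1 + kap M p ρ) / 2) ^ k * C) := by
    intro k
    induction k with
    | zero => exact ⟨0, le_rfl, fun x => ⟨0, fun d _ n i0 J hJ hx => by have := hc n d i0 J hJ; rw [hx] at this; simpa using this⟩⟩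
    | succ k ih =>
      have := HH_step h hμ (by positivity) ih
      rwa [← mul_assoc, ← pow_succ'] at this
  have h1 : Tendsto (fun k : ℕ => ((1 + kap M p ρ) / 2) ^ k * C) atTop (𝓝 (0 * C)) :=
    (tendsto_pow_atTop_nhds_zero_of_lt_one (by linarith) (by linarith)).mul_const _
  rw [zero_mul] at h1
  filter_upwards [h1.eventually_le_const hε] with k hk
  exact (h0 k).mono hk

end GT

open MeasureTheory ProbabilityTheory Filter Topology

namespace GT

variable {n M A : ℕ}

lemma occ_nil (L : List (Fin M) → Fin A) : Occurs L [] := fun t => absurd t.2 (by simp)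

lemma occ_cons (L : List (Fin M) → Fin A) (i : Fin M) (a : Fin A) (w : List (Fin M × Fin A)) :
    Occurs L ((i, a) :: w) ↔ L [i] = a ∧ Occurs (fun v => L (i :: v)) w := by
  unfold Occurs
  constructor
  · intro h
    refine ⟨by simpa using h ⟨0, by simp⟩, fun t => ?_⟩
    simpa using h ⟨t.1 + 1, by simp⟩
  · rintro ⟨h1, h2⟩ ⟨t, ht⟩
    cases t with
    | zero => simpa using h1
    | succ t => simpa using h2 ⟨t, by simpa using ht⟩

lemma occ_meas (w : List (Fin M × Fin A)) : MeasurableSet {L : List (Fin M) → Fin A | Occurs L w} := by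
  have : {L : List (Fin M) → Fin A | Occurs L w} = ⋂ t : Fin w.length, {L | L ((w.take (t.1 + 1)).map Prod.fst) = (w.get t).2} := by
    ext L; simp [Occurs]
  rw [this]
  exact MeasurableSet.iInter fun t => measurable_pi_apply _ (measurableSet_singleton _)

/-- words of length less than `d` -/
def Wd (M A : ℕ) : ℕ → Finset (List (Fin M × Fin A))
  | 0 => ∅
  | d + 1 => insert [] ((Finset.univ ×ˢ Wd M A d).image fun q => q.1 :: q.2)

lemma mem_Wd (d : ℕ) (w : List (Fin M × Fin A)) : w ∈ Wd M A d ↔ w.length < d := by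
  induction d generalizing w with
  | zero => simp [Wd]
  | succ d ih =>
    cases w with
    | nil => simp [Wd]
    | cons q w => simp [Wd, ih]

lemma sum_Wd (d : ℕ) (f : List (Fin M × Fin A) → ℝ) :
    ∑ w ∈ Wd M A (d + 1), f w = f [] + ∑ i, ∑ a, ∑ w ∈ Wd M A d, f ((i, a) :: w) := by
  rw [Wd, Finset.sum_insert (by simp), Finset.sum_image (fun x _ y _ h => by
    simp only [List.cons.injEq] at h; exact Prod.ext h.1 h.2), Finset.sum_product, Fintype.sum_prod_type]

open Classical in
/-- labelings containing a word -/
noncomputable def oc (J : Finset (Fin n)) (Ls : Fin n → List (Fin M) → Fin A) (w : List (Fin M × Fin A)) : Finset (Fin n) :=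
  J.filter fun j => Occurs (Ls j) w

open Classical in
/-- truncated size -/
noncomputable def Sd (d : ℕ) (J : Finset (Fin n)) (Ls : Fin n → List (Fin M) → Fin A) : ℝ :=
  ∑ w ∈ Wd M A d, if 2 ≤ (oc J Ls w).card then 1 else 0

open Classical in
lemma U_eq (d : ℕ) (i0 : Fin n) (J : Finset (Fin n)) (Ls : Fin n → List (Fin M) → Fin A) :
    U d i0 J Ls = ∑ w ∈ Wd M A d, if Occurs (Ls i0) w ∧ (oc J Ls w).card = 1 then 1 else 0 := by
  induction d generalizing J Ls with
  | zero => simp [U, Wd]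
  | succ d ih =>
    rw [sum_Wd, U_succ]
    congr 1
    · simp [occ_nil, oc]
    · refine Finset.sum_congr rfl fun i _ => ?_
      rw [Finset.sum_eq_single (Ls i0 [i])]
      · rw [Y, ih]
        refine Finset.sum_congr rfl fun w _ => ?_
        have e1 : oc J Ls ((i, Ls i0 [i]) :: w) = oc (agr i0 J (shift i Ls)) (shift i Ls) w := by
          ext j; rw [oc, oc, agr, Finset.mem_filter, Finset.mem_filter, Finset.mem_filter, occ_cons, and_assoc]; rfl
        rw [e1, occ_cons]
        simp only [true_and]
        rfl
      · intro a _ ha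
        refine Finset.sum_eq_zero fun w _ => ?_
        rw [if_neg]
        rintro ⟨h1, -⟩
        exact ha ((occ_cons _ _ _ _).1 h1).1.symm
      · simp

lemma Sd_insert (d : ℕ) (i0 : Fin n) (J : Finset (Fin n)) (hJ : i0 ∉ J) (Ls : Fin n → List (Fin M) → Fin A) :
    Sd d (insert i0 J) Ls = Sd d J Ls + U d i0 J Ls := by
  classical
  rw [U_eq, Sd, Sd, ← Finset.sum_add_distrib]
  refine Finset.sum_congr rfl fun w _ => ?_
  have h1 : i0 ∉ oc J Ls w := fun h => hJ (Finset.mem_filter.1 h).1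
  by_cases h : Occurs (Ls i0) w
  · have : oc (insert i0 J) Ls w = insert i0 (oc J Ls w) := by
      rw [oc, Finset.filter_insert, if_pos h]; rfl
    rw [this, Finset.card_insert_of_notMem h1]
    simp only [h, true_and]
    rcases Nat.lt_trichotomy (oc J Ls w).card 1 with h2 | h2 | h2
    · rw [if_neg (by omega), if_neg (by omega), if_neg (by omega)]; simp
    · rw [if_pos (by omega), if_neg (by omega), if_pos (by omega)]; simp
    · rw [if_pos (by omega), if_pos (by omega), if_neg (by omega)]; simp
  · have : oc (insert i0 J) Ls w = oc J Ls w := by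
      rw [oc, Finset.filter_insert, if_neg h]; rfl
    rw [this]; simp [h]

lemma Sd_nonneg (d : ℕ) (J : Finset (Fin n)) (Ls : Fin n → List (Fin M) → Fin A) : 0 ≤ Sd d J Ls :=
  Finset.sum_nonneg fun w _ => by split_ifs <;> norm_num

lemma Sd_empty (d : ℕ) (Ls : Fin n → List (Fin M) → Fin A) : Sd d ∅ Ls = 0 := by simp [Sd, oc]

lemma Sd_BM (d : ℕ) (J : Finset (Fin n)) : BM (Sd (M := M) (A := A) d J) := by
  classical
  induction J using Finset.induction_on with
  | empty =>
    have : Sd (M := M) (A := A) d (∅ : Finset (Fin n)) = fun _ => 0 := funext fun Ls => Sd_empty d Ls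
    rw [this]; exact BM.const 0
  | insert i J hi ih =>
    have : Sd (M := M) (A := A) d (insert i J) = fun Ls => Sd d J Ls + U d i J Ls := funext fun Ls => Sd_insert d i J hi Ls
    rw [this]; exact ih.add (U_BM d i J)

lemma Sd_update (d : ℕ) (J : Finset (Fin n)) (i : Fin n) (hi : i ∉ J) (Ls : Fin n → List (Fin M) → Fin A) (b : List (Fin M) → Fin A) :
    Sd d J (Function.update Ls i b) = Sd d J Ls := by
  classical
  unfold Sd
  refine Finset.sum_congr rfl fun w _ => ?_
  have : oc J (Function.update Ls i b) w = oc J Ls w := by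
    refine Finset.filter_congr fun j hj => ?_
    rw [Function.update_of_ne]; rintro rfl; exact hi hj
  rw [this]

lemma Sd_mono (J : Finset (Fin n)) (Ls : Fin n → List (Fin M) → Fin A) : Monotone fun d => Sd d J Ls := by
  intro d d' h
  refine Finset.sum_le_sum_of_subset_of_nonneg (fun w hw => ?_) fun w _ _ => by split_ifs <;> norm_num
  rw [mem_Wd] at hw ⊢; omega

lemma mem_GTrie (Ls : Fin n → List (Fin M) → Fin A) (w : List (Fin M × Fin A)) : w ∈ GTrie Ls ↔ 2 ≤ (oc Finset.univ Ls w).card := by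
  classical
  have : occCount Ls w = (oc Finset.univ Ls w).card := by
    rw [occCount, Nat.card_eq_fintype_card, Fintype.card_subtype]; rfl
  rw [GTrie, Set.mem_ofPred_eq, this]

open Classical in
lemma Sd_univ (d : ℕ) (Ls : Fin n → List (Fin M) → Fin A) : Sd d Finset.univ Ls = (((Wd M A d).filter (· ∈ GTrie Ls)).card : ℝ) := by
  rw [Finset.card_filter]
  push_cast
  simp only [mem_GTrie]
  rfl

lemma Sd_le (d : ℕ) (Ls : Fin n → List (Fin M) → Fin A) (hf : (GTrie Ls).Finite) : Sd d Finset.univ Ls ≤ gtrieSize Ls := by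
  classical
  rw [Sd_univ, gtrieSize, ← Set.ncard_coe_finset]
  exact_mod_cast Set.ncard_le_ncard (fun w hw => (Finset.mem_filter.1 hw).2) hf

lemma Sd_ev (Ls : Fin n → List (Fin M) → Fin A) (hf : (GTrie Ls).Finite) : ∀ᶠ d in atTop, Sd d Finset.univ Ls = gtrieSize Ls := by
  classical
  filter_upwards [eventually_gt_atTop (hf.toFinset.sup List.length)] with d hd
  rw [Sd_univ, gtrieSize, ← Set.ncard_coe_finset]
  congr 2
  ext w
  simp only [Finset.coe_filter, Set.mem_ofPred_eq, and_iff_right_iff_imp, mem_Wd]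
  intro hw
  exact lt_of_le_of_lt (Finset.le_sup (f := List.length) (hf.mem_toFinset.2 hw)) hd

lemma Sd_fin (Ls : Fin n → List (Fin M) → Fin A) (C : ℝ) (hC : ∀ d, Sd d Finset.univ Ls ≤ C) : (GTrie Ls).Finite := by
  classical
  by_contra hinf
  obtain ⟨s, hs, hc⟩ := (show (GTrie Ls).Infinite from hinf).exists_subset_card_eq (⌈C⌉₊ + 1)
  have h1 := hC (s.sup List.length + 1)
  rw [Sd_univ] at h1
  have h2 : s ⊆ (Wd M A (s.sup List.length + 1)).filter (· ∈ GTrie Ls) := fun w hw => by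
    rw [Finset.mem_filter, mem_Wd]
    exact ⟨Nat.lt_succ_of_le (Finset.le_sup (f := List.length) hw), hs hw⟩
  have h3 := Finset.card_le_card h2
  have h4 : ((s.card : ℕ) : ℝ) ≤ C := le_trans (by exact_mod_cast h3) h1
  rw [hc] at h4
  push_cast at h4
  linarith [Nat.le_ceil C]

variable {p : Fin A → ℝ} {ρ : ℝ} {μL : Measure (List (Fin M) → Fin A)} [IsProbabilityMeasure μL]

lemma Sd_mom (h : Par M A p ρ) (hμ : IsLabelingMeasure p μL) (m : ℕ) (J : Finset (Fin n)) : ∃ C ≥ 0, ∀ d,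
    ∫ Ls, Sd d J Ls ^ m ∂(Measure.pi fun _ : Fin n => μL) ≤ C := by
  classical
  induction J using Finset.induction_on with
  | empty => exact ⟨|(0:ℝ) ^ m|, abs_nonneg _, fun d => by simp only [Sd_empty]; rw [integral_const, probReal_univ, one_smul]; exact le_abs_self _⟩
  | insert i J hi ih =>
    obtain ⟨C, hC, ih⟩ := ih
    obtain ⟨C', hC', hU⟩ := U_mom h hμ m
    refine ⟨2 ^ (m - 1) * (C + C' * (J.card : ℝ) ^ ((ρ - 1) * m)), by positivity, fun d => ?_⟩
    calc _ ≤ ∫ Ls, 2 ^ (m - 1) * (Sd d J Ls ^ m + U d i J Ls ^ m) ∂(Measure.pi fun _ : Fin n => μL) := by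
          refine integral_mono (((Sd_BM d _).pow m).int _) (((BM.const _).mul (((Sd_BM d J).pow m).add ((U_BM d i J).pow m))).int _) fun Ls => ?_
          dsimp only
          rw [Sd_insert d i J hi]
          exact add_pow_le (Sd_nonneg _ _ _) (U_nonneg _ _ _ _) m
      _ = 2 ^ (m - 1) * (∫ Ls, Sd d J Ls ^ m ∂(Measure.pi fun _ : Fin n => μL) + ∫ Ls, U d i J Ls ^ m ∂(Measure.pi fun _ : Fin n => μL)) := by
          rw [integral_const_mul, integral_add (((Sd_BM d J).pow m).int _) (((U_BM d i J).pow m).int _)]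
      _ ≤ _ := by
          gcongr
          · exact ih d
          · exact hU n d i J hi

lemma G_int (h : Par M A p ρ) (hμ : IsLabelingMeasure p μL) (m : ℕ) :
    (∀ᵐ Ls ∂(Measure.pi fun _ : Fin n => μL), (GTrie Ls).Finite) ∧
    Integrable (fun Ls => gtrieSize Ls ^ m) (Measure.pi fun _ : Fin n => μL) := by
  set P := (Measure.pi fun _ : Fin n => μL) with hP
  have key : ∀ m, ∃ C ≥ 0, ∫⁻ Ls, ⨆ d, ENNReal.ofReal (Sd (M := M) (A := A) (n := n) d Finset.univ Ls ^ m) ∂P ≤ ENNReal.ofReal C := by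
    intro m
    obtain ⟨C, hC, hS⟩ := Sd_mom (n := n) h hμ m Finset.univ
    refine ⟨C, hC, ?_⟩
    rw [lintegral_iSup (fun d => ((Sd_BM d Finset.univ).pow m).meas.ennreal_ofReal)]
    · refine iSup_le fun d => ?_
      rw [← ofReal_integral_eq_lintegral_ofReal (((Sd_BM d Finset.univ).pow m).int _) (ae_of_all _ fun Ls => pow_nonneg (Sd_nonneg _ _ _) _)]
      exact ENNReal.ofReal_le_ofReal (hS d)
    · intro d d' hd Ls
      exact ENNReal.ofReal_le_ofReal (pow_le_pow_left₀ (Sd_nonneg _ _ _) (Sd_mono _ Ls hd) m)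
  have hfin : ∀ᵐ Ls ∂P, (GTrie Ls).Finite := by
    obtain ⟨C, hC, hS⟩ := key 1
    have : ∀ᵐ Ls ∂P, ⨆ d, ENNReal.ofReal (Sd (M := M) (A := A) (n := n) d Finset.univ Ls ^ 1) < ⊤ :=
      ae_lt_top (Measurable.iSup fun d => ((Sd_BM d Finset.univ).pow 1).meas.ennreal_ofReal) (ne_top_of_le_ne_top ENNReal.ofReal_ne_top hS)
    filter_upwards [this] with Ls hLs
    refine Sd_fin Ls (⨆ d, ENNReal.ofReal (Sd d Finset.univ Ls ^ 1)).toReal fun d => ?_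
    have h1 := le_iSup (fun d => ENNReal.ofReal (Sd d Finset.univ Ls ^ 1)) d
    have h2 := ENNReal.toReal_mono hLs.ne h1
    rw [ENNReal.toReal_ofReal (pow_nonneg (Sd_nonneg _ _ _) _), pow_one] at h2
    exact h2
  refine ⟨hfin, ?_⟩
  have hmeas : AEStronglyMeasurable (fun Ls : Fin n → List (Fin M) → Fin A => gtrieSize Ls ^ m) P := by
    refine aestronglyMeasurable_of_tendsto_ae atTop (fun d => ((Sd_BM d Finset.univ).pow m).meas.aestronglyMeasurable) ?_
    filter_upwards [hfin] with Ls hLs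
    exact tendsto_const_nhds.congr' ((Sd_ev Ls hLs).mono fun d hd => by dsimp only; rw [hd])
  refine ⟨hmeas, ?_⟩
  obtain ⟨C, hC, hS⟩ := key m
  rw [hasFiniteIntegral_iff_ofReal (ae_of_all _ fun Ls => pow_nonneg (by unfold gtrieSize; positivity) _)]
  refine lt_of_le_of_lt (le_trans (lintegral_mono_ae ?_) hS) ENNReal.ofReal_lt_top
  filter_upwards [hfin] with Ls hLs
  obtain ⟨d, hd⟩ := (Sd_ev Ls hLs).exists
  exact le_iSup_of_le d (by rw [hd])

lemma CM_lim (h : Par M A p ρ) (hμ : IsLabelingMeasure p μL) (m : ℕ) :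
    Tendsto (fun d => ∫ Ls, (Sd d Finset.univ Ls - ∫ Ls', Sd d Finset.univ Ls' ∂(Measure.pi fun _ : Fin n => μL)) ^ m ∂(Measure.pi fun _ : Fin n => μL)) atTop
      (𝓝 (∫ Ls, (gtrieSize Ls - ∫ Ls', gtrieSize Ls' ∂(Measure.pi fun _ : Fin n => μL)) ^ m ∂(Measure.pi fun _ : Fin n => μL))) := by
  set P := (Measure.pi fun _ : Fin n => μL) with hP
  have hfin := (G_int (n := n) h hμ 1).1
  have hintM := fun m => (G_int (n := n) h hμ m).2
  have hg0 : ∀ Ls : Fin n → List (Fin M) → Fin A, 0 ≤ gtrieSize Ls := fun Ls => by unfold gtrieSize; positivity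
  have h1 : Tendsto (fun d => ∫ Ls, Sd d Finset.univ Ls ∂P) atTop (𝓝 (∫ Ls, gtrieSize Ls ∂P)) := by
    have hi := hintM 1
    simp only [pow_one] at hi
    refine tendsto_integral_of_dominated_convergence (fun Ls => gtrieSize Ls) (fun d => (Sd_BM d _).meas.aestronglyMeasurable) hi (fun d => ?_) ?_
    · filter_upwards [hfin] with Ls hLs
      rw [Real.norm_eq_abs, abs_of_nonneg (Sd_nonneg _ _ _)]
      exact Sd_le d Ls hLs
    · filter_upwards [hfin] with Ls hLs
      exact tendsto_const_nhds.congr' ((Sd_ev Ls hLs).mono fun d hd => hd.symm)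
  obtain ⟨C, hC, hS⟩ := Sd_mom (n := n) h hμ 1 Finset.univ
  simp only [pow_one] at hS
  refine tendsto_integral_of_dominated_convergence (fun Ls => 2 ^ (m - 1) * (gtrieSize Ls ^ m + C ^ m)) (fun d => (((Sd_BM d _).sub (BM.const _)).pow m).meas.aestronglyMeasurable)
    (((hintM m).add (integrable_const _)).const_mul _) (fun d => ?_) ?_
  · filter_upwards [hfin] with Ls hLs
    rw [Real.norm_eq_abs, abs_pow]
    refine le_trans (pow_le_pow_left₀ (abs_nonneg _) ?_ m) (add_pow_le (hg0 Ls) hC m)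
    have h2 := Sd_le d Ls hLs
    have h3 := Sd_nonneg d Finset.univ Ls
    have h4 : 0 ≤ ∫ Ls', Sd d Finset.univ Ls' ∂P := integral_nonneg fun Ls => Sd_nonneg _ _ _
    rw [abs_le]; constructor <;> linarith [hS d, hg0 Ls]
  · filter_upwards [hfin] with Ls hLs
    exact ((tendsto_const_nhds.congr' ((Sd_ev Ls hLs).mono fun d hd => hd.symm)).sub h1).pow m

end GT

open MeasureTheory ProbabilityTheory Filter Topology

namespace GT

variable {M A : ℕ} {p : Fin A → ℝ} {ρ : ℝ} {μL : Measure (List (Fin M) → Fin A)} [IsProbabilityMeasure μL]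

lemma one_int {g : (List (Fin M) → Fin A) → ℝ} (hg : BM g) :
    ∫ L, g L ∂μL = ∫ Ls, g (Ls 0) ∂(Measure.pi fun _ : Fin 1 => μL) := by
  have h := measurePreserving_eval (fun _ : Fin 1 => μL) 0
  have e := integral_map (μ := Measure.pi fun _ : Fin 1 => μL) h.measurable.aemeasurable (f := g) hg.meas.aestronglyMeasurable
  rw [h.map_eq] at e
  exact e

lemma W1_mean (h : Par M A p ρ) (hμ : IsLabelingMeasure p μL) (k : ℕ) : ∫ L, (W p (ρ - 1) k L - 1) ∂μL = 0 := by
  rw [integral_sub ((W_BM1 _ _ _).int _) ((BM.const 1).int _), one_int (W_BM1 _ _ _), W_mean h hμ]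
  simp

lemma W1_sq (h : Par M A p ρ) (hμ : IsLabelingMeasure p μL) (k : ℕ) : ∫ L, (W p (ρ - 1) k L - 1) ^ 2 ∂μL = ww M p ρ k - 1 := by
  have e : ∀ L : List (Fin M) → Fin A, (W p (ρ - 1) k L - 1) ^ 2 = W p (ρ - 1) k L ^ 2 - 2 * (W p (ρ - 1) k L - 1) - 1 := fun L => by ring
  simp only [e]
  have b1 : BM (fun L : List (Fin M) → Fin A => W p (ρ - 1) k L ^ 2) := (W_BM1 _ _ _).pow 2
  have b2 : BM (fun L : List (Fin M) → Fin A => 2 * (W p (ρ - 1) k L - 1)) := (BM.const 2).mul ((W_BM1 _ _ _).sub (BM.const 1))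
  rw [integral_sub ((b1.sub b2).int _) ((BM.const 1).int _), integral_sub (b1.int _) (b2.int _), integral_const_mul, W1_mean h hμ, one_int b1, W_sq h hμ]
  simp

/-- variances -/
noncomputable def sk (M : ℕ) (p : Fin A → ℝ) (ρ : ℝ) (k : ℕ) : ℝ := √(ww M p ρ k - 1)

/-- linearization -/
noncomputable def Tk (p : Fin A → ℝ) (ρ : ℝ) {n : ℕ} (k : ℕ) (Ls : Fin n → List (Fin M) → Fin A) : ℝ :=
  FF M p n * ∑ i, (W p (ρ - 1) k (Ls i) - 1)

lemma Tk_BM (n k : ℕ) : BM (Tk (M := M) p ρ (n := n) k) :=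
  (BM.const _).mul (BM.sum _ fun i _ => (W_BM _ _ _ i).sub (BM.const 1))

/-- normalized profile -/
noncomputable def Fn (M : ℕ) (p : Fin A → ℝ) (ρ : ℝ) (n : ℕ) : ℝ := FF M p n / (n : ℝ) ^ (ρ - 1)

lemma Fn_bdd (h : Par M A p ρ) : ∃ C > 0, ∀ n, 0 ≤ Fn M p ρ n ∧ Fn M p ρ n ≤ C := by
  obtain ⟨C, hC, hF⟩ := FF_nat h
  refine ⟨C, hC, fun n => ⟨div_nonneg (FF_nonneg h (Nat.cast_nonneg _)) (by positivity), ?_⟩⟩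
  exact div_le_of_le_mul₀ (by positivity) hC.le (hF n)

lemma Nn_eq {n : ℕ} (hn : 1 ≤ n) (ρ : ℝ) : (n : ℝ) ^ (ρ - 1 / 2) = (n : ℝ) ^ (ρ - 1) * √n := by
  have : (0:ℝ) < n := by exact_mod_cast hn
  rw [Real.sqrt_eq_rpow, ← Real.rpow_add this]; congr 1; ring

lemma X3 (h : Par M A p ρ) (hμ : IsLabelingMeasure p μL) (k m : ℕ) :
    Tendsto (fun n : ℕ => (∫ Ls, Tk p ρ k Ls ^ m ∂(Measure.pi fun _ : Fin n => μL)) / ((n : ℝ) ^ (ρ - 1 / 2)) ^ m -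
      gaussianMoment m * sk M p ρ k ^ m * Fn M p ρ n ^ m) atTop (𝓝 0) := by
  obtain ⟨C, hC, hF⟩ := Fn_bdd h
  have h0 : 0 ≤ ww M p ρ k - 1 := by rw [← W1_sq h hμ]; exact integral_nonneg fun _ => sq_nonneg _
  have hc := clt μL (fun L => W p (ρ - 1) k L - 1) ((W_BM1 _ _ _).sub (BM.const 1)) (W1_mean h hμ k) (sk M p ρ k)
    (by rw [W1_sq h hμ, sk, Real.sq_sqrt h0]) m
  have hc2 := hc.sub_const (gaussianMoment m * sk M p ρ k ^ m)
  rw [sub_self] at hc2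
  have hb : Tendsto (fun n : ℕ => Fn M p ρ n ^ m * ((∫ ω, (∑ i, (W p (ρ - 1) k (ω i) - 1)) ^ m ∂(Measure.pi fun _ : Fin n => μL)) / √(n:ℝ) ^ m - gaussianMoment m * sk M p ρ k ^ m)) atTop (𝓝 0) := by
    refine bdd_le_mul_tendsto_zero' (C ^ m) ?_ hc2
    refine Eventually.of_forall fun n => ?_
    rw [abs_of_nonneg (pow_nonneg (hF n).1 _)]
    exact pow_le_pow_left₀ (hF n).1 (hF n).2 m
  refine hb.congr' ?_
  filter_upwards [eventually_ge_atTop 1] with n hn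
  have hn0 : (0:ℝ) < n := by exact_mod_cast hn
  simp only [Tk, mul_pow]
  rw [integral_const_mul, Nn_eq hn, mul_pow, Fn, div_pow]
  have : ((n:ℝ) ^ (ρ - 1)) ≠ 0 := by positivity
  have : √(n:ℝ) ≠ 0 := by positivity
  field_simp

lemma X1 (h : Par M A p ρ) (hμ : IsLabelingMeasure p μL) (m : ℕ) : ∃ B ≥ 0, ∀ n d : ℕ, 1 ≤ n →
    ∫ Ls, (Sd d Finset.univ Ls - ∫ Ls', Sd d Finset.univ Ls' ∂(Measure.pi fun _ : Fin n => μL)) ^ (2 * m) ∂(Measure.pi fun _ : Fin n => μL) ≤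
      B * ((n : ℝ) ^ (ρ - 1 / 2)) ^ (2 * m) := by
  rcases Nat.eq_zero_or_pos m with rfl | hm
  · exact ⟨1, zero_le_one, fun n d _ => by simp⟩
  obtain ⟨K, hK, hES⟩ := ES_even m hm
  obtain ⟨C, hC, hU⟩ := U_mom h hμ (2 * m)
  have hσ : 0 < ρ - 1 := by linarith [h.ρ1]
  refine ⟨K * C, by positivity, fun n d hn => ?_⟩
  have hn0 : (0:ℝ) < n := by exact_mod_cast hn
  refine (hES (List (Fin M) → Fin A) μL (C * (n:ℝ) ^ ((ρ - 1) * ((2 * m : ℕ) : ℝ))) (by positivity) n _ (fun i => U d i (Finset.univ.erase i)) (Sd_BM d _) (fun i => U_BM _ _ _) ?_ ?_).trans ?_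
  · intro i ω b
    have e : ∀ Ls : Fin n → List (Fin M) → Fin A, Sd d Finset.univ Ls - U d i (Finset.univ.erase i) Ls = Sd d (Finset.univ.erase i) Ls := fun Ls => by
      have := Sd_insert d i (Finset.univ.erase i) (by simp) Ls
      rw [Finset.insert_erase (Finset.mem_univ i)] at this
      rw [this]; ring
    rw [e, e, Sd_update _ _ _ (by simp)]
  · intro i
    refine (hU n d i _ (by simp)).trans ?_
    have : ((Finset.univ.erase i).card : ℝ) ≤ n := by
      rw [Finset.card_erase_of_mem (Finset.mem_univ i), Finset.card_univ, Fintype.card_fin]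
      exact_mod_cast Nat.sub_le _ _
    gcongr
  · rw [Nn_eq hn, mul_pow, ← Real.rpow_natCast ((n:ℝ) ^ (ρ - 1)), ← Real.rpow_mul hn0.le, pow_mul (√(n:ℝ)), Real.sq_sqrt hn0.le]
    exact le_of_eq (by ring)

lemma FF_pred (h : Par M A p ρ) : ∃ C > 0, ∀ n : ℕ, 4 ≤ n → (FF M p (n - 1 : ℕ) - FF M p n) ^ 2 ≤ C := by
  obtain ⟨C, hC, hF⟩ := FF_le' h
  have hσ : 0 < ρ - 1 := by linarith [h.ρ1]
  refine ⟨(12 * C) ^ 2, by positivity, fun n hn => ?_⟩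
  have hn0 : (4:ℝ) ≤ n := by exact_mod_cast hn
  have e : ((n - 1 : ℕ) : ℝ) - n = -1 := by rw [Nat.cast_sub (by omega)]; push_cast; ring
  have h1 := FF_lip h (y := n) (z := (n - 1 : ℕ)) (by linarith) (by rw [e]; norm_num; linarith)
  rw [e] at h1
  have h2 := hF (n / 2) (by linarith)
  have h3 : ((n:ℝ) / 2) ^ (ρ - 1) ≤ n := by
    calc ((n:ℝ) / 2) ^ (ρ - 1) ≤ (n:ℝ) ^ (ρ - 1) := by gcongr; linarith
      _ ≤ (n:ℝ) ^ (1:ℝ) := Real.rpow_le_rpow_of_exponent_le (by linarith) (by linarith [h.ρ2])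
      _ = n := Real.rpow_one _
  have h4 : |FF M p (n - 1 : ℕ) - FF M p n| ≤ 12 * C := by
    calc _ ≤ 12 * (|(-1:ℝ)| / n) * FF M p (n / 2) := h1
      _ ≤ 12 * (|(-1:ℝ)| / n) * (C * n) := by gcongr; exact h2.trans (by gcongr)
      _ = _ := by rw [abs_neg, abs_one]; field_simp
  rw [← sq_abs]; gcongr

lemma X2 (h : Par M A p ρ) (hμ : IsLabelingMeasure p μL) {k : ℕ} {r : ℝ} (hr : 0 < r) (H : HH p ρ μL k r) :
    ∀ᶠ n : ℕ in atTop, ∀ᶠ d : ℕ in atTop,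
    ∫ Ls, (Sd d Finset.univ Ls - ∫ Ls', Sd d Finset.univ Ls' ∂(Measure.pi fun _ : Fin n => μL) - Tk p ρ k Ls) ^ 2 ∂(Measure.pi fun _ : Fin n => μL) ≤
      9 * r * ((n : ℝ) ^ (ρ - 1 / 2)) ^ 2 := by
  obtain ⟨C, hC, H⟩ := H
  obtain ⟨C1, hC1, hF⟩ := FF_pred h
  have hσ : 0 < ρ - 1 := by linarith [h.ρ1]
  have hw := ww_nonneg h k
  have hlim : ∀ᶠ n : ℕ in atTop, 4 * (2 * C + 2 * C1 * ww M p ρ k) / r ≤ ((n:ℝ) ^ (ρ - 1)) := by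
    have : Tendsto (fun n : ℕ => ((n:ℝ) ^ (ρ - 1))) atTop atTop := (tendsto_rpow_atTop hσ).comp tendsto_natCast_atTop_atTop
    exact this.eventually_ge_atTop _
  filter_upwards [hlim, eventually_ge_atTop 4] with n hn hn4
  obtain ⟨d0, hd0⟩ := H (n - 1)
  filter_upwards [eventually_ge_atTop d0] with d hd
  have hn0 : (4:ℝ) ≤ n := by exact_mod_cast hn4
  have hnp : (0:ℝ) < n := by linarith
  set N1 := (n:ℝ) ^ (ρ - 1) with hN1
  have hN1' : 1 ≤ N1 := Real.one_le_rpow (by linarith) hσ.le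
  have hcard : ∀ i : Fin n, (Finset.univ.erase i).card = n - 1 := fun i => by
    rw [Finset.card_erase_of_mem (Finset.mem_univ i), Finset.card_univ, Fintype.card_fin]
  have hsq : ((n - 1 : ℕ) : ℝ) ^ (2 * (ρ - 1)) ≤ N1 ^ 2 := by
    rw [hN1, ← Real.rpow_natCast ((n:ℝ) ^ (ρ - 1)), ← Real.rpow_mul hnp.le]
    have e : (ρ - 1) * ((2 : ℕ) : ℝ) = 2 * (ρ - 1) := by push_cast; ring
    rw [e]
    have : ((n - 1 : ℕ) : ℝ) ≤ n := by exact_mod_cast Nat.sub_le _ _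
    gcongr
  set f : (Fin n → List (Fin M) → Fin A) → ℝ := fun Ls => Sd d Finset.univ Ls - FF M p n * ∑ i, W p (ρ - 1) k (Ls i) with hf
  have hWs : BM fun Ls : Fin n → List (Fin M) → Fin A => ∑ i, W p (ρ - 1) k (Ls i) := BM.sum _ fun i _ => W_BM _ _ _ i
  have hfB : BM f := (Sd_BM d _).sub ((BM.const _).mul hWs)
  have hfm : ∫ Ls, f Ls ∂(Measure.pi fun _ : Fin n => μL) = ∫ Ls', Sd d Finset.univ Ls' ∂(Measure.pi fun _ : Fin n => μL) - FF M p n * n := by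
    rw [hf, integral_sub ((Sd_BM d _).int _) (((BM.const _).mul hWs).int _), integral_const_mul, integral_finsetSum _ fun i _ => (W_BM _ _ _ i).int _]
    simp only [W_mean h hμ]
    simp
  have hrw : ∀ Ls : Fin n → List (Fin M) → Fin A, Sd d Finset.univ Ls - ∫ Ls', Sd d Finset.univ Ls' ∂(Measure.pi fun _ : Fin n => μL) - Tk p ρ k Ls =
      f Ls - ∫ Ls, f Ls ∂(Measure.pi fun _ : Fin n => μL) := fun Ls => by
    rw [hfm, hf, Tk, Finset.sum_sub_distrib]
    simp; ring
  simp only [hrw]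
  set X : Fin n → (Fin n → List (Fin M) → Fin A) → ℝ := fun i Ls => U d i (Finset.univ.erase i) Ls - FF M p n * W p (ρ - 1) k (Ls i) with hX
  refine (ES_two μL (2 * (r * N1 ^ 2 + C) + 2 * C1 * ww M p ρ k) (by positivity) n f X hfB (fun i => (U_BM _ _ _).sub ((BM.const _).mul (W_BM _ _ _ _))) ?_ ?_).trans ?_
  · intro i ω b
    have e : ∀ Ls : Fin n → List (Fin M) → Fin A, f Ls - X i Ls = Sd d (Finset.univ.erase i) Ls - FF M p n * ∑ j ∈ Finset.univ.erase i, W p (ρ - 1) k (Ls j) := fun Ls => by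
      have := Sd_insert d i (Finset.univ.erase i) (by simp) Ls
      rw [Finset.insert_erase (Finset.mem_univ i)] at this
      simp only [hf, hX]
      rw [this, ← Finset.add_sum_erase _ _ (Finset.mem_univ i)]; ring
    rw [e, e, Sd_update _ _ _ (by simp)]
    congr 2
    refine Finset.sum_congr rfl fun j hj => ?_
    rw [Function.update_of_ne (Finset.ne_of_mem_erase hj)]
  · intro i
    have hD := hd0 d hd n i (Finset.univ.erase i) (by simp) (hcard i)
    have b1 : BM fun Ls : Fin n → List (Fin M) → Fin A => Df p ρ d k i (Finset.univ.erase i) Ls ^ 2 := (Df_BM _ _ _ _).pow 2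
    have b2 : BM fun Ls : Fin n → List (Fin M) → Fin A => W p (ρ - 1) k (Ls i) ^ 2 := (W_BM _ _ _ _).pow 2
    calc _ ≤ ∫ Ls, (2 * Df p ρ d k i (Finset.univ.erase i) Ls ^ 2 + 2 * (FF M p (n - 1 : ℕ) - FF M p n) ^ 2 * W p (ρ - 1) k (Ls i) ^ 2) ∂(Measure.pi fun _ : Fin n => μL) := by
          refine integral_mono ((((U_BM _ _ _).sub ((BM.const _).mul (W_BM _ _ _ _))).pow 2).int _) ((((BM.const _).mul b1).add ((BM.const _).mul b2)).int _) fun Ls => ?_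
          simp only [Df, hcard]
          nlinarith [sq_nonneg ((U d i (Finset.univ.erase i) Ls - FF M p (n - 1 : ℕ) * W p (ρ - 1) k (Ls i)) - (FF M p (n - 1 : ℕ) - FF M p n) * W p (ρ - 1) k (Ls i))]
      _ = 2 * ∫ Ls, Df p ρ d k i (Finset.univ.erase i) Ls ^ 2 ∂(Measure.pi fun _ : Fin n => μL) + 2 * (FF M p (n - 1 : ℕ) - FF M p n) ^ 2 * ww M p ρ k := by
          rw [integral_add (((BM.const _).mul b1).int _) (((BM.const _).mul b2).int _), integral_const_mul, integral_const_mul, W_sq h hμ]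
      _ ≤ 2 * (r * N1 ^ 2 + C) + 2 * C1 * ww M p ρ k := by
          have := hF n hn4
          gcongr
          exact hD.trans (by gcongr)
  · rw [Nn_eq (by omega), mul_pow, Real.sq_sqrt hnp.le, ← hN1]
    rw [div_le_iff₀ hr] at hn
    have h5 : 4 * (2 * C + 2 * C1 * ww M p ρ k) ≤ r * N1 ^ 2 := by nlinarith [mul_pos hr (lt_of_lt_of_le one_pos hN1')]
    nlinarith

end GT

open MeasureTheory ProbabilityTheory Filter Topology

namespace GT

lemma pow_diff_pt (x y η : ℝ) (hη : 0 < η) (m : ℕ) :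
    |x ^ (m + 1) - y ^ (m + 1)| ≤ (m + 1) * (2 / η * (x - y) ^ 2 + η * (x ^ (2 * m) + y ^ (2 * m))) := by
  have h1 : |x ^ (m + 1) - y ^ (m + 1)| ≤ (m + 1) * (|x - y| * (|x| ^ m + |y| ^ m)) := by
    have := abs_pow_sub_pow_le x y (m + 1)
    simp only [Nat.add_sub_cancel] at this
    refine this.trans ?_
    have h2 : max |x| |y| ^ m ≤ |x| ^ m + |y| ^ m := by
      rcases max_choice |x| |y| with e | e <;> rw [e] <;> nlinarith [pow_nonneg (abs_nonneg x) m, pow_nonneg (abs_nonneg y) m]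
    push_cast
    calc |x - y| * (m + 1) * max |x| |y| ^ m ≤ |x - y| * (m + 1) * (|x| ^ m + |y| ^ m) := by gcongr
      _ = _ := by ring
  refine h1.trans ?_
  have key : ∀ z : ℝ, |x - y| * |z| ^ m ≤ 1 / η * (x - y) ^ 2 + η * z ^ (2 * m) := by
    intro z
    have e1 : z ^ (2 * m) = (|z| ^ m) ^ 2 := by rw [← pow_mul, mul_comm m 2, pow_mul, pow_mul, sq_abs]
    rw [e1, ← sq_abs (x - y)]
    set u := |x - y|
    set v := |z| ^ m
    have hs := Real.sq_sqrt hη.le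
    have hp := Real.sqrt_pos.mpr hη
    have : 1 / η * u ^ 2 + η * v ^ 2 - u * v = (u / √η - √η * v) ^ 2 + u * v := by
      have : (u / √η) ^ 2 = 1 / η * u ^ 2 := by rw [div_pow, hs]; ring
      have h3 : (√η * v) ^ 2 = η * v ^ 2 := by rw [mul_pow, hs]
      have h4 : u / √η * (√η * v) = u * v := by field_simp
      linear_combination (-1) * this - h3 + 2 * h4
    have : 0 ≤ u * v := mul_nonneg (abs_nonneg _) (pow_nonneg (abs_nonneg _) _)
    nlinarith [sq_nonneg (u / √η - √η * v)]
  gcongr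
  have := key x
  have := key y
  have e : 2 / η * (x - y) ^ 2 = 1 / η * (x - y) ^ 2 + 1 / η * (x - y) ^ 2 := by ring
  rw [e]
  linarith

lemma pow_diff {Ω : Type*} [MeasurableSpace Ω] (μ : Measure Ω) [IsProbabilityMeasure μ] {a b : Ω → ℝ} (ha : BM a) (hb : BM b)
    {η : ℝ} (hη : 0 < η) (m : ℕ) :
    |∫ ω, a ω ^ (m + 1) ∂μ - ∫ ω, b ω ^ (m + 1) ∂μ| ≤
      (m + 1) * (2 / η * ∫ ω, (a ω - b ω) ^ 2 ∂μ + η * (∫ ω, a ω ^ (2 * m) ∂μ + ∫ ω, b ω ^ (2 * m) ∂μ)) := by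
  rw [← integral_sub ((ha.pow _).int μ) ((hb.pow _).int μ)]
  refine (abs_integral_le_integral_abs).trans ?_
  have b1 : BM fun ω => (a ω - b ω) ^ 2 := (ha.sub hb).pow 2
  have b2 : BM fun ω => a ω ^ (2 * m) := ha.pow _
  have b3 : BM fun ω => b ω ^ (2 * m) := hb.pow _
  rw [← integral_add (b2.int μ) (b3.int μ), ← integral_const_mul, ← integral_const_mul,
    ← integral_add (((BM.const _).mul b1).int μ) (((BM.const _).mul (b2.add b3)).int μ), ← integral_const_mul]
  exact integral_mono ((((ha.pow _).sub (hb.pow _)).abs).int μ)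
    (((BM.const _).mul (((BM.const _).mul b1).add ((BM.const _).mul (b2.add b3)))).int μ) fun ω => pow_diff_pt _ _ _ hη m

lemma pow_diff_scaled {Ω : Type*} [MeasurableSpace Ω] (μ : Measure Ω) [IsProbabilityMeasure μ] {a b : Ω → ℝ} (ha : BM a) (hb : BM b)
    {η N : ℝ} (hη : 0 < η) (m : ℕ) :
    |(∫ ω, a ω ^ (m + 1) ∂μ) / N ^ (m + 1) - (∫ ω, b ω ^ (m + 1) ∂μ) / N ^ (m + 1)| ≤
      (m + 1) * (2 / η * ((∫ ω, (a ω - b ω) ^ 2 ∂μ) / N ^ 2) + η * ((∫ ω, a ω ^ (2 * m) ∂μ) / N ^ (2 * m) + (∫ ω, b ω ^ (2 * m) ∂μ) / N ^ (2 * m))) := by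
  have := pow_diff μ (ha.mul (BM.const N⁻¹)) (hb.mul (BM.const N⁻¹)) hη m
  simp only [← div_eq_mul_inv, ← sub_div, div_pow, integral_div] at this
  simpa only [← sub_div] using this

variable {M A : ℕ} {p : Fin A → ℝ} {ρ : ℝ} {μL : Measure (List (Fin M) → Fin A)} [IsProbabilityMeasure μL]

lemma gm_nonneg (m : ℕ) : 0 ≤ gaussianMoment m := by
  unfold gaussianMoment; split_ifs <;> positivity

lemma sk_lim (h : Par M A p ρ) : Tendsto (sk M p ρ) atTop (𝓝 (√(((M : ℝ) - 1) / (M * (1 - kap M p ρ)) - 1))) :=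
  (Real.continuous_sqrt.tendsto _).comp ((ww_lim h).sub_const 1)

lemma X4 (h : Par M A p ρ) (hμ : IsLabelingMeasure p μL) (m : ℕ) :
    Tendsto (fun n : ℕ => (∫ Ls, (gtrieSize Ls - ∫ Ls', gtrieSize Ls' ∂(Measure.pi fun _ : Fin n => μL)) ^ m ∂(Measure.pi fun _ : Fin n => μL)) / ((n : ℝ) ^ (ρ - 1 / 2)) ^ m -
      gaussianMoment m * √(((M : ℝ) - 1) / (M * (1 - kap M p ρ)) - 1) ^ m * Fn M p ρ n ^ m) atTop (𝓝 0) := by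
  rcases m with _ | m
  · simp [gaussianMoment]
  have hs := sk_lim h
  set s := √(((M : ℝ) - 1) / (M * (1 - kap M p ρ)) - 1) with hsdef
  have hs0 : 0 ≤ s := Real.sqrt_nonneg _
  obtain ⟨C, hC, hF⟩ := Fn_bdd h
  obtain ⟨B, hB, hX1⟩ := X1 h hμ m
  rw [Metric.tendsto_nhds]
  intro ε hε
  set g := gaussianMoment (m + 1)
  have hg : 0 ≤ g := gm_nonneg _
  have hg2 := gm_nonneg (2 * m)
  set B' := gaussianMoment (2 * m) * (s + 1) ^ (2 * m) * C ^ (2 * m) + 1 with hB'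
  have hB'0 : 0 ≤ B' := by positivity
  set η := ε / (4 * (m + 1) * (B + B' + 1)) with hη
  have hη0 : 0 < η := by positivity
  set r := ε * η / (72 * (m + 1)) with hr
  have hr0 : 0 < r := by positivity
  have e1 : ∀ᶠ k in atTop, sk M p ρ k ≤ s + 1 := hs.eventually_le_const (by linarith)
  have e2 : ∀ᶠ k in atTop, g * C ^ (m + 1) * |sk M p ρ k ^ (m + 1) - s ^ (m + 1)| < ε / 4 := by
    have : Tendsto (fun k => g * C ^ (m + 1) * |sk M p ρ k ^ (m + 1) - s ^ (m + 1)|) atTop (𝓝 (g * C ^ (m + 1) * |s ^ (m + 1) - s ^ (m + 1)|)) :=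
      (((hs.pow _).sub_const _).abs).const_mul _
    rw [sub_self, abs_zero, mul_zero] at this
    exact this.eventually_lt_const (by positivity)
  obtain ⟨k, hk1, hk2, hk3⟩ := (e1.and (e2.and (HH_small h hμ hr0))).exists
  have hsk0 : 0 ≤ sk M p ρ k := Real.sqrt_nonneg _
  have x3 := (Metric.tendsto_nhds.mp (X3 h hμ k (m + 1))) (ε / 4) (by positivity)
  have x3' := (Metric.tendsto_nhds.mp (X3 h hμ k (2 * m))) 1 one_pos
  filter_upwards [x3, x3', X2 h hμ hr0 hk3, eventually_ge_atTop 1] with n h3 h3' h2 hn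
  rw [Real.dist_eq, sub_zero] at h3 h3' ⊢
  set P := (Measure.pi fun _ : Fin n => μL) with hP
  set N := (n : ℝ) ^ (ρ - 1 / 2) with hN
  have hn0 : (0 : ℝ) < n := by exact_mod_cast hn
  have hN0 : 0 < N := Real.rpow_pos_of_pos hn0 _
  obtain ⟨hF0, hFC⟩ := hF n
  have hT : (∫ Ls, Tk p ρ k Ls ^ (2 * m) ∂P) / N ^ (2 * m) ≤ B' := by
    have h5 : gaussianMoment (2 * m) * sk M p ρ k ^ (2 * m) * Fn M p ρ n ^ (2 * m) ≤ gaussianMoment (2 * m) * (s + 1) ^ (2 * m) * C ^ (2 * m) := by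
      gcongr
    have := (abs_lt.mp h3').2
    linarith
  have hlim : |(∫ Ls, (gtrieSize Ls - ∫ Ls', gtrieSize Ls' ∂P) ^ (m + 1) ∂P) / N ^ (m + 1) - (∫ Ls, Tk p ρ k Ls ^ (m + 1) ∂P) / N ^ (m + 1)| ≤ ε / 2 := by
    refine le_of_tendsto ((((CM_lim h hμ (m + 1)).div_const (N ^ (m + 1))).sub_const _).abs) ?_
    filter_upwards [h2] with d hd
    refine (pow_diff_scaled P ((Sd_BM d _).sub (BM.const _)) (Tk_BM n k) hη0 m).trans ?_
    have q1 : (∫ Ls, (Sd d Finset.univ Ls - ∫ Ls', Sd d Finset.univ Ls' ∂P - Tk p ρ k Ls) ^ 2 ∂P) / N ^ 2 ≤ 9 * r := by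
      rw [div_le_iff₀ (by positivity)]; exact hd
    have q2 : (∫ Ls, (Sd d Finset.univ Ls - ∫ Ls', Sd d Finset.univ Ls' ∂P) ^ (2 * m) ∂P) / N ^ (2 * m) ≤ B := by
      rw [div_le_iff₀ (by positivity)]; exact hX1 n d hn
    calc _ ≤ ((m : ℝ) + 1) * (2 / η * (9 * r) + η * (B + B')) := by gcongr
      _ ≤ ((m : ℝ) + 1) * (2 / η * (9 * r) + η * (B + B' + 1)) := by
          have h6 : B + B' ≤ B + B' + 1 := by linarith
          exact mul_le_mul_of_nonneg_left (add_le_add le_rfl (mul_le_mul_of_nonneg_left h6 hη0.le)) (by positivity)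
      _ = ε / 2 := by
        have : (m : ℝ) + 1 ≠ 0 := by positivity
        have h7 : B + B' + 1 ≠ 0 := by positivity
        have h8 : η * (B + B' + 1) = ε / (4 * (m + 1)) := by rw [hη]; field_simp
        rw [h8, hr]
        field_simp
        ring
  have h9 : |g * sk M p ρ k ^ (m + 1) * Fn M p ρ n ^ (m + 1) - g * s ^ (m + 1) * Fn M p ρ n ^ (m + 1)| < ε / 4 := by
    refine lt_of_le_of_lt ?_ hk2
    rw [show g * sk M p ρ k ^ (m + 1) * Fn M p ρ n ^ (m + 1) - g * s ^ (m + 1) * Fn M p ρ n ^ (m + 1) =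
      g * Fn M p ρ n ^ (m + 1) * (sk M p ρ k ^ (m + 1) - s ^ (m + 1)) by ring, abs_mul, abs_of_nonneg (by positivity : 0 ≤ g * Fn M p ρ n ^ (m + 1))]
    gcongr
  rw [abs_le] at hlim
  rw [abs_lt] at h3 h9 ⊢
  constructor <;> linarith [hlim.1, hlim.2, h3.1, h3.2, h9.1, h9.2]

lemma c_pos (h : Par M A p ρ) : 0 < ((M : ℝ) - 1) / (M * (1 - kap M p ρ)) - 1 := by
  have hM := h.Mpos
  have hk := kap_lt h
  have key : 1 < M * kap M p ρ := by
    have e : ∀ a, p a * (p a ^ (ρ - 1) - 1 / M) ^ 2 = p a ^ (2 * ρ - 1) - 2 / M * p a ^ ρ + 1 / M ^ 2 * p a := fun a => by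
      have h0 := h.p0 a
      have e1 : p a ^ (2 * ρ - 1) = p a * (p a ^ (ρ - 1)) ^ 2 := by
        rw [← Real.rpow_natCast (p a ^ (ρ - 1)), ← Real.rpow_mul h0.le]
        nth_rw 2 [← Real.rpow_one (p a)]
        rw [← Real.rpow_add h0]; congr 1; push_cast; ring
      have e2 : p a ^ ρ = p a * p a ^ (ρ - 1) := by
        nth_rw 2 [← Real.rpow_one (p a)]
        rw [← Real.rpow_add h0]; congr 1; ring
      rw [e1, e2]; ring
    have hsum : ∑ a, p a * (p a ^ (ρ - 1) - 1 / M) ^ 2 = (M * kap M p ρ - 1) / M ^ 2 := by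
      simp only [e, Finset.sum_add_distrib, Finset.sum_sub_distrib, ← Finset.mul_sum]
      have h1 := h.hρ
      have h2 : ∑ a, p a ^ ρ = 1 / M := by field_simp; linarith
      rw [h2, h.sum1, kap]
      field_simp
      ring
    have hpos : 0 < ∑ a, p a * (p a ^ (ρ - 1) - 1 / M) ^ 2 := by
      obtain ⟨j₁, j₂, hj⟩ := h.nonunif
      have hne : ∃ j, p j ^ (ρ - 1) ≠ 1 / M := by
        by_contra! hcon
        apply hj
        have := (hcon j₁).trans (hcon j₂).symm
        exact (Real.rpow_left_inj (h.p0 _).le (h.p0 _).le (by linarith [h.ρ1])).mp this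
      obtain ⟨j, hj⟩ := hne
      refine Finset.sum_pos' (fun a _ => mul_nonneg (h.p0 a).le (sq_nonneg _)) ⟨j, Finset.mem_univ _, mul_pos (h.p0 j) ?_⟩
      have := sub_ne_zero.mpr hj
      positivity
    rw [hsum] at hpos
    have := (div_pos_iff_of_pos_right (by positivity)).mp hpos
    linarith
  rw [sub_pos, lt_div_iff₀ (mul_pos hM (by linarith))]
  nlinarith

lemma Fn_tsum (h : Par M A p ρ) (m : ℕ) : Tendsto (fun n : ℕ => ((Fn M p ρ n : ℝ) : ℂ) ^ m -
    ((∑' β : rootsLine M A p ρ, (β : ℂ) * GE M A p β * (n : ℂ) ^ ((β : ℂ) - 1)) / (((n : ℝ) ^ (ρ - 1) : ℝ) : ℂ)) ^ m) atTop (𝓝 0) := by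
  obtain ⟨C, hC, hF⟩ := Fn_bdd h
  have hd : Tendsto (fun n : ℕ => ((Fn M p ρ n : ℝ) : ℂ) -
    ((∑' β : rootsLine M A p ρ, (β : ℂ) * GE M A p β * (n : ℂ) ^ ((β : ℂ) - 1)) / (((n : ℝ) ^ (ρ - 1) : ℝ) : ℂ))) atTop (𝓝 0) := by
    refine (FF_roots h).congr fun n => ?_
    rw [sub_div, Fn]; push_cast; rfl
  set u : ℕ → ℂ := fun n => ((Fn M p ρ n : ℝ) : ℂ)
  set v : ℕ → ℂ := fun n => ((∑' β : rootsLine M A p ρ, (β : ℂ) * GE M A p β * (n : ℂ) ^ ((β : ℂ) - 1)) / (((n : ℝ) ^ (ρ - 1) : ℝ) : ℂ))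
  change Tendsto (fun n => u n ^ m - v n ^ m) atTop (𝓝 0)
  have hu : ∀ n, ‖u n‖ ≤ C := fun n => by
    simp only [u, Complex.norm_real, Real.norm_eq_abs]
    rw [abs_of_nonneg (hF n).1]; exact (hF n).2
  induction m with
  | zero => simp
  | succ m ih =>
    have hum : IsBoundedUnder (· ≤ ·) atTop (fun n => ‖u n‖) := isBoundedUnder_of ⟨C, hu⟩
    have hvm : IsBoundedUnder (· ≤ ·) atTop (fun n => ‖v n ^ m‖) := by
      have : ∀ᶠ n in atTop, ‖u n ^ m - v n ^ m‖ ≤ 1 := by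
        have := ih.norm; rw [norm_zero] at this
        exact this.eventually_le_const one_pos
      refine ⟨C ^ m + 1, ?_⟩
      rw [eventually_map]
      filter_upwards [this] with n hn
      have h1 : ‖u n ^ m‖ ≤ C ^ m := by rw [norm_pow]; gcongr; exact hu n
      have := norm_sub_norm_le (v n ^ m) (u n ^ m)
      rw [norm_sub_rev] at this
      linarith
    have t1 := Filter.Tendsto.zero_mul_isBoundedUnder_le ih hum
    have t2 := Filter.Tendsto.zero_mul_isBoundedUnder_le hd hvm
    have := t1.add t2
    rw [add_zero] at this
    exact this.congr fun n => by ring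

end GT

open MeasureTheory ProbabilityTheory Filter Topology

/-- **Central moments of the size of a G-trie, non-uniform case** (Proposition 6).
If not all `p_j` are equal and `ρ > 1`, then `c = (M-1)/(M·P(2ρ-1)) - 1 > 0` and for
every `m ≥ 0`,
`E[(S_n-E(S_n))^m] = g_m c^{m/2} (∑_{β∈S_ρ} β G_E(β) n^{β-1})^m n^{m/2} + o(n^{(ρ-1/2)m})`. -/
theorem gtrie_central_moments_nonuniform_case
    {M A : ℕ} (hM : 1 ≤ M) (hA : 2 ≤ A)
    (p : Fin A → ℝ) (hp0 : ∀ j, 0 < p j) (hp1 : ∀ j, p j < 1)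
    (hpsum : ∑ j, p j = 1)
    (hnonexp : ∑ j, (p j) ^ 2 < 1 / (M : ℝ))
    (hnonunif : ∃ j₁ j₂, p j₁ ≠ p j₂)
    (ρ : ℝ) (hρ : ∑ j, (p j) ^ ρ = 1 / (M : ℝ)) (hρ1 : 1 < ρ)
    (μL : Measure (List (Fin M) → Fin A)) [IsProbabilityMeasure μL]
    (hμL : IsLabelingMeasure p μL)
    (μ : (n : ℕ) → Measure (Fin n → List (Fin M) → Fin A))
    (hμ : ∀ n, μ n = Measure.pi fun _ => μL)
    (E : ℕ → ℝ)
    (hE : ∀ n, E n = ∫ Ls, gtrieSize Ls ∂(μ n))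
    (CM : ℕ → ℕ → ℝ)
    (hCM : ∀ m n, CM m n = ∫ Ls, (gtrieSize Ls - E n) ^ m ∂(μ n))
    (c : ℝ)
    (hc : c = ((M : ℝ) - 1) / ((M : ℝ) * (1 - (M : ℝ) * ∑ j, (p j) ^ (2 * ρ - 1))) - 1) :
    0 < c ∧
    ∀ m : ℕ,
      (fun n : ℕ => (CM m n : ℂ) -
          ((gaussianMoment m * c ^ ((m : ℝ) / 2) * (n : ℝ) ^ ((m : ℝ) / 2) : ℝ) : ℂ) *
            (∑' β : rootsLine M A p ρ, (β : ℂ) * GE M A p β * (n : ℂ) ^ ((β : ℂ) - 1)) ^ m)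
        =o[atTop] (fun n : ℕ => (n : ℝ) ^ ((ρ - 1 / 2) * (m : ℝ))) := by
  have hM0 : (0 : ℝ) < M := by exact_mod_cast hM
  have hρ2 : ρ < 2 := by
    by_contra! hcon
    have : ∑ j, p j ^ ρ ≤ ∑ j, p j ^ 2 := by
      refine Finset.sum_le_sum fun j _ => ?_
      rw [← Real.rpow_natCast (p j) 2]
      exact Real.rpow_le_rpow_of_exponent_ge (hp0 j) (hp1 j).le (by exact_mod_cast hcon)
    rw [hρ] at this
    linarith
  have h : GT.Par M A p ρ :=
    { hM := hM, p0 := hp0, p1 := hp1, sum1 := hpsum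
      sum2 := by
        rw [lt_div_iff₀ hM0] at hnonexp
        simp only [← sq]; linarith
      hρ := by rw [hρ]; field_simp
      ρ1 := hρ1, ρ2 := hρ2, nonunif := hnonunif }
  have hc' : c = ((M : ℝ) - 1) / (M * (1 - GT.kap M p ρ)) - 1 := hc
  have hcpos : 0 < c := by rw [hc']; exact GT.c_pos h
  refine ⟨hcpos, fun m => ?_⟩
  have x4 := GT.X4 h hμL m
  rw [← hc'] at x4
  have ft := GT.Fn_tsum h m
  have hcm : c ^ ((m : ℝ) / 2) = √c ^ m := by
    rw [Real.sqrt_eq_rpow, ← Real.rpow_natCast, ← Real.rpow_mul hcpos.le]; congr 1; ring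
  have x4c : Tendsto (fun n : ℕ => (((CM m n / ((n : ℝ) ^ (ρ - 1 / 2)) ^ m - gaussianMoment m * √c ^ m * GT.Fn M p ρ n ^ m : ℝ)) : ℂ)) atTop (𝓝 0) := by
    have := (Complex.continuous_ofReal.tendsto 0).comp x4
    rw [Complex.ofReal_zero] at this
    refine this.congr fun n => ?_
    simp only [Function.comp, hCM, hE, hμ]
  have tot := x4c.add (ft.const_mul ((gaussianMoment m * √c ^ m : ℝ) : ℂ))
  rw [mul_zero, add_zero] at tot
  rw [Asymptotics.isLittleO_iff]
  intro ε hε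
  have tn := tot.norm
  rw [norm_zero] at tn
  filter_upwards [tn.eventually_le_const hε, eventually_ge_atTop 1] with n hn hn1
  have hn0 : (0 : ℝ) < n := by exact_mod_cast hn1
  set T : ℂ := ∑' β : rootsLine M A p ρ, (β : ℂ) * GE M A p β * (n : ℂ) ^ ((β : ℂ) - 1) with hT
  have hnm : (n : ℝ) ^ ((m : ℝ) / 2) = √(n : ℝ) ^ m := by
    rw [Real.sqrt_eq_rpow, ← Real.rpow_natCast, ← Real.rpow_mul hn0.le]; congr 1; ring
  have hN : (n : ℝ) ^ ((ρ - 1 / 2) * (m : ℝ)) = ((n : ℝ) ^ (ρ - 1 / 2)) ^ m := by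
    rw [← Real.rpow_natCast, ← Real.rpow_mul hn0.le]
  have hN2 := GT.Nn_eq hn1 ρ
  rw [hcm, hnm, hN]
  set N := (n : ℝ) ^ (ρ - 1 / 2) with hNdef
  set Q := (n : ℝ) ^ (ρ - 1) with hQ
  have hQ0 : 0 < Q := Real.rpow_pos_of_pos hn0 _
  have hq0 : 0 < √(n : ℝ) := Real.sqrt_pos.mpr hn0
  have hN0 : 0 < N := Real.rpow_pos_of_pos hn0 _
  have e : (CM m n : ℂ) - ((gaussianMoment m * √c ^ m * √(n : ℝ) ^ m : ℝ) : ℂ) * T ^ m =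
      ((N ^ m : ℝ) : ℂ) * ((((CM m n / N ^ m - gaussianMoment m * √c ^ m * GT.Fn M p ρ n ^ m : ℝ)) : ℂ) +
        ((gaussianMoment m * √c ^ m : ℝ) : ℂ) * (((GT.Fn M p ρ n : ℝ) : ℂ) ^ m - (T / (Q : ℂ)) ^ m)) := by
    have hNc : (N : ℂ) = (Q : ℂ) * ((√(n : ℝ) : ℝ) : ℂ) := by rw [hN2]; push_cast; rfl
    have hQc : (Q : ℂ) ≠ 0 := by exact_mod_cast hQ0.ne'
    have hqc : ((√(n : ℝ) : ℝ) : ℂ) ≠ 0 := by exact_mod_cast hq0.ne'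
    push_cast
    have hQm := pow_ne_zero m hQc
    have hqm := pow_ne_zero m hqc
    rw [hNc, div_pow, mul_pow]
    field_simp
    ring
  rw [e, norm_mul, Complex.norm_real, mul_comm]
  exact mul_le_mul_of_nonneg_right hn (norm_nonneg _)
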